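/- arXiv:0809.1640 — 3 statements merged into one kernel-verified Lean document; each statement's English description precedes it below -/
import Mathlib

section
/- For every integer m ≥ 1 and every real ε with 0 < ε < 1 there exist a constant C > 0 and a threshold x₀ (depending only on m and ε) such that the following holds. Let λ₁, λ₂ : ℕ₊ → ℂ be multiplicative functions satisfying |λᵢ(n)| ≤ τ_m(n) for all n ≥ 1 and i = 1, 2. Let x ≥ x₀, set s := ε log log x, z := x^{1/s} and y := x^ε, and let ℓ be a nonzero integer with |ℓ| ≤ x. Then the sum of |λ₁(n) λ₂(n + ℓ)| over those positive integers n ≤ x with n + ℓ ≥ 1 for which the z-smooth part of n is ≤ y and the z-smooth part of n + ℓ is ≤ y is at most C · x · (log x)^{ε - 2} · Π_{p ≤ z, p prime} (1 + |λ₁(p)|/p)(1 + |λ₂(p)|/p) · τ(|ℓ|). -/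
open scoped Classical

/-- `tauM m n` is `τ_m(n)`: the number of ordered `m`-tuples `(d₁, …, d_m)` of positive
integers with `d₁ ⋯ d_m = n`. -/
def tauM (m n : ℕ) : ℕ :=
  ((Fintype.piFinset fun _ : Fin m => Finset.Icc 1 n).filter fun t => ∏ i, t i = n).card

/-- The `z`-smooth part of a positive integer `n`: the product of `p ^ v_p(n)` over the
primes `p ≤ z` dividing `n`, i.e. the largest `z`-smooth divisor of `n`. -/
noncomputable def smoothPart (z : ℝ) (n : ℕ) : ℕ :=
  ∏ p ∈ n.primeFactors.filter fun p : ℕ => (p : ℝ) ≤ z, p ^ n.factorization p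

lemma tau_mem {m n : ℕ} (hn : 1 ≤ n) (t : Fin m → ℕ) :
    t ∈ ((Fintype.piFinset fun _ : Fin m => Finset.Icc 1 n).filter fun t => ∏ i, t i = n) ↔
      ∏ i, t i = n := by
  simp only [Finset.mem_filter, Fintype.mem_piFinset, Finset.mem_Icc, and_iff_right_iff_imp]
  intro h i
  have hd : t i ∣ n := h ▸ Finset.dvd_prod_of_mem t (Finset.mem_univ i)
  exact ⟨Nat.pos_of_dvd_of_pos hd hn, Nat.le_of_dvd hn hd⟩

lemma tau_split (m : ℕ) : ∀ (t : Fin m → ℕ) (a b : ℕ), 1 ≤ a → 1 ≤ b → ∏ i, t i = a * b →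
    ∃ u v : Fin m → ℕ, (∀ i, u i * v i = t i) ∧ ∏ i, u i = a ∧ ∏ i, v i = b := by
  induction m with
  | zero =>
    intro t a b ha hb h
    simp at h
    have h1 := h.symm
    rw [mul_eq_one] at h1
    exact ⟨t, t, fun i => i.elim0, by simp [h1.1], by simp [h1.2]⟩
  | succ m ih =>
    intro t a b ha hb h
    rw [Fin.prod_univ_succ] at h
    obtain ⟨a1, b1, ha1, hb1, h0⟩ := exists_dvd_and_dvd_of_dvd_mul (Dvd.intro _ h)
    obtain ⟨a2, rfl⟩ := ha1
    obtain ⟨b2, rfl⟩ := hb1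
    have ha1 : 0 < a1 := Nat.pos_of_mul_pos_right ha
    have hb1 : 0 < b1 := Nat.pos_of_mul_pos_right hb
    have ha2 : 0 < a2 := Nat.pos_of_mul_pos_left ha
    have hb2 : 0 < b2 := Nat.pos_of_mul_pos_left hb
    have h3 : ∏ i : Fin m, t i.succ = a2 * b2 := by
      apply Nat.eq_of_mul_eq_mul_left (Nat.mul_pos ha1 hb1)
      rw [← h0, h, h0]; ring
    obtain ⟨u, v, huv, hu, hv⟩ := ih (fun i => t i.succ) a2 b2 ha2 hb2 h3
    refine ⟨Fin.cons a1 u, Fin.cons b1 v, ?_, ?_, ?_⟩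
    · intro i
      refine Fin.cases ?_ ?_ i
      · simp [h0]
      · intro j; simpa using huv j
    · rw [Fin.prod_univ_succ]; simp [hu]
    · rw [Fin.prod_univ_succ]; simp [hv]

lemma tau_mul_le (m a b : ℕ) (ha : 1 ≤ a) (hb : 1 ≤ b) :
    tauM m (a * b) ≤ tauM m a * tauM m b := by
  unfold tauM
  rw [← Finset.card_product]
  apply Finset.card_le_card_of_surjOn (fun q : (Fin m → ℕ) × (Fin m → ℕ) => fun i => q.1 i * q.2 i)
  intro t ht
  rw [Finset.mem_coe, tau_mem (Nat.mul_pos ha hb)] at ht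
  obtain ⟨u, v, huv, hu, hv⟩ := tau_split m t a b ha hb ht
  refine ⟨(u, v), ?_, funext huv⟩
  rw [Finset.mem_coe, Finset.mem_product]
  exact ⟨(tau_mem ha u).2 hu, (tau_mem hb v).2 hv⟩

lemma tau_one (m : ℕ) : tauM m 1 ≤ 1 := by
  unfold tauM
  refine (Finset.card_filter_le _ _).trans ?_
  simp

lemma tau_prime_pow (m p j : ℕ) (hp : p.Prime) : tauM m (p ^ j) ≤ (j + 1) ^ m := by
  unfold tauM
  have : ((Fintype.piFinset fun _ : Fin m => Finset.Icc 1 (p ^ j)).filter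
      fun t => ∏ i, t i = p ^ j) ⊆ Fintype.piFinset fun _ : Fin m => (p ^ j).divisors := by
    intro t ht
    rw [tau_mem (Nat.pow_pos hp.pos)] at ht
    rw [Fintype.mem_piFinset]
    intro i
    rw [Nat.mem_divisors]
    exact ⟨ht ▸ Finset.dvd_prod_of_mem t (Finset.mem_univ i), (Nat.pow_pos hp.pos).ne'⟩
  refine (Finset.card_le_card this).trans ?_
  rw [Fintype.card_piFinset]
  simp [Nat.divisors_prime_pow hp]

lemma tau_prime (m p : ℕ) (hp : p.Prime) : tauM m p ≤ m := by
  unfold tauM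
  have : ((Fintype.piFinset fun _ : Fin m => Finset.Icc 1 p).filter
      fun t => ∏ i, t i = p) ⊆ Finset.univ.image
        (fun i : Fin m => fun j : Fin m => if j = i then p else 1) := by
    intro t ht
    rw [tau_mem hp.pos] at ht
    have hd : p ∣ ∏ i, t i := ht.symm ▸ dvd_rfl
    obtain ⟨i, -, hi⟩ := (Prime.dvd_finsetProd_iff hp.prime _).1 hd
    rw [Finset.mem_image]
    refine ⟨i, Finset.mem_univ i, ?_⟩
    have hip : t i = p := Nat.dvd_antisymm (ht ▸ Finset.dvd_prod_of_mem t (Finset.mem_univ i)) hi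
    have h2 : ∏ j ∈ Finset.univ.erase i, t j = 1 := by
      have := Finset.mul_prod_erase Finset.univ t (Finset.mem_univ i)
      rw [ht, hip] at this
      exact Nat.eq_of_mul_eq_mul_left hp.pos (by rw [this, mul_one])
    funext j
    split_ifs with h
    · rw [h, hip]
    · exact ((Finset.prod_eq_one_iff.1 h2) j (Finset.mem_erase.2 ⟨h, Finset.mem_univ j⟩)).symm
  refine (Finset.card_le_card this).trans (Finset.card_image_le.trans ?_)
  simp

lemma tau_le_pow (m : ℕ) (n : ℕ) (hn : 1 ≤ n) : tauM m n ≤ m ^ n.primeFactorsList.length := by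
  induction n using Nat.recOnMul with
  | zero => omega
  | one => simpa using tau_one m
  | prime p hp => simpa [Nat.primeFactorsList_prime hp] using tau_prime m p hp
  | mul a b iha ihb =>
    have ha : 1 ≤ a := Nat.pos_of_mul_pos_right hn
    have hb : 1 ≤ b := Nat.pos_of_mul_pos_left hn
    rw [(Nat.perm_primeFactorsList_mul (by omega) (by omega)).length_eq, List.length_append, pow_add]
    exact (tau_mul_le m a b ha hb).trans (Nat.mul_le_mul (iha ha) (ihb hb))

/-- multiplicative function from local data -/
noncomputable def MF (g : ℕ → ℕ → ℝ) (n : ℕ) : ℝ := ∏ p ∈ n.primeFactors, g p (n.factorization p)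

lemma MF_one (g : ℕ → ℕ → ℝ) : MF g 1 = 1 := by simp [MF]

lemma MF_nonneg (g : ℕ → ℕ → ℝ) (hg : ∀ p j, 0 ≤ g p j) (n : ℕ) : 0 ≤ MF g n :=
  Finset.prod_nonneg fun p _ => hg p _

lemma MF_mul (g : ℕ → ℕ → ℝ) {a b : ℕ} (h : Nat.Coprime a b) : MF g (a * b) = MF g a * MF g b := by
  unfold MF
  rw [h.primeFactors_mul, Finset.prod_union h.disjoint_primeFactors]
  congr 1
  · refine Finset.prod_congr rfl fun p hp => ?_
    rw [Nat.factorization_eq_of_coprime_left h (List.mem_toFinset.1 hp)]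
  · refine Finset.prod_congr rfl fun p hp => ?_
    rw [Nat.factorization_eq_of_coprime_right h (List.mem_toFinset.1 hp)]

lemma MF_prime_pow (g : ℕ → ℕ → ℝ) {p j : ℕ} (hp : p.Prime) (hj : j ≠ 0) :
    MF g (p ^ j) = g p j := by
  unfold MF
  rw [Nat.primeFactors_prime_pow hj hp]
  simp [hp.factorization_self]

lemma MF_prime (g : ℕ → ℕ → ℝ) {p : ℕ} (hp : p.Prime) : MF g p = g p 1 := by
  simpa using MF_prime_pow g hp one_ne_zero

lemma tau_le_MF (m n : ℕ) (hn : 1 ≤ n) : (tauM m n : ℝ) ≤ MF (fun p j => (tauM m (p ^ j) : ℝ)) n := by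
  induction n using Nat.recOnPosPrimePosCoprime with
  | prime_pow p j hp hj => rw [MF_prime_pow _ hp (by omega)]
  | zero => omega
  | one => rw [MF_one]; exact_mod_cast tau_one m
  | coprime a b ha hb hab iha ihb =>
    rw [MF_mul _ hab]
    have h1 : (tauM m (a * b) : ℝ) ≤ (tauM m a : ℝ) * tauM m b := by
      exact_mod_cast tau_mul_le m a b (by omega) (by omega)
    refine h1.trans ?_
    exact mul_le_mul (iha (by omega)) (ihb (by omega)) (by positivity)
      (MF_nonneg _ (fun _ _ => by positivity) _)

/-- polynomial versus exponential -/
lemma tau_pow_bound (m : ℕ) : ∃ B : ℝ, 1 ≤ B ∧ ∀ p j : ℕ, p.Prime →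
    (tauM m (p ^ j) : ℝ) ≤ B * (p : ℝ) ^ ((j : ℝ) / 16) := by
  have h : Filter.Tendsto (fun j : ℕ => ((j : ℝ)) ^ m / ((2 : ℝ) ^ ((1 : ℝ) / 16)) ^ j)
      Filter.atTop (nhds 0) :=
    tendsto_pow_const_div_const_pow_of_one_lt m (Real.one_lt_rpow (by norm_num) (by norm_num))
  have h1 := (Filter.tendsto_add_atTop_iff_nat 1).2 h
  obtain ⟨B, hB⟩ := h1.bddAbove_range
  have hB' : ∀ j : ℕ, ((j : ℝ) + 1) ^ m / ((2 : ℝ) ^ ((1 : ℝ) / 16)) ^ (j + 1) ≤ B := by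
    intro j
    have := hB (Set.mem_range_self j)
    simpa using this
  set c : ℝ := (2 : ℝ) ^ ((1 : ℝ) / 16) with hc
  have hc0 : 0 < c := by positivity
  have hB0 : 0 ≤ B := le_trans (by positivity) (hB' 0)
  refine ⟨B * c + 1, by nlinarith, fun p j hp => ?_⟩
  have h2 : (tauM m (p ^ j) : ℝ) ≤ ((j : ℝ) + 1) ^ m := by exact_mod_cast tau_prime_pow m p j hp
  have h3 := hB' j
  rw [div_le_iff₀ (by positivity)] at h3
  have h4 : c ^ j ≤ (p : ℝ) ^ ((j : ℝ) / 16) := by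
    rw [hc, ← Real.rpow_natCast, ← Real.rpow_mul (by norm_num)]
    have : (1 : ℝ) / 16 * j = j / 16 := by ring
    rw [this]
    exact Real.rpow_le_rpow (by norm_num) (by exact_mod_cast hp.two_le) (by positivity)
  calc (tauM m (p ^ j) : ℝ) ≤ B * c ^ (j + 1) := h2.trans h3
    _ = (B * c) * c ^ j := by ring
    _ ≤ (B * c) * (p : ℝ) ^ ((j : ℝ) / 16) := by gcongr
    _ ≤ _ := by
      have : 0 ≤ (p : ℝ) ^ ((j : ℝ) / 16) := by positivity
      nlinarith

lemma local_sum (B : ℝ) (hB : 0 ≤ B) (f : ℕ → ℝ) (hf : ∀ n, 0 ≤ f n) (hf1 : f 1 = 1)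
    (p : ℕ) (hp : p.Prime)
    (hpow : ∀ j : ℕ, 2 ≤ j → f (p ^ j) ≤ B * (p : ℝ) ^ ((j : ℝ) / 4)) :
    Summable (fun n : ℕ => f (p ^ n) / ((p ^ n : ℕ) : ℝ)) ∧
    ∑' n : ℕ, f (p ^ n) / ((p ^ n : ℕ) : ℝ) ≤ 1 + f p / p + 3 * B * (p : ℝ) ^ (-(3 / 2) : ℝ) := by
  have hp0 : (0 : ℝ) < p := by exact_mod_cast hp.pos
  have hp2 : (2 : ℝ) ≤ p := by exact_mod_cast hp.two_le
  set r : ℝ := (p : ℝ) ^ (-(3 / 4) : ℝ) with hr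
  have hr0 : 0 < r := by positivity
  have hr4 : r ^ 4 ≤ 1 / 8 := by
    rw [hr, ← Real.rpow_natCast, ← Real.rpow_mul hp0.le]
    have : (-(3 / 4) : ℝ) * ((4 : ℕ) : ℝ) = -((3 : ℕ) : ℝ) := by norm_num
    rw [this, Real.rpow_neg hp0.le, Real.rpow_natCast, inv_eq_one_div]
    apply one_div_le_one_div_of_le (by norm_num)
    calc (8 : ℝ) = 2 ^ 3 := by norm_num
      _ ≤ (p : ℝ) ^ 3 := by gcongr
  have hr35 : r ≤ 3 / 5 := by
    by_contra h
    push Not at h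
    have : (3 / 5 : ℝ) ^ 4 < r ^ 4 := by gcongr
    norm_num at this
    linarith
  have hr2 : r ^ 2 = (p : ℝ) ^ (-(3 / 2) : ℝ) := by
    rw [hr, ← Real.rpow_natCast, ← Real.rpow_mul hp0.le]
    norm_num
  have hb : ∀ n : ℕ, f (p ^ (n + 2)) / ((p ^ (n + 2) : ℕ) : ℝ) ≤ B * r ^ 2 * r ^ n := by
    intro n
    rw [div_le_iff₀ (by exact_mod_cast Nat.pow_pos hp.pos)]
    refine (hpow (n + 2) (by omega)).trans (le_of_eq ?_)
    have : (p : ℝ) ^ (((n + 2 : ℕ) : ℝ) / 4) = r ^ (n + 2) * ((p ^ (n + 2) : ℕ) : ℝ) := by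
      rw [hr, ← Real.rpow_natCast, ← Real.rpow_mul hp0.le, Nat.cast_pow, ← Real.rpow_natCast,
        ← Real.rpow_add hp0]
      congr 1
      ring
    rw [this]; ring
  have hg : Summable (fun n : ℕ => B * r ^ 2 * r ^ n) :=
    (summable_geometric_of_lt_one hr0.le (by linarith)).mul_left _
  have hs2 : Summable (fun n : ℕ => f (p ^ (n + 2)) / ((p ^ (n + 2) : ℕ) : ℝ)) :=
    Summable.of_nonneg_of_le (fun n => div_nonneg (hf _) (by positivity)) hb hg
  have hs : Summable (fun n : ℕ => f (p ^ n) / ((p ^ n : ℕ) : ℝ)) :=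
    (summable_nat_add_iff 2).1 hs2
  refine ⟨hs, ?_⟩
  rw [← hs.sum_add_tsum_nat_add 2]
  have h1 : ∑ n ∈ Finset.range 2, f (p ^ n) / ((p ^ n : ℕ) : ℝ) = 1 + f p / p := by
    simp [Finset.sum_range_succ, hf1]
  rw [h1]
  have h2 := hs2.tsum_le_tsum hb hg
  rw [tsum_mul_left, tsum_geometric_of_lt_one hr0.le (by linarith)] at h2
  have h3 : (1 - r)⁻¹ ≤ 3 := by
    rw [inv_le_comm₀ (by linarith) (by norm_num)]; linarith
  have h4 : B * r ^ 2 * (1 - r)⁻¹ ≤ 3 * B * (p : ℝ) ^ (-(3 / 2) : ℝ) := by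
    rw [← hr2]
    calc B * r ^ 2 * (1 - r)⁻¹ ≤ B * r ^ 2 * 3 := by gcongr
      _ = _ := by ring
  linarith

lemma euler_bound (B : ℝ) (hB : 0 ≤ B) : ∃ C : ℝ, 1 ≤ C ∧ ∀ f : ℕ → ℝ, (∀ n, 0 ≤ f n) → f 1 = 1 →
    (∀ a b : ℕ, 1 ≤ a → 1 ≤ b → Nat.Coprime a b → f (a * b) = f a * f b) →
    (∀ p j : ℕ, p.Prime → 2 ≤ j → f (p ^ j) ≤ B * (p : ℝ) ^ ((j : ℝ) / 4)) →
    ∀ Q A : Finset ℕ, (∀ p ∈ Q, p.Prime) → (∀ a ∈ A, a ≠ 0 ∧ ∀ p : ℕ, p.Prime → p ∣ a → p ∈ Q) →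
    ∑ a ∈ A, f a / a ≤ C * ∏ p ∈ Q, (1 + f p / p) := by
  have hS : Summable (fun n : ℕ => (n : ℝ) ^ (-(3 / 2) : ℝ)) :=
    Real.summable_nat_rpow.2 (by norm_num)
  set S : ℝ := ∑' n : ℕ, (n : ℝ) ^ (-(3 / 2) : ℝ) with hSdef
  have hS0 : 0 ≤ S := tsum_nonneg fun n => by positivity
  refine ⟨Real.exp (3 * B * S), Real.one_le_exp (by positivity), ?_⟩
  intro f hf hf1 hmul hpow Q A hQ hA
  set g : ℕ → ℝ := fun n => f n / n with hg
  have hg0 : ∀ n, 0 ≤ g n := fun n => div_nonneg (hf n) (by positivity)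
  have hg1 : g 1 = 1 := by simp [hg, hf1]
  have hgm : ∀ {a b : ℕ}, Nat.Coprime a b → g (a * b) = g a * g b := by
    intro a b hab
    rcases Nat.eq_zero_or_pos a with rfl | ha
    · simp [hg]
    rcases Nat.eq_zero_or_pos b with rfl | hb
    · simp [hg]
    simp only [hg, hmul a b ha hb hab, Nat.cast_mul]
    rw [mul_div_mul_comm]
  have hloc := fun (p : ℕ) (hp : p.Prime) => local_sum B hB f hf hf1 p hp (hpow p · hp)
  obtain ⟨hs1, hs2⟩ := EulerProduct.summable_and_hasSum_factoredNumbers_prod_filter_prime_tsum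
    (f := g) hg1 hgm (fun {p} hp => by
      have := (hloc p hp).1.norm
      simpa [hg] using this) Q
  have hfil : Q.filter Nat.Prime = Q := Finset.filter_true_of_mem hQ
  have hAf : ∀ a ∈ A, a ∈ Nat.factoredNumbers Q := by
    intro a ha
    rw [Nat.mem_factoredNumbers]
    refine ⟨(hA a ha).1, fun p hp => ?_⟩
    exact (hA a ha).2 p (Nat.prime_of_mem_primeFactorsList hp) (Nat.dvd_of_mem_primeFactorsList hp)
  have h1 : ∑ a ∈ A, g a ≤ ∏ p ∈ Q.filter Nat.Prime, ∑' n : ℕ, g (p ^ n) := by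
    have h2 := sum_le_hasSum (A.attach.image
      (fun a : {a // a ∈ A} => (⟨a.1, hAf a.1 a.2⟩ : Nat.factoredNumbers Q)))
      (fun i _ => hg0 i) hs2
    rw [Finset.sum_image] at h2
    · rw [← Finset.sum_attach]
      exact h2
    · intro a _ b _ hab
      exact Subtype.ext (by simpa using hab)
  rw [hfil] at h1
  have h3 : ∀ p ∈ Q, ∑' n : ℕ, g (p ^ n) ≤ (1 + f p / p) * Real.exp (3 * B * (p : ℝ) ^ (-(3 / 2) : ℝ)) := by
    intro p hp
    refine ((hloc p (hQ p hp)).2).trans ?_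
    have h5 := Real.add_one_le_exp (3 * B * (p : ℝ) ^ (-(3 / 2) : ℝ))
    have h6 : 0 ≤ 3 * B * (p : ℝ) ^ (-(3 / 2) : ℝ) := by positivity
    have h7 : 0 ≤ f p / p := hg0 p
    nlinarith
  refine h1.trans ?_
  refine (Finset.prod_le_prod (fun p _ => tsum_nonneg fun n => hg0 _) h3).trans ?_
  rw [Finset.prod_mul_distrib, ← Real.exp_sum, ← Finset.mul_sum, mul_comm]
  gcongr
  · exact Finset.prod_nonneg fun p _ => add_nonneg zero_le_one (hg0 p)
  · exact hS.sum_le_tsum Q (fun n _ => by positivity)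

/-- primes up to `N` -/
abbrev PR (N : ℕ) : Finset ℕ := (Finset.Icc 2 N).filter Nat.Prime

lemma mem_PR {N p : ℕ} : p ∈ PR N ↔ p ≤ N ∧ p.Prime := by
  simp only [PR, Finset.mem_filter, Finset.mem_Icc]
  exact ⟨fun h => ⟨h.1.2, h.2⟩, fun h => ⟨⟨h.2.two_le, h.1⟩, h.2⟩⟩

lemma log_rad_le (n : ℕ) (hn : 1 ≤ n) : ∑ p ∈ n.primeFactors, Real.log p ≤ Real.log n := by
  rw [← Real.log_prod]
  · apply Real.log_le_log
    · exact Finset.prod_pos fun p hp => by exact_mod_cast (Nat.prime_of_mem_primeFactors hp).pos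
    · have h := Nat.le_of_dvd hn (Nat.prod_primeFactors_dvd n)
      have h' : ((∏ p ∈ n.primeFactors, p : ℕ) : ℝ) ≤ n := Nat.cast_le.2 h
      rwa [Nat.cast_prod] at h'
  · intro p hp
    exact_mod_cast (Nat.prime_of_mem_primeFactors hp).ne_zero

lemma mertens1 (N : ℕ) : ∑ p ∈ PR N, Real.log p / p ≤ 2 * Real.log N := by
  rcases Nat.eq_zero_or_pos N with rfl | hN
  · simp [PR]
  have h1 : ∑ n ∈ Finset.Icc 1 N, ∑ p ∈ n.primeFactors, Real.log p ≤ N * Real.log N := by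
    calc _ ≤ ∑ n ∈ Finset.Icc 1 N, Real.log N := by
          refine Finset.sum_le_sum fun n hn => ?_
          rw [Finset.mem_Icc] at hn
          refine (log_rad_le n hn.1).trans (Real.log_le_log (by exact_mod_cast hn.1)
            (by exact_mod_cast hn.2))
      _ = _ := by simp
  have h2 : ∑ n ∈ Finset.Icc 1 N, ∑ p ∈ n.primeFactors, Real.log p =
      ∑ p ∈ PR N, ∑ n ∈ (Finset.Icc 1 N).filter (p ∣ ·), Real.log p := by
    apply Finset.sum_comm'
    intro n p
    rw [mem_PR, Finset.mem_filter, Finset.mem_Icc, Nat.mem_primeFactors]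
    constructor
    · rintro ⟨⟨h1, h2⟩, h3, h4, h5⟩
      exact ⟨⟨⟨h1, h2⟩, h4⟩, (Nat.le_of_dvd h1 h4).trans h2, h3⟩
    · rintro ⟨⟨⟨h1, h2⟩, h4⟩, h5, h3⟩
      exact ⟨⟨h1, h2⟩, h3, h4, by omega⟩
  have hN' : (0 : ℝ) < N := by exact_mod_cast hN
  have h3 : ∑ p ∈ PR N, (N / 2 : ℝ) * (Real.log p / p) ≤ ∑ p ∈ PR N, ∑ n ∈ (Finset.Icc 1 N).filter (p ∣ ·), Real.log p := by
    refine Finset.sum_le_sum fun p hp => ?_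
    rw [mem_PR] at hp
    rw [Finset.sum_const, nsmul_eq_mul]
    have hc : ((Finset.Icc 1 N).filter (p ∣ ·)).card = N / p := by
      have := Nat.Ioc_filter_dvd_card_eq_div N p
      rw [← this]; rfl
    rw [hc]
    have hp0 : (0 : ℝ) < p := by exact_mod_cast hp.2.pos
    have hl : 0 ≤ Real.log p := Real.log_nonneg (by exact_mod_cast hp.2.one_le)
    have hd : (N : ℝ) / 2 ≤ ((N / p : ℕ) : ℝ) * p := by
      have h5 : N < (N / p + 1) * p := by
        rw [mul_comm]; exact Nat.lt_mul_div_succ N hp.2.pos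
      have h6 : 1 ≤ N / p := Nat.div_pos hp.1 hp.2.pos
      have h7 : (N : ℝ) < (((N / p : ℕ) : ℝ) + 1) * p := by exact_mod_cast h5
      have h8 : (1 : ℝ) ≤ ((N / p : ℕ) : ℝ) := by exact_mod_cast h6
      nlinarith
    have : (N / 2 : ℝ) * (Real.log p / p) = (N / 2 / p) * Real.log p := by ring
    rw [this]
    gcongr
    rwa [div_le_iff₀ hp0]
  rw [← h2, ← Finset.mul_sum] at h3
  have h4 := h3.trans h1
  have : (N : ℝ) / 2 * ∑ p ∈ PR N, Real.log p / p ≤ (N : ℝ) / 2 * (2 * Real.log N) := by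
    linarith
  exact le_of_mul_le_mul_left this (by positivity)

lemma mertens_between (M N : ℕ) (hM : 2 ≤ M) :
    ∑ p ∈ (PR N).filter (M < ·), (1 : ℝ) / p ≤ 2 * Real.log N / Real.log M := by
  have hl : 0 < Real.log M := Real.log_pos (by exact_mod_cast hM)
  rw [le_div_iff₀ hl, Finset.sum_mul]
  refine le_trans ?_ (mertens1 N)
  refine le_trans (Finset.sum_le_sum (g := fun p : ℕ => Real.log p / p) fun p hp => ?_)
    (Finset.sum_le_sum_of_subset_of_nonneg (Finset.filter_subset _ _) fun p hp _ => ?_)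
  · rw [Finset.mem_filter] at hp
    have : Real.log M ≤ Real.log p := Real.log_le_log (by exact_mod_cast (by omega : 0 < M))
      (by exact_mod_cast hp.2.le)
    rw [one_div, inv_mul_eq_div]
    gcongr
  · rw [mem_PR] at hp
    exact div_nonneg (Real.log_nonneg (by exact_mod_cast hp.2.one_le)) (by positivity)

lemma mertens2_pow (k : ℕ) : ∑ p ∈ PR (2 ^ 2 ^ k), (1 : ℝ) / p ≤ 4 * k + 1 := by
  induction k with
  | zero =>
    have : PR (2 ^ 2 ^ 0) = {2} := by
      ext p; rw [mem_PR, Finset.mem_singleton]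
      constructor
      · rintro ⟨h1, h2⟩
        have := h2.two_le
        simp at h1; omega
      · rintro rfl; exact ⟨by norm_num, Nat.prime_two⟩
    rw [this]; norm_num
  | succ k ih =>
    have h := mertens_between (2 ^ 2 ^ k) (2 ^ 2 ^ (k + 1)) (by
      calc 2 = 2 ^ 1 := by norm_num
        _ ≤ _ := Nat.pow_le_pow_right (by norm_num) Nat.one_le_two_pow)
    rw [← Finset.sum_filter_add_sum_filter_not _ (fun p => 2 ^ 2 ^ k < p)]
    have h2 : (PR (2 ^ 2 ^ (k + 1))).filter (fun p => ¬ (2 ^ 2 ^ k < p)) ⊆ PR (2 ^ 2 ^ k) := by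
      intro p hp
      rw [Finset.mem_filter, mem_PR] at hp
      rw [mem_PR]
      exact ⟨by omega, hp.1.2⟩
    have h3 := Finset.sum_le_sum_of_subset_of_nonneg (f := fun p : ℕ => (1 : ℝ) / p) h2
      (fun p _ _ => by positivity)
    have h4 : 2 * Real.log ((2 ^ 2 ^ (k + 1) : ℕ) : ℝ) / Real.log ((2 ^ 2 ^ k : ℕ) : ℝ) = 4 := by
      push_cast
      rw [Real.log_pow, Real.log_pow]
      have : Real.log 2 ≠ 0 := (Real.log_pos (by norm_num)).ne'
      push_cast
      field_simp
      ring
    rw [h4] at h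
    push_cast
    linarith

lemma mertens2 (N : ℕ) (L : ℝ) (hL : 1 ≤ L) (hN : Real.log N ≤ L) :
    ∑ p ∈ PR N, (1 : ℝ) / p ≤ 8 * Real.log L + 10 := by
  set k : ℕ := ⌈Real.log (2 * L) / Real.log 2⌉₊ with hk
  have hl2 : 0.5 < Real.log 2 := by have := Real.log_two_gt_d9; norm_num at this ⊢; linarith
  have hl2' : Real.log 2 < 0.7 := by have := Real.log_two_lt_d9; norm_num at this ⊢; linarith
  have h1 : Real.log (2 * L) / Real.log 2 ≤ k := Nat.le_ceil _
  have h0 : 0 ≤ Real.log (2 * L) / Real.log 2 := div_nonneg (Real.log_nonneg (by linarith)) (by linarith)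
  have h2 : (k : ℝ) < Real.log (2 * L) / Real.log 2 + 1 := Nat.ceil_lt_add_one h0
  have h3 : 2 * L ≤ 2 ^ k := by
    rw [div_le_iff₀ (by linarith)] at h1
    have := Real.exp_le_exp.2 h1
    rw [Real.exp_log (by linarith), mul_comm (k : ℝ), Real.exp_mul, Real.exp_log (by norm_num), Real.rpow_natCast] at this
    exact this
  have h4 : N ≤ 2 ^ 2 ^ k := by
    rcases Nat.eq_zero_or_pos N with rfl | hN0
    · exact Nat.zero_le _
    have : (N : ℝ) ≤ 2 ^ 2 ^ k := by
      rw [← Real.log_le_log_iff (by exact_mod_cast hN0) (by positivity), Real.log_pow]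
      push_cast
      have h5 : L ≤ 2 * L * Real.log 2 := by nlinarith
      have h6 : 2 * L * Real.log 2 ≤ 2 ^ k * Real.log 2 := by gcongr
      linarith
    exact_mod_cast this
  have h5 : PR N ⊆ PR (2 ^ 2 ^ k) := by
    intro p hp; rw [mem_PR] at hp ⊢; exact ⟨hp.1.trans h4, hp.2⟩
  have h6 := Finset.sum_le_sum_of_subset_of_nonneg (f := fun p : ℕ => (1 : ℝ) / p) h5
      (fun p _ _ => by positivity)
  have h7 := mertens2_pow k
  rw [Real.log_mul (by norm_num) (by linarith)] at h2
  have h8 : (Real.log 2 + Real.log L) / Real.log 2 ≤ 1 + 2 * Real.log L := by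
    rw [div_le_iff₀ (by linarith)]
    have := Real.log_nonneg hL
    nlinarith
  linarith

lemma omega_le (N : ℕ) (hN : 1 ≤ N) : (N.primeFactors.card : ℝ) ≤ 2 * Real.log N := by
  have h := log_rad_le N hN
  have hl2 : 0.5 < Real.log 2 := by have := Real.log_two_gt_d9; norm_num at this ⊢; linarith
  have : ∑ p ∈ N.primeFactors, (1 / 2 : ℝ) ≤ ∑ p ∈ N.primeFactors, Real.log p := by
    refine Finset.sum_le_sum fun p hp => ?_
    have : Real.log 2 ≤ Real.log p := Real.log_le_log (by norm_num)
      (by exact_mod_cast (Nat.prime_of_mem_primeFactors hp).two_le)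
    linarith
  rw [Finset.sum_const, nsmul_eq_mul] at this
  linarith

/-- reciprocal sum of prime divisors -/
lemma prime_div_sum (N : ℕ) (hN : 1 ≤ N) (L : ℝ) (hL : 3 ≤ L) (h : Real.log N ≤ 4 * L) :
    ∑ p ∈ N.primeFactors, (1 : ℝ) / p ≤ 8 * Real.log (Real.log L) + 18 := by
  rw [← Finset.sum_filter_add_sum_filter_not _ (fun p : ℕ => (p : ℝ) ≤ L)]
  have h1 : ∑ p ∈ N.primeFactors.filter (fun p : ℕ => (p : ℝ) ≤ L), (1 : ℝ) / p ≤ 8 * Real.log (Real.log L) + 10 := by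
    refine le_trans ?_ (mertens2 ⌊L⌋₊ (Real.log L) ?_ ?_)
    · apply Finset.sum_le_sum_of_subset_of_nonneg _ (fun p _ _ => by positivity)
      intro p hp
      rw [Finset.mem_filter] at hp
      rw [mem_PR]
      exact ⟨Nat.le_floor hp.2, Nat.prime_of_mem_primeFactors hp.1⟩
    · rw [Real.le_log_iff_exp_le (by linarith)]
      have := Real.exp_one_lt_d9
      norm_num at this; linarith
    · apply Real.log_le_log
      · exact_mod_cast Nat.floor_pos.2 (by linarith)
      · exact Nat.floor_le (by linarith)
  have h2 : ∑ p ∈ N.primeFactors.filter (fun p : ℕ => ¬ (p : ℝ) ≤ L), (1 : ℝ) / p ≤ 8 := by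
    calc _ ≤ ∑ p ∈ N.primeFactors.filter (fun p : ℕ => ¬ (p : ℝ) ≤ L), 1 / L := by
          refine Finset.sum_le_sum fun p hp => ?_
          rw [Finset.mem_filter] at hp
          push Not at hp
          exact one_div_le_one_div_of_le (by linarith) hp.2.le
      _ = ((N.primeFactors.filter (fun p : ℕ => ¬ (p : ℝ) ≤ L)).card : ℝ) * (1 / L) := by simp
      _ ≤ (8 * L) * (1 / L) := by
          gcongr
          calc ((N.primeFactors.filter (fun p : ℕ => ¬ (p : ℝ) ≤ L)).card : ℝ) ≤ N.primeFactors.card := by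
                exact_mod_cast Finset.card_filter_le _ _
            _ ≤ 8 * L := by have := omega_le N hN; linarith
      _ = 8 := by field_simp
  linarith

lemma bonf (B : Finset ℕ) (k : ℕ) :
    (if B = ∅ then (1 : ℝ) else 0) ≤ ∑ D ∈ B.powerset.filter (fun D => D.card ≤ 2 * k), (-1 : ℝ) ^ D.card := by
  have hmap : ∀ D ∈ B.powerset.filter (fun D => D.card ≤ 2 * k), D.card ∈ Finset.range (2 * k + 1) := by
    intro D hD
    rw [Finset.mem_filter] at hD
    rw [Finset.mem_range]; omega
  rw [← Finset.sum_fiberwise_of_maps_to hmap]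
  have h1 : ∀ j ∈ Finset.range (2 * k + 1),
      ∑ D ∈ (B.powerset.filter (fun D => D.card ≤ 2 * k)).filter (fun D => D.card = j), (-1 : ℝ) ^ D.card
        = (-1 : ℝ) ^ j * B.card.choose j := by
    intro j hj
    rw [Finset.mem_range] at hj
    have : (B.powerset.filter (fun D => D.card ≤ 2 * k)).filter (fun D => D.card = j)
        = Finset.powersetCard j B := by
      ext D
      simp only [Finset.mem_filter, Finset.mem_powerset, Finset.mem_powersetCard]
      constructor
      · rintro ⟨⟨a, b⟩, c⟩; exact ⟨a, c⟩
      · rintro ⟨a, c⟩; exact ⟨⟨a, by omega⟩, c⟩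
    rw [this, Finset.sum_congr rfl (g := fun _ => (-1 : ℝ) ^ j)]
    · rw [Finset.sum_const, Finset.card_powersetCard, nsmul_eq_mul, mul_comm]
    · intro D hD; rw [(Finset.mem_powersetCard.1 hD).2]
  rw [Finset.sum_congr rfl h1]
  split_ifs with h
  · subst h
    rw [Finset.sum_range_succ']
    simp
  · obtain ⟨n, hn⟩ : ∃ n, B.card = n + 1 := ⟨B.card - 1, by
      have := Finset.card_pos.2 (Finset.nonempty_iff_ne_empty.2 h); omega⟩
    have h2 := @Int.alternating_sum_range_choose_eq_choose n (2 * k)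
    have h3 : ∑ j ∈ Finset.range (2 * k + 1), (-1 : ℝ) ^ j * B.card.choose j = n.choose (2 * k) := by
      rw [hn]
      have := congrArg (fun z : ℤ => (z : ℝ)) h2
      simpa using this
    rw [h3]; positivity

lemma brun_comb (Ω P : Finset ℕ) (Ev : ℕ → ℕ → Prop) (k : ℕ) :
    ((Ω.filter (fun n => ∀ p ∈ P, ¬ Ev p n)).card : ℝ) ≤
      ∑ D ∈ P.powerset.filter (fun D => D.card ≤ 2 * k),
        (-1 : ℝ) ^ D.card * ((Ω.filter (fun n => ∀ p ∈ D, Ev p n)).card : ℝ) := by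
  have h1 : ((Ω.filter (fun n => ∀ p ∈ P, ¬ Ev p n)).card : ℝ) =
      ∑ n ∈ Ω, if P.filter (fun p => Ev p n) = ∅ then (1 : ℝ) else 0 := by
    rw [Finset.card_filter]
    push_cast
    refine Finset.sum_congr rfl fun n _ => ?_
    simp only [Finset.filter_eq_empty_iff]
  rw [h1]
  refine (Finset.sum_le_sum fun n _ => bonf (P.filter (fun p => Ev p n)) k).trans (le_of_eq ?_)
  have h2 : ∀ D ∈ P.powerset.filter (fun D => D.card ≤ 2 * k),
      (-1 : ℝ) ^ D.card * ((Ω.filter (fun n => ∀ p ∈ D, Ev p n)).card : ℝ) =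
      ∑ n ∈ Ω.filter (fun n => ∀ p ∈ D, Ev p n), (-1 : ℝ) ^ D.card := by
    intro D _
    rw [Finset.sum_const, nsmul_eq_mul, mul_comm]
  rw [Finset.sum_congr rfl h2]
  apply Finset.sum_comm'
  intro n D
  simp only [Finset.mem_filter, Finset.mem_powerset, Finset.subset_iff]
  constructor
  · rintro ⟨h, h3, h4⟩
    exact ⟨⟨h, fun p hp => (h3 hp).2⟩, fun p hp => (h3 hp).1, h4⟩
  · rintro ⟨⟨h, h3⟩, h4, h5⟩
    exact ⟨h, fun p hp => ⟨h4 hp, h3 p hp⟩, h5⟩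

lemma brun (Ω P : Finset ℕ) (Ev : ℕ → ℕ → Prop) (k : ℕ) (h : ℕ → ℝ) (h0 : ∀ p, 0 ≤ h p)
    (X : ℝ) (hX : 0 ≤ X) (R T : ℝ) (hR : 1 ≤ R) (hT : 1 ≤ T) (hPR : (P.card : ℝ) ≤ R)
    (hc : ∀ D ⊆ P, |((Ω.filter (fun n => ∀ p ∈ D, Ev p n)).card : ℝ) - X * ∏ p ∈ D, h p| ≤ 2 ^ D.card) :
    ((Ω.filter (fun n => ∀ p ∈ P, ¬ Ev p n)).card : ℝ) ≤
      X * (∏ p ∈ P, (1 - h p) + (∏ p ∈ P, (1 + T * h p)) / T ^ (2 * k)) + Real.exp 2 * R ^ (2 * k) := by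
  refine (brun_comb Ω P Ev k).trans ?_
  set F := P.powerset.filter (fun D => D.card ≤ 2 * k) with hF
  have hFP : ∀ D ∈ F, D ⊆ P := fun D hD => Finset.mem_powerset.1 (Finset.mem_filter.1 hD).1
  have hsign : ∀ j : ℕ, |(-1 : ℝ) ^ j| = 1 := fun j => by simp
  have s1 : ∑ D ∈ F, (-1 : ℝ) ^ D.card * ((Ω.filter (fun n => ∀ p ∈ D, Ev p n)).card : ℝ) ≤
      ∑ D ∈ F, ((-1 : ℝ) ^ D.card * (X * ∏ p ∈ D, h p) + 2 ^ D.card) := by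
    refine Finset.sum_le_sum fun D hD => ?_
    have h1 := hc D (hFP D hD)
    have h2 : |(-1 : ℝ) ^ D.card * (((Ω.filter (fun n => ∀ p ∈ D, Ev p n)).card : ℝ) - X * ∏ p ∈ D, h p)| ≤ 2 ^ D.card := by
      rw [abs_mul, hsign, one_mul]; exact h1
    have h3 := (abs_le.1 h2).2
    rw [mul_sub] at h3
    linarith
  refine s1.trans ?_
  rw [Finset.sum_add_distrib]
  apply add_le_add
  · have e1 : ∀ D : Finset ℕ, (-1 : ℝ) ^ D.card * (X * ∏ p ∈ D, h p) = X * ∏ p ∈ D, (- h p) := by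
      intro D
      rw [Finset.prod_neg]; ring
    simp only [e1]
    rw [← Finset.mul_sum]
    apply mul_le_mul_of_nonneg_left _ hX
    have e2 : ∏ p ∈ P, (1 - h p) = ∑ D ∈ P.powerset, ∏ p ∈ D, (- h p) := by
      rw [← Finset.prod_one_add]
      simp [sub_eq_add_neg]
    rw [e2, ← Finset.sum_filter_add_sum_filter_not P.powerset (fun D => D.card ≤ 2 * k), ← hF,
      add_assoc]
    have e3 : -∑ D ∈ P.powerset.filter (fun D => ¬ D.card ≤ 2 * k), ∏ p ∈ D, (- h p) ≤
        (∏ p ∈ P, (1 + T * h p)) / T ^ (2 * k) := by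
      rw [Finset.prod_one_add, Finset.sum_div, ← Finset.sum_neg_distrib]
      refine (Finset.sum_le_sum (g := fun D => (∏ p ∈ D, T * h p) / T ^ (2 * k)) fun D hD => ?_).trans
        (Finset.sum_le_sum_of_subset_of_nonneg (Finset.filter_subset _ _) fun D _ _ => ?_)
      · rw [Finset.mem_filter] at hD
        rw [le_div_iff₀ (by positivity), Finset.prod_neg, Finset.prod_mul_distrib, Finset.prod_const]
        have h5 : 0 ≤ ∏ p ∈ D, h p := Finset.prod_nonneg fun p _ => h0 p
        have h6 : -((-1 : ℝ) ^ D.card * ∏ p ∈ D, h p) ≤ ∏ p ∈ D, h p := by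
          have := neg_abs_le ((-1 : ℝ) ^ D.card * ∏ p ∈ D, h p)
          rw [abs_mul, hsign, one_mul, abs_of_nonneg h5] at this
          linarith
        have h7 : T ^ (2 * k) ≤ T ^ D.card := pow_le_pow_right₀ hT (by omega)
        calc -((-1 : ℝ) ^ D.card * ∏ p ∈ D, h p) * T ^ (2 * k) ≤ (∏ p ∈ D, h p) * T ^ (2 * k) := by gcongr
          _ ≤ (∏ p ∈ D, h p) * T ^ D.card := by gcongr
          _ = _ := mul_comm _ _
      · exact div_nonneg (Finset.prod_nonneg fun p _ => mul_nonneg (by linarith) (h0 p)) (by positivity)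
    linarith
  · have e4 : ∑ D ∈ F, (2 : ℝ) ^ D.card ≤ ∑ D ∈ P.powerset, R ^ (2 * k) * ∏ p ∈ D, (2 / R) := by
      refine (Finset.sum_le_sum fun D hD => ?_).trans
        (Finset.sum_le_sum_of_subset_of_nonneg (Finset.filter_subset _ _) fun D _ _ => ?_)
      · rw [hF, Finset.mem_filter] at hD
        rw [Finset.prod_const, div_pow]
        have h7 : R ^ D.card ≤ R ^ (2 * k) := pow_le_pow_right₀ hR hD.2
        rw [mul_div_assoc', le_div_iff₀ (by positivity), mul_comm]
        gcongr
      · exact mul_nonneg (by positivity) (Finset.prod_nonneg fun p _ => by positivity)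
    refine e4.trans ?_
    rw [← Finset.mul_sum, ← Finset.prod_one_add, mul_comm]
    gcongr
    rw [Finset.prod_const]
    calc (1 + 2 / R) ^ P.card ≤ (Real.exp (2 / R)) ^ P.card := by
          gcongr
          have := Real.add_one_le_exp (2 / R); linarith
      _ = Real.exp (P.card * (2 / R)) := by rw [← Real.exp_nat_mul]
      _ ≤ Real.exp 2 := by
          apply Real.exp_le_exp.2
          rw [mul_div_assoc', div_le_iff₀ (by linarith)]
          nlinarith

lemma count_class (A A' : ℕ) (hA : 1 ≤ A) (hA' : 1 ≤ A') (ℓ : ℤ) (hg : ((Nat.gcd A A' : ℕ) : ℤ) ∣ ℓ) (N : ℕ) :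
    |((((Finset.Icc 1 N).filter (fun n : ℕ => (A : ℕ) ∣ n ∧ (A' : ℤ) ∣ (n : ℤ) + ℓ)).card : ℕ) : ℝ)
      - (N : ℝ) / (Nat.lcm A A' : ℕ)| ≤ 1 := by
  obtain ⟨c, hc⟩ := hg
  have hbez := Nat.gcd_eq_gcd_ab A A'
  set v : ℤ := -(A * (A.gcdA A' * c)) with hv
  have hv1 : (A : ℤ) ∣ v := ⟨-(A.gcdA A' * c), by rw [hv]; ring⟩
  have hv2 : (A' : ℤ) ∣ v + ℓ := ⟨A.gcdB A' * c, by rw [hv, hc, hbez]; ring⟩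
  set r : ℕ := Nat.lcm A A' with hr
  have hr0 : 0 < r := Nat.lcm_pos hA hA'
  have hiff : ∀ n : ℤ, ((A : ℤ) ∣ n ∧ (A' : ℤ) ∣ n + ℓ) ↔ n ≡ v [ZMOD (r : ℤ)] := by
    intro n
    rw [Int.modEq_comm, Int.modEq_iff_dvd]
    have e1 : (A : ℤ) ∣ n ↔ (A : ℤ) ∣ n - v := (dvd_sub_left hv1).symm
    have e2 : (A' : ℤ) ∣ n + ℓ ↔ (A' : ℤ) ∣ n - v := by
      have : n - v = (n + ℓ) - (v + ℓ) := by ring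
      rw [this]; exact (dvd_sub_left hv2).symm
    rw [e1, e2, hr]
    have : ((Nat.lcm A A' : ℕ) : ℤ) = ((Int.lcm (A : ℤ) (A' : ℤ) : ℕ) : ℤ) := by
      rw [Int.lcm_natCast_natCast]
    rw [this, Int.coe_lcm]
    exact (lcm_dvd_iff).symm
  have hcard : ((Finset.Icc 1 N).filter (fun n : ℕ => (A : ℕ) ∣ n ∧ (A' : ℤ) ∣ (n : ℤ) + ℓ)).card
      = ((Finset.Ioc (0 : ℤ) N).filter (fun n => n ≡ v [ZMOD (r : ℤ)])).card := by
    apply Finset.card_bij (fun (n : ℕ) _ => (n : ℤ))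
    · intro n hn
      rw [Finset.mem_filter, Finset.mem_Icc] at hn
      rw [Finset.mem_filter, Finset.mem_Ioc, ← hiff]
      refine ⟨⟨by omega, by omega⟩, by exact_mod_cast hn.2.1, hn.2.2⟩
    · intro a _ b _ h; exact_mod_cast h
    · intro n hn
      rw [Finset.mem_filter, Finset.mem_Ioc, ← hiff] at hn
      obtain ⟨⟨h1, h2⟩, h3, h4⟩ := hn
      lift n to ℕ using h1.le
      refine ⟨n, ?_, rfl⟩
      rw [Finset.mem_filter, Finset.mem_Icc]
      refine ⟨⟨by omega, by omega⟩, by exact_mod_cast h3, h4⟩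
  rw [hcard]
  have hm := Int.Ioc_filter_modEq_card 0 (N : ℤ) (r := (r : ℤ)) (by exact_mod_cast hr0) v
  set K := ((Finset.Ioc (0 : ℤ) N).filter (fun n => n ≡ v [ZMOD (r : ℤ)])).card with hK
  have hrq : (0 : ℚ) < r := by exact_mod_cast hr0
  have f1 := Int.floor_le (((N : ℤ) - (v : ℚ)) / ((r : ℤ) : ℚ))
  have f2 := Int.lt_floor_add_one (((N : ℤ) - (v : ℚ)) / ((r : ℤ) : ℚ))
  have f3 := Int.floor_le ((((0 : ℤ) : ℚ) - (v : ℚ)) / ((r : ℤ) : ℚ))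
  have f4 := Int.lt_floor_add_one ((((0 : ℤ) : ℚ) - (v : ℚ)) / ((r : ℤ) : ℚ))
  set F1 := ⌊((N : ℤ) - (v : ℚ)) / ((r : ℤ) : ℚ)⌋ with hF1
  set F2 := ⌊(((0 : ℤ) : ℚ) - (v : ℚ)) / ((r : ℤ) : ℚ)⌋ with hF2
  have e : ((N : ℤ) - (v : ℚ)) / ((r : ℤ) : ℚ) = (N : ℚ) / r + (((0 : ℤ) : ℚ) - (v : ℚ)) / ((r : ℤ) : ℚ) := by
    push_cast; ring
  rw [e] at f1 f2
  have hmono : F2 ≤ F1 := by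
    apply Int.floor_le_floor
    rw [e]
    have : (0 : ℚ) ≤ (N : ℚ) / r := by positivity
    linarith
  have hK2 : (K : ℤ) = F1 - F2 := by
    rw [hm, max_eq_left]; linarith
  have hK3 : (K : ℚ) = F1 - F2 := by exact_mod_cast hK2
  have g1 : (K : ℚ) - (N : ℚ) / r ≤ 1 := by rw [hK3]; linarith
  have g2 : -1 ≤ (K : ℚ) - (N : ℚ) / r := by rw [hK3]; linarith
  rw [abs_le]
  constructor
  · have : ((-1 : ℚ) : ℝ) ≤ (((K : ℚ) - (N : ℚ) / r : ℚ) : ℝ) := Rat.cast_le.2 g2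
    simpa using this
  · have : (((K : ℚ) - (N : ℚ) / r : ℚ) : ℝ) ≤ ((1 : ℚ) : ℝ) := Rat.cast_le.2 g1
    simpa using this

/-- the progression part -/
noncomputable def Om (a a' : ℕ) (ℓ : ℤ) (N : ℕ) : Finset ℕ :=
  (Finset.Icc 1 N).filter (fun n : ℕ => a ∣ n ∧ (a' : ℤ) ∣ (n : ℤ) + ℓ)

lemma mem_Om {a a' : ℕ} {ℓ : ℤ} {N n : ℕ} :
    n ∈ Om a a' ℓ N ↔ (1 ≤ n ∧ n ≤ N) ∧ a ∣ n ∧ (a' : ℤ) ∣ (n : ℤ) + ℓ := by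
  rw [Om, Finset.mem_filter, Finset.mem_Icc]

lemma count_D (ℓ : ℤ) (N : ℕ) (D : Finset ℕ) : ∀ a a' : ℕ, 1 ≤ a → 1 ≤ a' →
    ((Nat.gcd a a' : ℕ) : ℤ) ∣ ℓ →
    (∀ p ∈ D, p.Prime ∧ ¬ p ∣ a ∧ ¬ p ∣ a' ∧ ¬ (p : ℤ) ∣ ℓ) →
    |((((Om a a' ℓ N).filter (fun n => ∀ p ∈ D, (p ∣ n ∨ (p : ℤ) ∣ (n : ℤ) + ℓ))).card : ℕ) : ℝ)
      - (N : ℝ) / (Nat.lcm a a' : ℕ) * ∏ p ∈ D, (2 / (p : ℝ))| ≤ 2 ^ D.card := by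
  induction D using Finset.induction with
  | empty =>
    intro a a' ha ha' hg _
    simpa [Om] using count_class a a' ha ha' ℓ hg N
  | insert p D hpD ih =>
    intro a a' ha ha' hg hD
    obtain ⟨hp, hpa, hpa', hpl⟩ := hD p (Finset.mem_insert_self p D)
    have hD' : ∀ q ∈ D, q.Prime ∧ ¬ q ∣ a ∧ ¬ q ∣ a' ∧ ¬ (q : ℤ) ∣ ℓ :=
      fun q hq => hD q (Finset.mem_insert_of_mem hq)
    have hqp : ∀ q ∈ D, ¬ q ∣ p := by
      intro q hq h
      rw [Nat.prime_dvd_prime_iff_eq (hD' q hq).1 hp] at h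
      exact hpD (h ▸ hq)
    have c1 : Nat.Coprime p a := (Nat.Prime.coprime_iff_not_dvd hp).2 hpa
    have c2 : Nat.Coprime p a' := (Nat.Prime.coprime_iff_not_dvd hp).2 hpa'
    have g1 : Nat.gcd (p * a) a' = Nat.gcd a a' := Nat.Coprime.gcd_mul_left_cancel a c2
    have g2 : Nat.gcd a (p * a') = Nat.gcd a a' := Nat.Coprime.gcd_mul_left_cancel_right a' c1
    have l1 : Nat.lcm (p * a) a' = p * Nat.lcm a a' := by
      rw [Nat.lcm, Nat.lcm, g1, mul_assoc, Nat.mul_div_assoc]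
      exact (Nat.gcd_dvd_left a a').mul_right _
    have l2 : Nat.lcm a (p * a') = p * Nat.lcm a a' := by
      rw [Nat.lcm, Nat.lcm, g2, mul_left_comm, Nat.mul_div_assoc]
      exact (Nat.gcd_dvd_left a a').mul_right _
    have i1 := ih (p * a) a' (Nat.mul_pos hp.pos ha) ha' (by rw [g1]; exact hg) (by
      intro q hq
      obtain ⟨h1, h2, h3, h4⟩ := hD' q hq
      refine ⟨h1, ?_, h3, h4⟩
      rw [h1.dvd_mul]; exact not_or.2 ⟨hqp q hq, h2⟩)
    have i2 := ih a (p * a') ha (Nat.mul_pos hp.pos ha') (by rw [g2]; exact hg) (by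
      intro q hq
      obtain ⟨h1, h2, h3, h4⟩ := hD' q hq
      refine ⟨h1, h2, ?_, h4⟩
      rw [h1.dvd_mul]; exact not_or.2 ⟨hqp q hq, h3⟩)
    rw [l1] at i1
    rw [l2] at i2
    have hsplit : (Om a a' ℓ N).filter (fun n => ∀ q ∈ insert p D, (q ∣ n ∨ (q : ℤ) ∣ (n : ℤ) + ℓ))
       = ((Om (p * a) a' ℓ N).filter (fun n => ∀ p ∈ D, (p ∣ n ∨ (p : ℤ) ∣ (n : ℤ) + ℓ))) ∪
         ((Om a (p * a') ℓ N).filter (fun n => ∀ p ∈ D, (p ∣ n ∨ (p : ℤ) ∣ (n : ℤ) + ℓ))) := by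
      ext n
      have d1 : p * a ∣ n ↔ p ∣ n ∧ a ∣ n :=
        ⟨fun h => ⟨(Dvd.intro _ rfl).trans h, (Dvd.intro_left _ rfl).trans h⟩,
          fun h => c1.mul_dvd_of_dvd_of_dvd h.1 h.2⟩
      have d2 : ((p * a' : ℕ) : ℤ) ∣ (n : ℤ) + ℓ ↔ (p : ℤ) ∣ (n : ℤ) + ℓ ∧ (a' : ℤ) ∣ (n : ℤ) + ℓ := by
        push_cast
        exact ⟨fun h => ⟨(Dvd.intro _ rfl).trans h, (Dvd.intro_left _ rfl).trans h⟩,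
          fun h => (Nat.isCoprime_iff_coprime.2 c2).mul_dvd h.1 h.2⟩
      simp only [Finset.mem_filter, Finset.mem_union, mem_Om, Finset.forall_mem_insert, d1, d2]
      tauto
    have hdisj : Disjoint ((Om (p * a) a' ℓ N).filter (fun n => ∀ p ∈ D, (p ∣ n ∨ (p : ℤ) ∣ (n : ℤ) + ℓ)))
         ((Om a (p * a') ℓ N).filter (fun n => ∀ p ∈ D, (p ∣ n ∨ (p : ℤ) ∣ (n : ℤ) + ℓ))) := by
      rw [Finset.disjoint_left]
      intro n h1 h2
      rw [Finset.mem_filter, mem_Om] at h1 h2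
      have e1 : (p : ℤ) ∣ n := by exact_mod_cast (Dvd.intro _ rfl).trans h1.1.2.1
      have e2 : (p : ℤ) ∣ n + ℓ := by
        have := h2.1.2.2
        push_cast at this
        exact (Dvd.intro _ rfl).trans this
      exact hpl ((dvd_add_right e1).1 e2)
    rw [hsplit, Finset.card_union_of_disjoint hdisj, Finset.prod_insert hpD, Finset.card_insert_of_notMem hpD]
    have hp0 : (p : ℝ) ≠ 0 := by exact_mod_cast hp.ne_zero
    have hl0 : ((Nat.lcm a a' : ℕ) : ℝ) ≠ 0 := by exact_mod_cast (Nat.lcm_pos ha ha').ne'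
    have e3 : (N : ℝ) / (Nat.lcm a a' : ℕ) * (2 / (p : ℝ) * ∏ p ∈ D, (2 / (p : ℝ))) =
        2 * ((N : ℝ) / ((p * Nat.lcm a a' : ℕ) : ℝ) * ∏ p ∈ D, (2 / (p : ℝ))) := by
      push_cast
      field_simp
    rw [e3]
    push_cast at i1 i2 ⊢
    rw [abs_le] at i1 i2 ⊢
    rw [pow_succ]
    constructor <;> linarith [i1.1, i1.2, i2.1, i2.2]

lemma sieve_pair (ℓ : ℤ) (N : ℕ) (P : Finset ℕ) (a a' : ℕ) (ha : 1 ≤ a) (ha' : 1 ≤ a')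
    (hg : ((Nat.gcd a a' : ℕ) : ℤ) ∣ ℓ)
    (hP : ∀ p ∈ P, p.Prime ∧ ¬ p ∣ a ∧ ¬ p ∣ a' ∧ ¬ (p : ℤ) ∣ ℓ) (k : ℕ)
    (R T : ℝ) (hR : 1 ≤ R) (hT : 1 ≤ T) (hPR : (P.card : ℝ) ≤ R) :
    (((Om a a' ℓ N).filter (fun n => ∀ p ∈ P, ¬ (p ∣ n ∨ (p : ℤ) ∣ (n : ℤ) + ℓ))).card : ℝ) ≤
      (N : ℝ) / (Nat.lcm a a' : ℕ) * (∏ p ∈ P, (1 - 2 / (p : ℝ)) +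
        (∏ p ∈ P, (1 + T * (2 / (p : ℝ)))) / T ^ (2 * k)) + Real.exp 2 * R ^ (2 * k) := by
  have := brun (Om a a' ℓ N) P (fun p n => p ∣ n ∨ (p : ℤ) ∣ (n : ℤ) + ℓ) k (fun p => 2 / (p : ℝ))
    (fun p => by positivity) ((N : ℝ) / (Nat.lcm a a' : ℕ)) (by positivity) R T hR hT hPR (by
      intro D hD
      convert count_D ℓ N D a a' ha ha' hg (fun p hp => hP p (hD hp)))
  convert this

lemma euler_log (N : ℕ) (hN : 1 ≤ N) : ∏ p ∈ PR N, (1 - 1 / (p : ℝ)) ≤ 1 / Real.log (N + 1) := by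
  have hlog : 0 < Real.log (N + 1) := Real.log_pos (by
    have : (1 : ℝ) ≤ N := by exact_mod_cast hN
    linarith)
  set f : ℕ →* ℝ := (invMonoidHom (α := ℝ)).comp (Nat.castRingHom ℝ : ℕ →* ℝ) with hf
  have hfv : ∀ n : ℕ, f n = (n : ℝ)⁻¹ := fun n => rfl
  have h := (EulerProduct.summable_and_hasSum_factoredNumbers_prod_filter_prime_geometric (f := f)
    (fun {p} hp => by
      rw [hfv, norm_inv, inv_lt_one_iff₀]
      right
      simpa using hp.one_lt) (PR N)).2
  have hfil : (PR N).filter Nat.Prime = PR N := Finset.filter_true_of_mem fun p hp => (mem_PR.1 hp).2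
  rw [hfil] at h
  have hmem : ∀ n ∈ Finset.Icc 1 N, n ∈ Nat.factoredNumbers (PR N) := by
    intro n hn
    rw [Finset.mem_Icc] at hn
    rw [Nat.mem_factoredNumbers]
    refine ⟨by omega, fun p hp => mem_PR.2 ⟨?_, Nat.prime_of_mem_primeFactorsList hp⟩⟩
    exact (Nat.le_of_dvd hn.1 (Nat.dvd_of_mem_primeFactorsList hp)).trans hn.2
  have h2 := sum_le_hasSum ((Finset.Icc 1 N).attach.image
      (fun a : {a // a ∈ Finset.Icc 1 N} => (⟨a.1, hmem a.1 a.2⟩ : Nat.factoredNumbers (PR N))))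
      (fun i _ => by rw [hfv]; positivity) h
  rw [Finset.sum_image (fun a _ b _ hab => Subtype.ext (by simpa using hab)),
    Finset.sum_attach (Finset.Icc 1 N) (fun n => f n)] at h2
  have h3 : Real.log (N + 1) ≤ ∑ n ∈ Finset.Icc 1 N, f n := by
    have := log_add_one_le_harmonic N
    rw [harmonic_eq_sum_Icc] at this
    push_cast at this
    exact this
  have h4 := h3.trans h2
  rw [Finset.prod_inv_distrib] at h4
  have h5 : ∏ p ∈ PR N, (1 - 1 / (p : ℝ)) = ∏ p ∈ PR N, (1 - f p) := by
    simp [hfv]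
  rw [h5, one_div]
  exact le_inv_of_le_inv₀ hlog h4

lemma V_bound (Z M : ℕ) (hZ : 1 ≤ Z) (hM : 1 ≤ M) :
    ∏ p ∈ (PR Z).filter (fun p => ¬ p ∣ M), (1 - 2 / (p : ℝ)) ≤
      (1 / Real.log (Z + 1)) ^ 2 * Real.exp (4 * ∑ p ∈ M.primeFactors, (1 : ℝ) / p) := by
  have hpos : ∀ p : ℕ, p.Prime → (0 : ℝ) ≤ 1 - 2 / (p : ℝ) := by
    intro p hp
    have : (2 : ℝ) ≤ p := by exact_mod_cast hp.two_le
    rw [sub_nonneg, div_le_one (by linarith)]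
    exact this
  have hp2 : ∀ p : ℕ, p.Prime → (1 : ℝ) / p ≤ 1 / 2 := by
    intro p hp
    have : (2 : ℝ) ≤ p := by exact_mod_cast hp.two_le
    exact one_div_le_one_div_of_le (by norm_num) this
  have h1 : ∏ p ∈ (PR Z).filter (fun p => ¬ p ∣ M), (1 - 2 / (p : ℝ)) ≤
      (∏ p ∈ (PR Z).filter (fun p => ¬ p ∣ M), (1 - 1 / (p : ℝ))) ^ 2 := by
    rw [← Finset.prod_pow]
    refine Finset.prod_le_prod (fun p hp => hpos p (mem_PR.1 (Finset.mem_filter.1 hp).1).2) fun p hp => ?_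
    have : 2 / (p : ℝ) = 2 * (1 / p) := by ring
    rw [this]
    nlinarith [sq_nonneg (1 / (p : ℝ))]
  have h2 : ∏ p ∈ (PR Z).filter (fun p => ¬ p ∣ M), (1 - 1 / (p : ℝ)) ≤
      1 / Real.log (Z + 1) * Real.exp (2 * ∑ p ∈ M.primeFactors, (1 : ℝ) / p) := by
    have h3 := euler_log Z hZ
    rw [← Finset.prod_filter_mul_prod_filter_not _ (fun p => ¬ p ∣ M)] at h3
    set A := ∏ p ∈ (PR Z).filter (fun p => ¬ p ∣ M), (1 - 1 / (p : ℝ)) with hA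
    set B := ∏ p ∈ (PR Z).filter (fun p => ¬ ¬ p ∣ M), (1 - 1 / (p : ℝ)) with hB
    have hA0 : 0 ≤ A := Finset.prod_nonneg fun p hp => by
      have := hp2 p (mem_PR.1 (Finset.mem_filter.1 hp).1).2; linarith
    have hB1 : Real.exp (-(2 * ∑ p ∈ M.primeFactors, (1 : ℝ) / p)) ≤ B := by
      have h4 : ∑ p ∈ (PR Z).filter (fun p => ¬ ¬ p ∣ M), (1 : ℝ) / p ≤ ∑ p ∈ M.primeFactors, (1 : ℝ) / p := by
        apply Finset.sum_le_sum_of_subset_of_nonneg _ (fun p _ _ => by positivity)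
        intro p hp
        rw [Finset.mem_filter, mem_PR, not_not] at hp
        exact Nat.mem_primeFactors.2 ⟨hp.1.2, hp.2, by omega⟩
      calc Real.exp (-(2 * ∑ p ∈ M.primeFactors, (1 : ℝ) / p))
          ≤ Real.exp (∑ p ∈ (PR Z).filter (fun p => ¬ ¬ p ∣ M), -(2 * ((1 : ℝ) / p))) := by
            apply Real.exp_le_exp.2
            rw [Finset.sum_neg_distrib, ← Finset.mul_sum]
            linarith
        _ = ∏ p ∈ (PR Z).filter (fun p => ¬ ¬ p ∣ M), Real.exp (-(2 * ((1 : ℝ) / p))) := Real.exp_sum _ _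
        _ ≤ B := by
            refine Finset.prod_le_prod (fun p _ => (Real.exp_pos _).le) fun p hp => ?_
            have h5 := hp2 p (mem_PR.1 (Finset.mem_filter.1 hp).1).2
            have h6 : (0 : ℝ) ≤ 1 / p := by positivity
            set u := (1 : ℝ) / p
            have h7 := Real.add_one_le_exp (2 * u)
            rw [Real.exp_neg, inv_le_comm₀ (Real.exp_pos _) (by linarith)]
            refine le_trans ?_ h7
            rw [inv_le_iff_one_le_mul₀ (by linarith)]
            nlinarith
    have h8 : A * Real.exp (-(2 * ∑ p ∈ M.primeFactors, (1 : ℝ) / p)) ≤ 1 / Real.log (Z + 1) :=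
      (mul_le_mul_of_nonneg_left hB1 hA0).trans h3
    rw [Real.exp_neg, ← div_eq_mul_inv, div_le_iff₀ (Real.exp_pos _)] at h8
    exact h8
  refine h1.trans ?_
  have h0 : 0 ≤ ∏ p ∈ (PR Z).filter (fun p => ¬ p ∣ M), (1 - 1 / (p : ℝ)) :=
    Finset.prod_nonneg fun p hp => by
      have := hp2 p (mem_PR.1 (Finset.mem_filter.1 hp).1).2; linarith
  refine (pow_le_pow_left₀ h0 h2 2).trans (le_of_eq ?_)
  rw [mul_pow, ← Real.exp_nat_mul]
  congr 2
  push_cast; ring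

/-- part of `n` composed of primes with property `Q` -/
noncomputable def prt (Q : ℕ → Prop) (n : ℕ) : ℕ :=
  ∏ p ∈ n.primeFactors.filter Q, p ^ n.factorization p

lemma prt_pos (Q : ℕ → Prop) (n : ℕ) : 1 ≤ prt Q n :=
  Finset.prod_pos fun _ hp => Nat.pow_pos (Nat.prime_of_mem_primeFactors (Finset.mem_filter.1 hp).1).pos

lemma prt_mul (Q : ℕ → Prop) (n : ℕ) (hn : 1 ≤ n) : prt Q n * prt (fun p => ¬ Q p) n = n := by
  unfold prt
  rw [Finset.prod_filter_mul_prod_filter_not]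
  exact Nat.prod_factorization_pow_eq_self (by omega)

lemma prt_prime (Q : ℕ → Prop) (n p : ℕ) (hp : p.Prime) (h : p ∣ prt Q n) : Q p ∧ p ∣ n := by
  unfold prt at h
  obtain ⟨q, hq, hpq⟩ := (Prime.dvd_finsetProd_iff hp.prime _).1 h
  rw [Finset.mem_filter] at hq
  have h1 := hp.dvd_of_dvd_pow hpq
  have h2 := (Nat.prime_dvd_prime_iff_eq hp (Nat.prime_of_mem_primeFactors hq.1)).1 h1
  subst h2
  exact ⟨hq.2, Nat.dvd_of_mem_primeFactors hq.1⟩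

lemma prt_coprime (Q : ℕ → Prop) (n : ℕ) : Nat.Coprime (prt Q n) (prt (fun p => ¬ Q p) n) := by
  apply Nat.coprime_of_dvd
  intro p hp h1 h2
  exact (prt_prime _ n p hp h2).1 (prt_prime Q n p hp h1).1

/-- smooth numbers up to `Y` -/
noncomputable def SM (W Y : ℕ) : Finset ℕ :=
  (Finset.Icc 1 Y).filter (fun a => ∀ p : ℕ, p.Prime → p ∣ a → p ≤ W)

lemma mem_SM {W Y a : ℕ} : a ∈ SM W Y ↔ (1 ≤ a ∧ a ≤ Y) ∧ ∀ p : ℕ, p.Prime → p ∣ a → p ≤ W := by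
  rw [SM, Finset.mem_filter, Finset.mem_Icc]

lemma SM_dvd {W Y a b : ℕ} (ha : a ∈ SM W Y) (h : b ∣ a) : b ∈ SM W Y := by
  rw [mem_SM] at ha ⊢
  exact ⟨⟨Nat.pos_of_dvd_of_pos h ha.1.1, (Nat.le_of_dvd ha.1.1 h).trans ha.1.2⟩,
    fun p hp hpb => ha.2 p hp (hpb.trans h)⟩

lemma rpow_mono_aux (p j : ℕ) (hp : p.Prime) (s t : ℝ) (hst : s ≤ t) : (p : ℝ) ^ ((j : ℝ) * s) ≤ (p : ℝ) ^ ((j : ℝ) * t) := by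
  apply Real.rpow_le_rpow_of_exponent_le
  · exact_mod_cast hp.one_le
  · gcongr

/-- the hypotheses on a coefficient function -/
structure Coef (m : ℕ) (f : ℕ → ℝ) : Prop where
  nonneg : ∀ n, 0 ≤ f n
  one : f 1 = 1
  mul : ∀ a b : ℕ, 1 ≤ a → 1 ≤ b → Nat.Coprime a b → f (a * b) = f a * f b
  le : ∀ n : ℕ, 1 ≤ n → f n ≤ tauM m n

lemma F_bound (m : ℕ) : ∃ C : ℝ, 1 ≤ C ∧ ∀ f : ℕ → ℝ, Coef m f → ∀ W Y d : ℕ, 1 ≤ d →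
    ∑ a ∈ (SM W Y).filter (fun a => d ∣ a), f a / a ≤
      C * ((tauM m d : ℝ) / d) * (∏ p ∈ d.primeFactors, (1 + (m : ℝ) / p)) * ∏ p ∈ PR W, (1 + f p / p) := by
  obtain ⟨B, hB1, hB⟩ := tau_pow_bound m
  obtain ⟨C, hC1, hC⟩ := euler_bound B (by linarith)
  refine ⟨C * C, by nlinarith, ?_⟩
  intro f hf W Y d hd
  have hb : ∀ p j : ℕ, p.Prime → 2 ≤ j → (tauM m (p ^ j) : ℝ) ≤ B * (p : ℝ) ^ ((j : ℝ) / 4) := by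
    intro p j hp _
    refine (hB p j hp).trans ?_
    have := rpow_mono_aux p j hp (1 / 16) (1 / 4) (by norm_num)
    have e1 : (j : ℝ) * (1 / 16) = j / 16 := by ring
    have e2 : (j : ℝ) * (1 / 4) = j / 4 := by ring
    rw [e1, e2] at this
    gcongr
  set g : ℕ → ℝ := MF (fun p j => (tauM m (p ^ j) : ℝ)) with hg
  have hg0 : ∀ n, 0 ≤ g n := MF_nonneg _ (fun _ _ => by positivity)
  set K := (SM W Y).filter (fun k => ∀ p : ℕ, p.Prime → p ∣ k → p ∣ d) with hK
  have s1 : ∑ k ∈ K, g k / k ≤ C * ∏ p ∈ d.primeFactors, (1 + (m : ℝ) / p) := by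
    refine (hC g hg0 (MF_one _) (fun a b _ _ h => MF_mul _ h) ?_ d.primeFactors K
      (fun p hp => Nat.prime_of_mem_primeFactors hp) ?_).trans ?_
    · intro p j hp hj
      rw [hg, MF_prime_pow _ hp (by omega)]
      exact hb p j hp hj
    · intro a ha
      rw [hK, Finset.mem_filter, mem_SM] at ha
      exact ⟨by omega, fun p hp hpa => Nat.mem_primeFactors.2 ⟨hp, ha.2 p hp hpa, by omega⟩⟩
    · apply mul_le_mul_of_nonneg_left _ (by linarith)
      refine Finset.prod_le_prod (fun p _ => add_nonneg zero_le_one (div_nonneg (hg0 p) (by positivity))) ?_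
      intro p hp
      have hpp := Nat.prime_of_mem_primeFactors hp
      rw [hg, MF_prime _ hpp]
      have : (tauM m (p ^ 1) : ℝ) ≤ m := by rw [pow_one]; exact_mod_cast tau_prime m p hpp
      gcongr
  have s2 : ∑ a ∈ SM W Y, f a / a ≤ C * ∏ p ∈ PR W, (1 + f p / p) := by
    apply hC f hf.nonneg hf.one hf.mul _ (PR W) (SM W Y) (fun p hp => (mem_PR.1 hp).2)
    · intro a ha
      rw [mem_SM] at ha
      exact ⟨by omega, fun p hp hpa => mem_PR.2 ⟨ha.2 p hp hpa, hp⟩⟩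
    · intro p j hp hj
      exact (hf.le _ (Nat.pow_pos hp.pos)).trans (hb p j hp hj)
  set Q : ℕ → Prop := fun p => p ∣ d with hQ
  have hdvd : ∀ a, 1 ≤ a → d ∣ a → d ∣ prt Q a := by
    intro a ha hda
    have hcop : Nat.Coprime d (prt (fun p => ¬ Q p) a) := by
      apply Nat.coprime_of_dvd
      intro p hp h1 h2
      exact (prt_prime _ a p hp h2).1 h1
    rw [← prt_mul Q a ha] at hda
    exact hcop.dvd_of_dvd_mul_right hda
  set φ : ℕ → ℕ × ℕ := fun a => (prt Q a / d, prt (fun p => ¬ Q p) a) with hφ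
  have hA : ∀ a ∈ (SM W Y).filter (fun a => d ∣ a), 1 ≤ a ∧ d ∣ a ∧ a ∈ SM W Y ∧ d * (φ a).1 * (φ a).2 = a ∧
      1 ≤ (φ a).1 ∧ 1 ≤ (φ a).2 := by
    intro a ha
    rw [Finset.mem_filter] at ha
    have h1 := (mem_SM.1 ha.1).1.1
    have h2 := Nat.mul_div_cancel' (hdvd a h1 ha.2)
    have h3 : d * (φ a).1 = prt Q a := h2
    refine ⟨h1, ha.2, ha.1, ?_, ?_, prt_pos _ _⟩
    · rw [h3]; exact prt_mul Q a h1
    · exact Nat.div_pos (Nat.le_of_dvd (prt_pos _ _) (hdvd a h1 ha.2)) hd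
  have hinj : Set.InjOn φ ((SM W Y).filter (fun a => d ∣ a)) := by
    intro a ha b hb hab
    rw [← (hA a ha).2.2.2.1, ← (hA b hb).2.2.2.1, hab]
  have hmaps : ((SM W Y).filter (fun a => d ∣ a)).image φ ⊆ K ×ˢ SM W Y := by
    intro q hq
    rw [Finset.mem_image] at hq
    obtain ⟨a, ha, rfl⟩ := hq
    obtain ⟨h1, h2, h3, h4, h5, h6⟩ := hA a ha
    rw [Finset.mem_product]
    refine ⟨?_, ?_⟩
    · rw [hK, Finset.mem_filter]
      refine ⟨SM_dvd h3 ⟨d * (φ a).2, h4.symm.trans (by ring)⟩, ?_⟩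
      intro p hp hpk
      have : p ∣ prt Q a := by
        refine hpk.trans ?_
        exact Nat.div_dvd_of_dvd (hdvd a h1 h2)
      exact (prt_prime Q a p hp this).1
    · exact SM_dvd h3 ⟨d * (φ a).1, by rw [mul_comm]; exact h4.symm⟩
  set G : ℕ × ℕ → ℝ := fun q => ((tauM m d : ℝ) / d) * (g q.1 / q.1) * (f q.2 / q.2) with hG
  have hG0 : ∀ q, 0 ≤ G q := fun q => by
    have := hg0 q.1; have := hf.nonneg q.2
    simp only [hG]; positivity
  calc ∑ a ∈ (SM W Y).filter (fun a => d ∣ a), f a / a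
      ≤ ∑ a ∈ (SM W Y).filter (fun a => d ∣ a), G (φ a) := by
        refine Finset.sum_le_sum fun a ha => ?_
        obtain ⟨h1, h2, h3, h4, h5, h6⟩ := hA a ha
        have e1 : f a = f (prt Q a) * f ((φ a).2) := by
          conv_lhs => rw [← prt_mul Q a h1]
          exact hf.mul _ _ (prt_pos _ _) (prt_pos _ _) (prt_coprime _ _)
        have e2 : f (prt Q a) ≤ tauM m d * g (φ a).1 := by
          refine (hf.le _ (prt_pos _ _)).trans ?_
          have h7 : d * (φ a).1 = prt Q a := Nat.mul_div_cancel' (hdvd a h1 h2)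
          rw [← h7]
          have h8 : (tauM m (d * (φ a).1) : ℝ) ≤ tauM m d * tauM m (φ a).1 := by
            exact_mod_cast tau_mul_le m _ _ hd h5
          refine h8.trans ?_
          gcongr
          exact tau_le_MF m _ h5
        have e3 : (a : ℝ) = d * (φ a).1 * (φ a).2 := by exact_mod_cast h4.symm
        have d0 : (0 : ℝ) < d := by exact_mod_cast hd
        have d1 : (0 : ℝ) < (φ a).1 := by exact_mod_cast h5
        have d2 : (0 : ℝ) < (φ a).2 := by exact_mod_cast h6
        have e4 : G (φ a) = (tauM m d * g (φ a).1 * f (φ a).2) / a := by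
          rw [e3]; simp only [hG]; field_simp
        rw [e4, e1]
        have := hf.nonneg (φ a).2
        gcongr
    _ = ∑ q ∈ ((SM W Y).filter (fun a => d ∣ a)).image φ, G q := (Finset.sum_image hinj).symm
    _ ≤ ∑ q ∈ K ×ˢ SM W Y, G q := Finset.sum_le_sum_of_subset_of_nonneg hmaps fun q _ _ => hG0 q
    _ = ((tauM m d : ℝ) / d) * (∑ k ∈ K, g k / k) * (∑ a ∈ SM W Y, f a / a) := by
        rw [Finset.sum_product, mul_assoc, Finset.sum_mul_sum, Finset.mul_sum]
        refine Finset.sum_congr rfl fun k _ => ?_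
        rw [Finset.mul_sum]
        refine Finset.sum_congr rfl fun a _ => ?_
        simp only [hG]; ring
    _ ≤ ((tauM m d : ℝ) / d) * (C * ∏ p ∈ d.primeFactors, (1 + (m : ℝ) / p)) * (C * ∏ p ∈ PR W, (1 + f p / p)) := by
        have h1 : 0 ≤ ∑ a ∈ SM W Y, f a / a := Finset.sum_nonneg fun a _ => div_nonneg (hf.nonneg a) (by positivity)
        have h2 : 0 ≤ ∏ p ∈ d.primeFactors, (1 + (m : ℝ) / p) := Finset.prod_nonneg fun p _ => by positivity
        gcongr
    _ = _ := by ring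

lemma prod_le_exp_sum (P : Finset ℕ) (c : ℝ) (hc : 0 ≤ c) :
    ∏ p ∈ P, (1 + c / (p : ℝ)) ≤ Real.exp (c * ∑ p ∈ P, (1 : ℝ) / p) := by
  rw [Finset.mul_sum, Real.exp_sum]
  refine Finset.prod_le_prod (fun p _ => by positivity) fun p _ => ?_
  have := Real.add_one_le_exp (c * (1 / (p : ℝ)))
  rw [mul_one_div] at this ⊢
  linarith

lemma S_bound (m : ℕ) : ∃ C : ℝ, 1 ≤ C ∧ ∀ f₁ f₂ : ℕ → ℝ, Coef m f₁ → Coef m f₂ → ∀ W Y l : ℕ, 1 ≤ l →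
    ∑ q ∈ (SM W Y ×ˢ SM W Y).filter (fun q => Nat.gcd q.1 q.2 ∣ l), f₁ q.1 * f₂ q.2 / (Nat.lcm q.1 q.2 : ℕ) ≤
      C * (∏ p ∈ PR W, (1 + f₁ p / p)) * (∏ p ∈ PR W, (1 + f₂ p / p)) *
        Real.exp ((2 * m + m ^ 2) * ∑ p ∈ l.primeFactors, (1 : ℝ) / p) := by
  obtain ⟨C, hC1, hC⟩ := F_bound m
  obtain ⟨B, hB1, hB⟩ := tau_pow_bound m
  obtain ⟨C', hC1', hC'⟩ := euler_bound (B ^ 2) (by positivity)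
  refine ⟨C * C * C', by nlinarith [mul_le_mul hC1 hC1 (by norm_num) (by linarith)], ?_⟩
  intro f₁ f₂ hf₁ hf₂ W Y l hl
  set P1 := ∏ p ∈ PR W, (1 + f₁ p / p) with hP1
  set P2 := ∏ p ∈ PR W, (1 + f₂ p / p) with hP2
  have hP10 : 0 ≤ P1 := Finset.prod_nonneg fun p _ => add_nonneg zero_le_one (div_nonneg (hf₁.nonneg p) (by positivity))
  have hP20 : 0 ≤ P2 := Finset.prod_nonneg fun p _ => add_nonneg zero_le_one (div_nonneg (hf₂.nonneg p) (by positivity))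
  set E := ∑ p ∈ l.primeFactors, (1 : ℝ) / p with hE
  set Sd : (ℕ → ℝ) → ℕ → ℝ := fun f d => ∑ a ∈ (SM W Y).filter (fun a => d ∣ a), f a / a with hSd
  have hSd0 : ∀ f : ℕ → ℝ, Coef m f → ∀ d, 0 ≤ Sd f d := fun f hf d =>
    Finset.sum_nonneg fun a _ => div_nonneg (hf.nonneg a) (by positivity)
  set g : ℕ → ℝ := MF (fun p j => (tauM m (p ^ j) : ℝ) ^ 2) with hg
  have hg0 : ∀ n, 0 ≤ g n := MF_nonneg _ (fun _ _ => by positivity)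
  have hgt : ∀ d : ℕ, 1 ≤ d → (tauM m d : ℝ) ^ 2 ≤ g d := by
    intro d hd
    have h1 := tau_le_MF m d hd
    have h2 : g d = (MF (fun p j => (tauM m (p ^ j) : ℝ)) d) ^ 2 := by
      rw [hg]; unfold MF; rw [← Finset.prod_pow]
    rw [h2]; gcongr
  have st1 : ∑ q ∈ (SM W Y ×ˢ SM W Y).filter (fun q => Nat.gcd q.1 q.2 ∣ l), f₁ q.1 * f₂ q.2 / (Nat.lcm q.1 q.2 : ℕ)
      ≤ ∑ d ∈ l.divisors, (d : ℝ) * (Sd f₁ d * Sd f₂ d) := by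
    have hmap : ∀ q ∈ (SM W Y ×ˢ SM W Y).filter (fun q => Nat.gcd q.1 q.2 ∣ l), Nat.gcd q.1 q.2 ∈ l.divisors := by
      intro q hq
      rw [Finset.mem_filter] at hq
      exact Nat.mem_divisors.2 ⟨hq.2, by omega⟩
    rw [← Finset.sum_fiberwise_of_maps_to hmap]
    refine Finset.sum_le_sum fun d hd => ?_
    have hd1 : 1 ≤ d := Nat.pos_of_mem_divisors hd
    rw [hSd, Finset.sum_mul_sum, ← Finset.sum_product', Finset.mul_sum]
    refine (Finset.sum_le_sum (g := fun q : ℕ × ℕ => (d : ℝ) * (f₁ q.1 / q.1 * (f₂ q.2 / q.2))) ?_).trans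
      (Finset.sum_le_sum_of_subset_of_nonneg ?_ ?_)
    · intro q hq
      rw [Finset.mem_filter, Finset.mem_filter, Finset.mem_product, mem_SM, mem_SM] at hq
      have h1 : (0 : ℝ) < q.1 := by exact_mod_cast hq.1.1.1.1.1
      have h2 : (0 : ℝ) < q.2 := by exact_mod_cast hq.1.1.2.1.1
      have h3 : (d : ℝ) * (Nat.lcm q.1 q.2 : ℕ) = q.1 * q.2 := by
        rw [← hq.2]; exact_mod_cast Nat.gcd_mul_lcm q.1 q.2
      have h4 : (0 : ℝ) < d := by exact_mod_cast hd1
      have h5 : ((Nat.lcm q.1 q.2 : ℕ) : ℝ) = q.1 * q.2 / d := by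
        rw [eq_div_iff h4.ne', mul_comm]; exact h3
      rw [h5]
      apply le_of_eq
      field_simp
    · intro q hq
      rw [Finset.mem_filter, Finset.mem_filter, Finset.mem_product] at hq
      rw [Finset.mem_product, Finset.mem_filter, Finset.mem_filter]
      exact ⟨⟨hq.1.1.1, hq.2 ▸ Nat.gcd_dvd_left _ _⟩, hq.1.1.2, hq.2 ▸ Nat.gcd_dvd_right _ _⟩
    · intro q _ _
      have := hf₁.nonneg q.1; have := hf₂.nonneg q.2
      positivity
  have st2 : ∀ d ∈ l.divisors, (d : ℝ) * (Sd f₁ d * Sd f₂ d) ≤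
      C * C * P1 * P2 * Real.exp (2 * m * E) * (g d / d) := by
    intro d hd
    have hd1 : 1 ≤ d := Nat.pos_of_mem_divisors hd
    have hdl : d ∣ l := Nat.dvd_of_mem_divisors hd
    have hd0 : (0 : ℝ) < d := by exact_mod_cast hd1
    set X := ∏ p ∈ d.primeFactors, (1 + (m : ℝ) / p) with hX
    have hX0 : 0 ≤ X := Finset.prod_nonneg fun p _ => by positivity
    have hXE : X ≤ Real.exp (m * E) := by
      refine (prod_le_exp_sum _ _ (by positivity)).trans (Real.exp_le_exp.2 ?_)
      gcongr
      exact Finset.sum_le_sum_of_subset_of_nonneg (Nat.primeFactors_mono hdl (by omega))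
        fun p _ _ => by positivity
    have b1 : Sd f₁ d ≤ C * ((tauM m d : ℝ) / d) * Real.exp (m * E) * P1 := by
      refine (hC f₁ hf₁ W Y d hd1).trans ?_
      gcongr
    have b2 : Sd f₂ d ≤ C * ((tauM m d : ℝ) / d) * Real.exp (m * E) * P2 := by
      refine (hC f₂ hf₂ W Y d hd1).trans ?_
      gcongr
    have hX2 : Real.exp (2 * m * E) = Real.exp (m * E) * Real.exp (m * E) := by
      rw [← Real.exp_add]; congr 1; ring
    calc (d : ℝ) * (Sd f₁ d * Sd f₂ d) ≤ d * ((C * ((tauM m d : ℝ) / d) * Real.exp (m * E) * P1) * (C * ((tauM m d : ℝ) / d) * Real.exp (m * E) * P2)) := by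
          gcongr
          · exact hSd0 f₂ hf₂ d
      _ = C * C * P1 * P2 * Real.exp (2 * m * E) * ((tauM m d : ℝ) ^ 2 / d) := by
          rw [hX2]; field_simp
      _ ≤ _ := by
          have := hgt d hd1
          gcongr
  have st3 : ∑ d ∈ l.divisors, g d / d ≤ C' * Real.exp (m ^ 2 * E) := by
    refine (hC' g hg0 (MF_one _) (fun a b _ _ h => MF_mul _ h) ?_ l.primeFactors l.divisors
      (fun p hp => Nat.prime_of_mem_primeFactors hp) ?_).trans ?_
    · intro p j hp hj
      rw [hg, MF_prime_pow _ hp (by omega)]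
      refine (pow_le_pow_left₀ (by positivity) (hB p j hp) 2).trans ?_
      rw [mul_pow, ← Real.rpow_natCast ((p : ℝ) ^ ((j : ℝ) / 16)), ← Real.rpow_mul (by positivity)]
      apply mul_le_mul_of_nonneg_left _ (by positivity)
      have := rpow_mono_aux p j hp (1 / 8) (1 / 4) (by norm_num)
      have e1 : (j : ℝ) / 16 * ((2 : ℕ) : ℝ) = (j : ℝ) * (1 / 8) := by push_cast; ring
      have e2 : (j : ℝ) / 4 = (j : ℝ) * (1 / 4) := by ring
      rw [e1, e2]; exact this
    · intro a ha
      have h1 := Nat.dvd_of_mem_divisors ha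
      exact ⟨(Nat.pos_of_mem_divisors ha).ne', fun p hp hpa => Nat.mem_primeFactors.2 ⟨hp, hpa.trans h1, by omega⟩⟩
    · gcongr
      refine le_trans (Finset.prod_le_prod (fun p _ => add_nonneg zero_le_one (div_nonneg (hg0 p) (by positivity))) ?_)
        (prod_le_exp_sum _ _ (by positivity))
      intro p hp
      have hpp := Nat.prime_of_mem_primeFactors hp
      rw [hg, MF_prime _ hpp]
      have : (tauM m (p ^ 1) : ℝ) ≤ m := by rw [pow_one]; exact_mod_cast tau_prime m p hpp
      gcongr
  calc _ ≤ ∑ d ∈ l.divisors, (d : ℝ) * (Sd f₁ d * Sd f₂ d) := st1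
    _ ≤ ∑ d ∈ l.divisors, C * C * P1 * P2 * Real.exp (2 * m * E) * (g d / d) := Finset.sum_le_sum st2
    _ = C * C * P1 * P2 * Real.exp (2 * m * E) * ∑ d ∈ l.divisors, g d / d := (Finset.mul_sum _ _ _).symm
    _ ≤ C * C * P1 * P2 * Real.exp (2 * m * E) * (C' * Real.exp (m ^ 2 * E)) := by gcongr
    _ = _ := by
        rw [add_mul, Real.exp_add]; ring

lemma MF_wt (m : ℕ) (W n : ℕ) (κ : ℝ) (hn : 1 ≤ n) :
    (tauM m n : ℝ) ^ 2 * ((prt (fun p => p ≤ W) n : ℕ) : ℝ) ^ κ ≤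
      MF (fun p j => (tauM m (p ^ j) : ℝ) ^ 2 * (if p ≤ W then (p : ℝ) ^ ((j : ℝ) * κ) else 1)) n := by
  have e : MF (fun p j => (tauM m (p ^ j) : ℝ) ^ 2 * (if p ≤ W then (p : ℝ) ^ ((j : ℝ) * κ) else 1)) n
      = (MF (fun p j => (tauM m (p ^ j) : ℝ)) n) ^ 2 * ((prt (fun p => p ≤ W) n : ℕ) : ℝ) ^ κ := by
    unfold MF prt
    rw [Finset.prod_mul_distrib, Finset.prod_pow]
    congr 1
    rw [← Finset.prod_filter]
    push_cast
    rw [← Real.finsetProd_rpow _ _ (fun p _ => by positivity)]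
    refine Finset.prod_congr (by ext; simp) fun p _ => ?_
    rw [← Real.rpow_natCast, ← Real.rpow_mul (by positivity)]
  rw [e]
  have := tau_le_MF m n hn
  gcongr

lemma exp_le_aux (t β : ℝ) (h0 : 0 ≤ t) (h : t ≤ β) : Real.exp t ≤ 1 + t * Real.exp β := by
  have h1 := Real.add_one_le_exp (-t)
  have h2 : Real.exp t * Real.exp (-t) = 1 := by rw [← Real.exp_add]; simp
  have h3 : Real.exp t ≤ Real.exp β := Real.exp_le_exp.2 h
  have h4 := Real.exp_pos t
  nlinarith

lemma wt_sum (m : ℕ) (β : ℝ) (hβ : 0 ≤ β) : ∃ C : ℝ, 1 ≤ C ∧ ∀ (W N : ℕ) (κ L : ℝ), 0 ≤ κ → κ ≤ 1 / 8 →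
    κ * Real.log W ≤ β → 1 ≤ L → Real.log N ≤ L →
    ∑ n ∈ Finset.Icc 1 N, (tauM m n : ℝ) ^ 2 * ((prt (fun p => p ≤ W) n : ℕ) : ℝ) ^ κ ≤
      C * N * L ^ (8 * (m : ℝ) ^ 2) := by
  obtain ⟨B, hB1, hB⟩ := tau_pow_bound m
  obtain ⟨C, hC1, hC⟩ := euler_bound (B ^ 2) (by positivity)
  refine ⟨C * Real.exp ((m : ℝ) ^ 2 * (10 + 2 * β * Real.exp β)), ?_, ?_⟩
  · have : (1 : ℝ) ≤ Real.exp ((m : ℝ) ^ 2 * (10 + 2 * β * Real.exp β)) := Real.one_le_exp (by positivity)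
    nlinarith
  intro W N κ L hκ0 hκ1 hκW hL hNL
  set f : ℕ → ℝ := MF (fun p j => (tauM m (p ^ j) : ℝ) ^ 2 * (if p ≤ W then (p : ℝ) ^ ((j : ℝ) * κ) else 1)) with hf
  have hf0 : ∀ n, 0 ≤ f n := MF_nonneg _ (fun p j => by split_ifs <;> positivity)
  have h1 : ∑ a ∈ Finset.Icc 1 N, f a / a ≤ C * ∏ p ∈ PR N, (1 + f p / p) := by
    refine hC f hf0 (MF_one _) (fun a b _ _ h => MF_mul _ h) ?_ (PR N) _ (fun p hp => (mem_PR.1 hp).2) ?_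
    · intro p j hp hj
      rw [hf, MF_prime_pow _ hp (by omega)]
      have a1 : (tauM m (p ^ j) : ℝ) ^ 2 ≤ B ^ 2 * (p : ℝ) ^ ((j : ℝ) * (1 / 8)) := by
        refine (pow_le_pow_left₀ (by positivity) (hB p j hp) 2).trans ?_
        rw [mul_pow, ← Real.rpow_natCast ((p : ℝ) ^ ((j : ℝ) / 16)), ← Real.rpow_mul (by positivity)]
        apply le_of_eq
        congr 2
        push_cast; ring
      have a2 : (if p ≤ W then (p : ℝ) ^ ((j : ℝ) * κ) else 1) ≤ (p : ℝ) ^ ((j : ℝ) * (1 / 8)) := by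
        split_ifs
        · exact rpow_mono_aux p j hp _ _ hκ1
        · exact Real.one_le_rpow (by exact_mod_cast hp.one_le) (by positivity)
      have p0 : (0 : ℝ) < p := by exact_mod_cast hp.pos
      calc _ ≤ (B ^ 2 * (p : ℝ) ^ ((j : ℝ) * (1 / 8))) * (p : ℝ) ^ ((j : ℝ) * (1 / 8)) := by
            apply mul_le_mul a1 a2 _ (by positivity)
            split_ifs <;> positivity
        _ = _ := by
            rw [mul_assoc, ← Real.rpow_add p0]
            congr 2; ring
    · intro a ha
      rw [Finset.mem_Icc] at ha
      exact ⟨by omega, fun p hp hpa => mem_PR.2 ⟨(Nat.le_of_dvd (by omega) hpa).trans ha.2, hp⟩⟩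
  have h2 : ∏ p ∈ PR N, (1 + f p / p) ≤ Real.exp (∑ p ∈ PR N, f p / p) := by
    rw [Real.exp_sum]
    refine Finset.prod_le_prod (fun p _ => add_nonneg zero_le_one (div_nonneg (hf0 p) (by positivity))) fun p _ => ?_
    have := Real.add_one_le_exp (f p / p)
    linarith
  have h3 : ∑ p ∈ PR N, f p / p ≤ (m : ℝ) ^ 2 * (∑ p ∈ PR N, (1 : ℝ) / p) +
      (m : ℝ) ^ 2 * (κ * Real.exp β) * ∑ p ∈ PR W, Real.log p / p := by
    have a1 : ∀ p ∈ PR N, f p / p ≤ (m : ℝ) ^ 2 * (1 / p) + (if p ≤ W then (m : ℝ) ^ 2 * (κ * Real.exp β) * (Real.log p / p) else 0) := by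
      intro p hp
      have hpp := (mem_PR.1 hp).2
      have p0 : (0 : ℝ) < p := by exact_mod_cast hpp.pos
      have p1 : (1 : ℝ) ≤ p := by exact_mod_cast hpp.one_le
      have b1 : (tauM m (p ^ 1) : ℝ) ^ 2 ≤ (m : ℝ) ^ 2 := by
        rw [pow_one]
        have : (tauM m p : ℝ) ≤ m := by exact_mod_cast tau_prime m p hpp
        gcongr
      rw [hf, MF_prime _ hpp]
      split_ifs with hW
      · have b2 : (p : ℝ) ^ (((1 : ℕ) : ℝ) * κ) ≤ 1 + κ * Real.log p * Real.exp β := by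
          have e : (p : ℝ) ^ (((1 : ℕ) : ℝ) * κ) = Real.exp (κ * Real.log p) := by
            rw [Real.rpow_def_of_pos p0]; congr 1; push_cast; ring
          rw [e]
          apply exp_le_aux
          · have := Real.log_nonneg p1; positivity
          · refine le_trans ?_ hκW
            have : Real.log p ≤ Real.log W := Real.log_le_log p0 (by exact_mod_cast hW)
            gcongr
        calc _ ≤ ((m : ℝ) ^ 2 * (1 + κ * Real.log p * Real.exp β)) / p := by gcongr
          _ = _ := by ring
      · calc _ ≤ ((m : ℝ) ^ 2 * 1) / p := by gcongr
          _ = _ := by ring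
    refine (Finset.sum_le_sum a1).trans ?_
    rw [Finset.sum_add_distrib, ← Finset.mul_sum, ← Finset.sum_filter, ← Finset.mul_sum]
    refine add_le_add le_rfl (mul_le_mul_of_nonneg_left ?_ (by positivity))
    refine Finset.sum_le_sum_of_subset_of_nonneg ?_ fun p _ _ => ?_
    · intro p hp
      rw [Finset.mem_filter, mem_PR] at hp
      exact mem_PR.2 ⟨hp.2, hp.1.2⟩
    · exact div_nonneg (Real.log_natCast_nonneg p) (by positivity)
  have h4 : ∑ p ∈ PR N, f p / p ≤ 8 * (m : ℝ) ^ 2 * Real.log L + (m : ℝ) ^ 2 * (10 + 2 * β * Real.exp β) := by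
    refine h3.trans ?_
    have m1 := mertens1 W
    have m2 := mertens2 N L hL hNL
    calc _ ≤ (m : ℝ) ^ 2 * (8 * Real.log L + 10) + (m : ℝ) ^ 2 * (κ * Real.exp β) * (2 * Real.log W) := by gcongr
      _ = (m : ℝ) ^ 2 * (8 * Real.log L + 10) + (m : ℝ) ^ 2 * (2 * (κ * Real.log W) * Real.exp β) := by ring
      _ ≤ (m : ℝ) ^ 2 * (8 * Real.log L + 10) + (m : ℝ) ^ 2 * (2 * β * Real.exp β) := by gcongr
      _ = _ := by ring
  have h5 : Real.exp (∑ p ∈ PR N, f p / p) ≤ L ^ (8 * (m : ℝ) ^ 2) * Real.exp ((m : ℝ) ^ 2 * (10 + 2 * β * Real.exp β)) := by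
    rw [Real.rpow_def_of_pos (by linarith), ← Real.exp_add]
    apply Real.exp_le_exp.2
    linarith
  calc _ ≤ ∑ n ∈ Finset.Icc 1 N, (N : ℝ) * (f n / n) := by
        refine Finset.sum_le_sum fun n hn => ?_
        rw [Finset.mem_Icc] at hn
        refine (MF_wt m W n κ hn.1).trans ?_
        have n0 : (0 : ℝ) < n := by exact_mod_cast hn.1
        have n1 : (n : ℝ) ≤ N := by exact_mod_cast hn.2
        have := hf0 n
        rw [← mul_div_assoc, le_div_iff₀ n0, mul_comm]
        gcongr
    _ = N * ∑ n ∈ Finset.Icc 1 N, f n / n := (Finset.mul_sum _ _ _).symm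
    _ ≤ N * (C * (L ^ (8 * (m : ℝ) ^ 2) * Real.exp ((m : ℝ) ^ 2 * (10 + 2 * β * Real.exp β)))) := by
        have := h2.trans h5
        gcongr
        refine h1.trans ?_
        gcongr
    _ = _ := by ring

lemma ev_LL (c : ℝ) (hc : 0 < c) : ∀ᶠ x : ℝ in Filter.atTop, Real.log (Real.log x) ≤ c * Real.log x := by
  have h := (Real.isLittleO_log_id_atTop.comp_tendsto Real.tendsto_log_atTop).bound hc
  have h2 : ∀ᶠ x : ℝ in Filter.atTop, 1 ≤ Real.log x := Real.tendsto_log_atTop.eventually_ge_atTop 1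
  filter_upwards [h, h2] with x hx hx2
  simp only [Function.comp, id, Real.norm_eq_abs] at hx
  rw [abs_of_nonneg (by linarith : 0 ≤ Real.log x)] at hx
  exact (le_abs_self _).trans hx

lemma exc_one (m : ℕ) (e A : ℝ) (he : 0 < e) (hA : 0 ≤ A) : ∃ C : ℝ, 1 ≤ C ∧ ∀ᶠ x : ℝ in Filter.atTop, ∀ W : ℕ,
    Real.log W ≤ Real.log x / (e * Real.log (Real.log x)) →
    ∑ n ∈ (Finset.Icc 1 ⌊2 * x⌋₊).filter (fun n => x ^ (1 / 8 : ℝ) < (prt (fun p => p ≤ W) n : ℕ)), (tauM m n : ℝ) ^ 2 ≤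
      C * x * (Real.log x) ^ (-A) := by
  set β := 8 * (A + 8 * (m : ℝ) ^ 2) / e with hβ
  have hβ0 : 0 ≤ β := by positivity
  obtain ⟨C, hC1, hC⟩ := wt_sum m β hβ0
  refine ⟨C * 2 * 2 ^ (8 * (m : ℝ) ^ 2), ?_, ?_⟩
  · have : (1 : ℝ) ≤ 2 ^ (8 * (m : ℝ) ^ 2) := Real.one_le_rpow (by norm_num) (by positivity)
    nlinarith
  filter_upwards [ev_LL (1 / (8 * (β * e + 1))) (by positivity), Real.tendsto_log_atTop.eventually_ge_atTop 3,
    Filter.eventually_ge_atTop 2] with x hx1 hx2 hx3 W hW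
  set L := Real.log x with hL
  have hx0 : 0 < x := by linarith
  have hLL : 0 < Real.log L := Real.log_pos (by linarith)
  set κ := β * e * Real.log L / L with hκ
  have hκ0 : 0 ≤ κ := by positivity
  have hκ1 : κ ≤ 1 / 8 := by
    rw [hκ, div_le_iff₀ (by linarith)]
    calc β * e * Real.log L ≤ β * e * (1 / (8 * (β * e + 1)) * L) := by gcongr
      _ = (1 / 8) * L * (β * e / (β * e + 1)) := by field_simp
      _ ≤ (1 / 8) * L * 1 := by
          gcongr
          rw [div_le_one (by positivity)]; linarith
      _ = _ := by ring
  have hκW : κ * Real.log W ≤ β := by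
    calc κ * Real.log W ≤ κ * (L / (e * Real.log L)) := by gcongr
      _ = β := by rw [hκ]; field_simp
  have hN : (⌊2 * x⌋₊ : ℝ) ≤ 2 * x := Nat.floor_le (by linarith)
  have hN1 : (1 : ℝ) ≤ ⌊2 * x⌋₊ := by
    exact_mod_cast Nat.le_floor (by push_cast; linarith)
  have hNL : Real.log (⌊2 * x⌋₊ : ℝ) ≤ 2 * L := by
    refine (Real.log_le_log (by linarith) hN).trans ?_
    rw [Real.log_mul (by norm_num) (by linarith)]
    have : Real.log 2 ≤ L := Real.log_le_log (by norm_num) hx3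
    linarith
  have key := hC W ⌊2 * x⌋₊ κ (2 * L) hκ0 hκ1 hκW (by linarith) hNL
  have hxk : (x ^ (1 / 8 : ℝ)) ^ κ = L ^ (A + 8 * (m : ℝ) ^ 2) := by
    rw [← Real.rpow_mul hx0.le, Real.rpow_def_of_pos hx0, Real.rpow_def_of_pos (by linarith), ← hL]
    congr 1
    rw [hκ, hβ]; field_simp
  have hD : 0 < L ^ (A + 8 * (m : ℝ) ^ 2) := Real.rpow_pos_of_pos (by linarith) _
  have step : L ^ (A + 8 * (m : ℝ) ^ 2) * ∑ n ∈ (Finset.Icc 1 ⌊2 * x⌋₊).filter (fun n => x ^ (1 / 8 : ℝ) < (prt (fun p => p ≤ W) n : ℕ)), (tauM m n : ℝ) ^ 2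
      ≤ C * (2 * x) * (2 * L) ^ (8 * (m : ℝ) ^ 2) := by
    calc _ ≤ ∑ n ∈ (Finset.Icc 1 ⌊2 * x⌋₊).filter (fun n => x ^ (1 / 8 : ℝ) < (prt (fun p => p ≤ W) n : ℕ)), (tauM m n : ℝ) ^ 2 * ((prt (fun p => p ≤ W) n : ℕ) : ℝ) ^ κ := by
          rw [Finset.mul_sum]
          refine Finset.sum_le_sum fun n hn => ?_
          rw [Finset.mem_filter] at hn
          rw [mul_comm, ← hxk]
          have := hn.2
          gcongr
      _ ≤ ∑ n ∈ Finset.Icc 1 ⌊2 * x⌋₊, (tauM m n : ℝ) ^ 2 * ((prt (fun p => p ≤ W) n : ℕ) : ℝ) ^ κ :=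
          Finset.sum_le_sum_of_subset_of_nonneg (Finset.filter_subset _ _) fun _ _ _ => by positivity
      _ ≤ _ := key
      _ ≤ _ := by gcongr
  rw [Real.mul_rpow (by norm_num) (by linarith)] at step
  have e1 : C * 2 * 2 ^ (8 * (m : ℝ) ^ 2) * x * L ^ (-A) = (C * (2 * x) * (2 ^ (8 * (m : ℝ) ^ 2) * L ^ (8 * (m : ℝ) ^ 2))) / L ^ (A + 8 * (m : ℝ) ^ 2) := by
    rw [eq_div_iff hD.ne', mul_assoc _ (L ^ (-A)), ← Real.rpow_add (by linarith)]
    rw [show -A + (A + 8 * (m : ℝ) ^ 2) = 8 * (m : ℝ) ^ 2 by ring]; ring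
  rw [e1, le_div_iff₀ hD, mul_comm]
  exact step

lemma sq_sum (m : ℕ) : ∃ C : ℝ, 1 ≤ C ∧ ∀ᶠ x : ℝ in Filter.atTop,
    ∑ n ∈ (Finset.Icc 1 ⌊2 * x⌋₊), (tauM m n : ℝ) ^ 2 ≤ C * x * (Real.log x) ^ (8 * (m : ℝ) ^ 2) := by
  obtain ⟨C, hC1, hC⟩ := wt_sum m 0 le_rfl
  refine ⟨C * 2 * 2 ^ (8 * (m : ℝ) ^ 2), ?_, ?_⟩
  · have : (1 : ℝ) ≤ 2 ^ (8 * (m : ℝ) ^ 2) := Real.one_le_rpow (by norm_num) (by positivity)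
    nlinarith
  filter_upwards [Real.tendsto_log_atTop.eventually_ge_atTop 3,
    Filter.eventually_ge_atTop 2] with x hx2 hx3
  have hN : (⌊2 * x⌋₊ : ℝ) ≤ 2 * x := Nat.floor_le (by linarith)
  have hN1 : (1 : ℝ) ≤ ⌊2 * x⌋₊ := by
    exact_mod_cast Nat.le_floor (by push_cast; linarith)
  have hNL : Real.log (⌊2 * x⌋₊ : ℝ) ≤ 2 * Real.log x := by
    refine (Real.log_le_log (by linarith) hN).trans ?_
    rw [Real.log_mul (by norm_num) (by linarith)]
    have : Real.log 2 ≤ Real.log x := Real.log_le_log (by norm_num) hx3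
    linarith
  have key := hC 0 ⌊2 * x⌋₊ 0 (2 * Real.log x) le_rfl (by norm_num) (by simp) (by linarith) hNL
  simp only [Real.rpow_zero, mul_one] at key
  refine key.trans ?_
  rw [Real.mul_rpow (by norm_num) (by linarith)]
  calc _ ≤ C * (2 * x) * (2 ^ (8 * (m : ℝ) ^ 2) * Real.log x ^ (8 * (m : ℝ) ^ 2)) := by gcongr
    _ = _ := by ring

lemma exc (m : ℕ) (e : ℝ) (he : 0 < e) : ∃ C : ℝ, 1 ≤ C ∧ ∀ᶠ x : ℝ in Filter.atTop, ∀ W : ℕ,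
    Real.log W ≤ Real.log x / (e * Real.log (Real.log x)) → ∀ ℓ : ℤ, (|ℓ| : ℝ) ≤ x →
    ∑ n ∈ (Finset.Icc 1 ⌊x⌋₊).filter (fun n : ℕ => 1 ≤ (n : ℤ) + ℓ ∧
      (x ^ (1 / 8 : ℝ) < (prt (fun p => p ≤ W) n : ℕ) ∨ x ^ (1 / 8 : ℝ) < (prt (fun p => p ≤ W) ((n : ℤ) + ℓ).toNat : ℕ))),
      (tauM m n : ℝ) * tauM m ((n : ℤ) + ℓ).toNat ≤ C * x * (Real.log x) ^ (-2 : ℝ) := by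
  obtain ⟨C1, hC1, h1⟩ := exc_one m e (8 * (m : ℝ) ^ 2 + 4) he (by positivity)
  obtain ⟨C2, hC2, h2⟩ := sq_sum m
  refine ⟨2 * (C1 + C2), by linarith, ?_⟩
  filter_upwards [h1, h2, Real.tendsto_log_atTop.eventually_ge_atTop 1, Filter.eventually_ge_atTop 2] with x h1 h2 hL hx2 W hW ℓ hℓ
  have h1 := h1 W hW
  set L := Real.log x with hLdef
  have hL0 : 0 < L := by linarith
  set U := L ^ (8 * (m : ℝ) ^ 2 + 2) with hU
  set V := L ^ (-(8 * (m : ℝ) ^ 2 + 2)) with hV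
  have hU0 : 0 < U := Real.rpow_pos_of_pos hL0 _
  have hV0 : 0 < V := Real.rpow_pos_of_pos hL0 _
  have hUV : U * V = 1 := by rw [hU, hV, ← Real.rpow_add hL0]; simp
  have amgm : ∀ s t : ℝ, 0 ≤ s → 0 ≤ t → s * t ≤ U * s ^ 2 + V * t ^ 2 := by
    intro s t hs ht
    have : 0 ≤ U * (s - V * t) ^ 2 := by positivity
    have e : U * (s - V * t) ^ 2 = U * s ^ 2 - 2 * (U * V) * (s * t) + (U * V) * V * t ^ 2 := by ring
    rw [e, hUV] at this
    nlinarith [mul_nonneg hs ht, mul_nonneg hU0.le (sq_nonneg s)]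
  set ex : ℕ → Prop := fun n => x ^ (1 / 8 : ℝ) < (prt (fun p => p ≤ W) n : ℕ) with hex
  set H : ℕ → ℝ := fun n => (if ex n then U * (tauM m n : ℝ) ^ 2 else 0) + V * (tauM m n : ℝ) ^ 2 with hH
  have hH0 : ∀ n, 0 ≤ H n := fun n => by simp only [hH]; split_ifs <;> positivity
  have hsum : ∑ n ∈ Finset.Icc 1 ⌊2 * x⌋₊, H n ≤ (C1 + C2) * x * L ^ (-2 : ℝ) := by
    simp only [hH]
    rw [Finset.sum_add_distrib, ← Finset.sum_filter, ← Finset.mul_sum, ← Finset.mul_sum]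
    calc _ ≤ U * (C1 * x * L ^ (-(8 * (m : ℝ) ^ 2 + 4))) + V * (C2 * x * L ^ (8 * (m : ℝ) ^ 2)) := by
          gcongr
      _ = C1 * x * (U * L ^ (-(8 * (m : ℝ) ^ 2 + 4))) + C2 * x * (V * L ^ (8 * (m : ℝ) ^ 2)) := by ring
      _ = _ := by
          rw [hU, hV, ← Real.rpow_add hL0, ← Real.rpow_add hL0]
          rw [show 8 * (m : ℝ) ^ 2 + 2 + -(8 * (m : ℝ) ^ 2 + 4) = -2 by ring,
            show -(8 * (m : ℝ) ^ 2 + 2) + 8 * (m : ℝ) ^ 2 = -2 by ring]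
          ring
  set S := (Finset.Icc 1 ⌊x⌋₊).filter (fun n : ℕ => 1 ≤ (n : ℤ) + ℓ ∧ (ex n ∨ ex ((n : ℤ) + ℓ).toNat)) with hS
  have p1 : ∑ n ∈ S, H n ≤ ∑ n ∈ Finset.Icc 1 ⌊2 * x⌋₊, H n := by
    refine Finset.sum_le_sum_of_subset_of_nonneg ?_ fun n _ _ => hH0 n
    intro n hn
    rw [hS, Finset.mem_filter, Finset.mem_Icc] at hn
    rw [Finset.mem_Icc]
    exact ⟨hn.1.1, hn.1.2.trans (Nat.floor_mono (by linarith))⟩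
  have p2 : ∑ n ∈ S, H ((n : ℤ) + ℓ).toNat ≤ ∑ n ∈ Finset.Icc 1 ⌊2 * x⌋₊, H n := by
    rw [← Finset.sum_image (g := fun n : ℕ => ((n : ℤ) + ℓ).toNat) (f := H)]
    · refine Finset.sum_le_sum_of_subset_of_nonneg ?_ fun n _ _ => hH0 n
      intro k hk
      obtain ⟨n, hn, rfl⟩ := Finset.mem_image.1 hk
      rw [hS, Finset.mem_filter, Finset.mem_Icc] at hn
      rw [Finset.mem_Icc]
      refine ⟨by omega, Nat.le_floor ?_⟩
      have a1 : ((((n : ℤ) + ℓ).toNat : ℕ) : ℤ) = n + ℓ := Int.toNat_of_nonneg (by omega)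
      have a2 : ((((n : ℤ) + ℓ).toNat : ℕ) : ℝ) = n + ℓ := by exact_mod_cast a1
      have a3 : (n : ℝ) ≤ x := (Nat.le_floor_iff (by linarith)).1 hn.1.2
      have a4 := le_abs_self (ℓ : ℝ)
      have : ((((n : ℤ) + ℓ).toNat : ℕ) : ℝ) ≤ 2 * x := by rw [a2]; linarith
      exact this
    · intro a ha b hb hab
      have ha' := ha
      rw [hS, Finset.mem_coe, Finset.mem_filter] at ha hb
      simp only at hab
      omega
  calc _ ≤ ∑ n ∈ S, (H n + H ((n : ℤ) + ℓ).toNat) := by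
        refine Finset.sum_le_sum fun n hn => ?_
        rw [hS, Finset.mem_filter] at hn
        set s : ℝ := (tauM m n : ℝ)
        set t : ℝ := (tauM m ((n : ℤ) + ℓ).toNat : ℝ)
        have s0 : 0 ≤ s := by positivity
        have t0 : 0 ≤ t := by positivity
        rcases hn.2.2 with h | h
        · have b1 : U * s ^ 2 ≤ H n := by
            simp only [hH]; rw [if_pos h]
            have : 0 ≤ V * s ^ 2 := by positivity
            linarith
          have b2 : V * t ^ 2 ≤ H ((n : ℤ) + ℓ).toNat := by
            simp only [hH]
            have : 0 ≤ U * t ^ 2 := by positivity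
            split_ifs <;> linarith
          linarith [amgm s t s0 t0]
        · have b1 : V * s ^ 2 ≤ H n := by
            simp only [hH]
            have : 0 ≤ U * s ^ 2 := by positivity
            split_ifs <;> linarith
          have b2 : U * t ^ 2 ≤ H ((n : ℤ) + ℓ).toNat := by
            simp only [hH]; rw [if_pos h]
            have : 0 ≤ V * t ^ 2 := by positivity
            linarith
          linarith [amgm t s t0 s0]
    _ = ∑ n ∈ S, H n + ∑ n ∈ S, H ((n : ℤ) + ℓ).toNat := Finset.sum_add_distrib
    _ ≤ (C1 + C2) * x * L ^ (-2 : ℝ) + (C1 + C2) * x * L ^ (-2 : ℝ) := add_le_add (p1.trans hsum) (p2.trans hsum)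
    _ = _ := by ring

lemma ev_LLL (c : ℝ) (hc : 0 < c) :
    ∀ᶠ x : ℝ in Filter.atTop, Real.log (Real.log (Real.log x)) ≤ c * Real.log (Real.log x) :=
  Real.tendsto_log_atTop.eventually (ev_LL c hc)

lemma ev_pow (c η : ℝ) (hc : 0 < c) (hη : 0 < η) :
    ∀ᶠ x : ℝ in Filter.atTop, Real.log (Real.log x) ≤ c * (Real.log x) ^ η := by
  have h := (isLittleO_log_rpow_atTop hη).bound hc
  have h1 := Real.tendsto_log_atTop.eventually h
  filter_upwards [h1, Real.tendsto_log_atTop.eventually_ge_atTop 1] with x hx hx1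
  rw [Real.norm_eq_abs, Real.norm_eq_abs, abs_of_nonneg (Real.rpow_nonneg (by linarith) η)] at hx
  exact (le_abs_self _).trans hx

lemma count_pair (η : ℝ) (h0 : 0 < η) (h1 : η < 1) : ∃ C : ℝ, 1 ≤ C ∧ ∀ᶠ x : ℝ in Filter.atTop, ∀ ℓ : ℤ, ℓ ≠ 0 →
    (|ℓ| : ℝ) ≤ x → ∀ a a' : ℕ, 1 ≤ a → 1 ≤ a' → (a : ℝ) ≤ x ^ (1 / 8 : ℝ) → (a' : ℝ) ≤ x ^ (1 / 8 : ℝ) →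
    ((Nat.gcd a a' : ℕ) : ℤ) ∣ ℓ →
    (((Om a a' ℓ ⌊x⌋₊).filter (fun n => ∀ p ∈ (PR ⌊Real.exp ((Real.log x) ^ (1 - η))⌋₊).filter
      (fun p => ¬ p ∣ a * a' * ℓ.natAbs), ¬ (p ∣ n ∨ (p : ℤ) ∣ (n : ℤ) + ℓ))).card : ℝ) ≤
      C * x * (Real.log x) ^ (-2 + 3 * η) * (1 / (Nat.lcm a a' : ℕ)) := by
  refine ⟨Real.exp 72 + Real.exp 60 + Real.exp 2, ?_, ?_⟩
  · have := Real.one_le_exp (show (0 : ℝ) ≤ 72 by norm_num)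
    have := Real.exp_pos 60
    have := Real.exp_pos 2
    linarith
  filter_upwards [ev_LLL (η / 32) (by positivity), ev_pow (1 / 432) η (by norm_num) h0, ev_LL (1 / 4) (by norm_num),
    Real.tendsto_log_atTop.eventually_ge_atTop 3, Filter.eventually_ge_atTop 2] with x e1 e2 e3 e4 e5 ℓ hℓ hℓx a a' ha ha' hax hax' hg
  set L := Real.log x with hL
  have hx0 : 0 < x := by linarith
  have hL0 : 0 < L := by linarith
  have hLL : 1 ≤ Real.log L := by
    rw [Real.le_log_iff_exp_le hL0]
    exact Real.exp_one_lt_three.le.trans e4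
  set R := Real.exp (L ^ (1 - η)) with hR
  set Z := ⌊R⌋₊ with hZ
  have hLη : 1 ≤ L ^ (1 - η) := Real.one_le_rpow (by linarith) (by linarith)
  have hR1 : 1 ≤ R := Real.one_le_exp (by linarith)
  have hZ1 : 1 ≤ Z := Nat.le_floor (by simpa using hR1)
  set M := a * a' * ℓ.natAbs with hM
  have hl1 : 1 ≤ ℓ.natAbs := Int.natAbs_pos.2 hℓ
  have hM1 : 1 ≤ M := Nat.mul_pos (Nat.mul_pos ha ha') hl1
  set P := (PR Z).filter (fun p => ¬ p ∣ M) with hP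
  set k := ⌈26 * Real.log L⌉₊ with hk
  have hk1 : 26 * Real.log L ≤ k := Nat.le_ceil _
  have hk2 : (k : ℝ) ≤ 26 * Real.log L + 1 := (Nat.ceil_lt_add_one (by linarith)).le
  have hcard : (P.card : ℝ) ≤ R := by
    have b1 : P.card ≤ (Finset.Icc 2 Z).card := Finset.card_le_card ((Finset.filter_subset _ _).trans (Finset.filter_subset _ _))
    rw [Nat.card_Icc] at b1
    have b2 : P.card ≤ Z := by omega
    calc (P.card : ℝ) ≤ Z := by exact_mod_cast b2
      _ ≤ R := Nat.floor_le (by linarith)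
  have hmemP : ∀ p ∈ P, p.Prime ∧ ¬ p ∣ a ∧ ¬ p ∣ a' ∧ ¬ (p : ℤ) ∣ ℓ := by
    intro p hp
    rw [hP, Finset.mem_filter, mem_PR] at hp
    refine ⟨hp.1.2, fun h => hp.2 ?_, fun h => hp.2 ?_, fun h => hp.2 ?_⟩
    · exact (h.mul_right a').mul_right _
    · exact (h.mul_left a).mul_right _
    · exact (Int.natCast_dvd.1 h).mul_left _
  have key := sieve_pair ℓ ⌊x⌋₊ P a a' ha ha' hg hmemP k R (Real.exp 1) hR1 (Real.one_le_exp (by norm_num)) hcard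
  refine key.trans ?_
  set q : ℝ := ((Nat.lcm a a' : ℕ) : ℝ) with hq
  have hq0 : 0 < q := by
    have : 0 < Nat.lcm a a' := Nat.lcm_pos ha ha'
    rw [hq]; exact_mod_cast this
  have ha0 : (0 : ℝ) < a := by exact_mod_cast ha
  have ha0' : (0 : ℝ) < a' := by exact_mod_cast ha'
  have hqx : q ≤ x ^ (1 / 4 : ℝ) := by
    have b1 : Nat.lcm a a' ≤ a * a' := Nat.le_of_dvd (Nat.mul_pos ha ha') (Nat.lcm_dvd_mul a a')
    have b2 : q ≤ a * a' := by rw [hq]; exact_mod_cast b1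
    calc q ≤ a * a' := b2
      _ ≤ x ^ (1 / 8 : ℝ) * x ^ (1 / 8 : ℝ) := by gcongr
      _ = x ^ (1 / 4 : ℝ) := by rw [← Real.rpow_add hx0]; norm_num
  have hlogM : Real.log M ≤ 4 * L := by
    have c1 : Real.log a ≤ 1 / 8 * L := by
      rw [hL, ← Real.log_rpow hx0]; exact Real.log_le_log ha0 hax
    have c2 : Real.log a' ≤ 1 / 8 * L := by
      rw [hL, ← Real.log_rpow hx0]; exact Real.log_le_log ha0' hax'
    have hl0 : (0 : ℝ) < ℓ.natAbs := by exact_mod_cast hl1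
    have c3 : Real.log ℓ.natAbs ≤ L := by
      apply Real.log_le_log hl0
      rw [Nat.cast_natAbs]; push_cast; exact hℓx
    rw [hM]; push_cast
    have hl0' : (|(ℓ : ℝ)|) ≠ 0 := abs_ne_zero.2 (by exact_mod_cast hℓ)
    have c3' : Real.log |(ℓ : ℝ)| ≤ L := Real.log_le_log (abs_pos.2 (by exact_mod_cast hℓ)) hℓx
    first
      | rw [Real.log_mul (by positivity) hl0', Real.log_mul ha0.ne' ha0'.ne']; linarith
      | rw [Real.log_mul (by positivity) hl0.ne', Real.log_mul ha0.ne' ha0'.ne']; linarith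
  have hpds := prime_div_sum M hM1 L (by linarith) hlogM
  have hV : ∏ p ∈ P, (1 - 2 / (p : ℝ)) ≤ Real.exp 72 * L ^ (-2 + 3 * η) := by
    refine (V_bound Z M hZ1 hM1).trans ?_
    have d1 : L ^ (1 - η) ≤ Real.log (Z + 1) := by
      rw [Real.le_log_iff_exp_le (by positivity)]
      exact (Nat.lt_floor_add_one R).le
    have d2 : (1 / Real.log (Z + 1)) ^ 2 ≤ L ^ (-2 + 2 * η) := by
      calc (1 / Real.log (Z + 1)) ^ 2 ≤ (1 / L ^ (1 - η)) ^ 2 := by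
            have : 0 < Real.log ((Z : ℝ) + 1) := by linarith
            gcongr
        _ = L ^ (-2 + 2 * η) := by
            rw [one_div, ← Real.rpow_neg hL0.le, ← Real.rpow_natCast, ← Real.rpow_mul hL0.le]
            congr 1; push_cast; ring
    have d3 : Real.exp (4 * ∑ p ∈ M.primeFactors, (1 : ℝ) / p) ≤ Real.exp 72 * L ^ η := by
      rw [Real.rpow_def_of_pos hL0, ← Real.exp_add]
      apply Real.exp_le_exp.2
      linarith
    calc _ ≤ L ^ (-2 + 2 * η) * (Real.exp 72 * L ^ η) := by gcongr
      _ = Real.exp 72 * (L ^ (-2 + 2 * η) * L ^ η) := by ring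
      _ = _ := by rw [← Real.rpow_add hL0]; congr 2; ring
  have hmono : L ^ (-2 : ℝ) ≤ L ^ (-2 + 3 * η) := Real.rpow_le_rpow_of_exponent_le (by linarith) (by linarith)
  have hT : (∏ p ∈ P, (1 + Real.exp 1 * (2 / (p : ℝ)))) / Real.exp 1 ^ (2 * k) ≤ Real.exp 60 * L ^ (-2 + 3 * η) := by
    have f1 : ∏ p ∈ P, (1 + Real.exp 1 * (2 / (p : ℝ))) ≤ Real.exp (48 * Real.log L + 60) := by
      have g1 : ∏ p ∈ P, (1 + Real.exp 1 * (2 / (p : ℝ))) = ∏ p ∈ P, (1 + (Real.exp 1 * 2) / (p : ℝ)) :=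
        Finset.prod_congr rfl fun p _ => by ring
      rw [g1]
      refine (prod_le_exp_sum P _ (by positivity)).trans (Real.exp_le_exp.2 ?_)
      have g2 : ∑ p ∈ P, (1 : ℝ) / p ≤ ∑ p ∈ PR Z, (1 : ℝ) / p :=
        Finset.sum_le_sum_of_subset_of_nonneg (Finset.filter_subset _ _) fun _ _ _ => by positivity
      have g3 : Real.log Z ≤ L := by
        have hz0 : (0 : ℝ) < Z := by exact_mod_cast hZ1
        calc Real.log Z ≤ Real.log R := Real.log_le_log hz0 (Nat.floor_le (by linarith))
          _ = L ^ (1 - η) := Real.log_exp _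
          _ ≤ L ^ (1 : ℝ) := Real.rpow_le_rpow_of_exponent_le (by linarith) (by linarith)
          _ = L := Real.rpow_one L
      have g4 := mertens2 Z L (by linarith) g3
      have g5 := Real.exp_one_lt_three.le
      calc Real.exp 1 * 2 * ∑ p ∈ P, (1 : ℝ) / p ≤ 3 * 2 * (8 * Real.log L + 10) := by
            have : 0 ≤ ∑ p ∈ P, (1 : ℝ) / p := Finset.sum_nonneg fun _ _ => by positivity
            have := g2.trans g4
            gcongr
        _ = _ := by ring
    calc _ ≤ Real.exp (48 * Real.log L + 60) / Real.exp 1 ^ (2 * k) := by gcongr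
      _ = Real.exp (48 * Real.log L + 60 - 2 * k) := by
          rw [← Real.exp_nat_mul, ← Real.exp_sub]; congr 1; push_cast; ring
      _ ≤ Real.exp (60 + Real.log L * (-2)) := by
          apply Real.exp_le_exp.2
          linarith
      _ = Real.exp 60 * L ^ (-2 : ℝ) := by rw [Real.exp_add, Real.rpow_def_of_pos hL0]
      _ ≤ _ := by gcongr
  have hlast : R ^ (2 * k) ≤ x * L ^ (-2 + 3 * η) * (1 / q) := by
    have i1 : R ^ (2 * k) ≤ x ^ (1 / 8 : ℝ) := by
      rw [hR, ← Real.exp_nat_mul, Real.rpow_def_of_pos hx0]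
      apply Real.exp_le_exp.2
      push_cast
      have j1 : 2 * (k : ℝ) ≤ 54 * Real.log L := by linarith
      calc 2 * (k : ℝ) * L ^ (1 - η) ≤ 54 * (1 / 432 * L ^ η) * L ^ (1 - η) := by
            have : 2 * (k : ℝ) ≤ 54 * (1 / 432 * L ^ η) := by linarith
            gcongr
        _ = (1 / 8) * (L ^ η * L ^ (1 - η)) := by ring
        _ = L * (1 / 8) := by rw [← Real.rpow_add hL0]; norm_num; ring
    have i2 : x ^ (1 / 8 : ℝ) ≤ x ^ (3 / 4 : ℝ) * L ^ (-2 : ℝ) := by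
      rw [Real.rpow_def_of_pos hx0, Real.rpow_def_of_pos hx0, Real.rpow_def_of_pos hL0, ← Real.exp_add]
      apply Real.exp_le_exp.2
      rw [← hL]; linarith
    have i3 : x ^ (3 / 4 : ℝ) ≤ x * (1 / q) := by
      rw [mul_one_div, le_div_iff₀ hq0]
      calc x ^ (3 / 4 : ℝ) * q ≤ x ^ (3 / 4 : ℝ) * x ^ (1 / 4 : ℝ) := by gcongr
        _ = x := by rw [← Real.rpow_add hx0]; norm_num
    calc R ^ (2 * k) ≤ x ^ (3 / 4 : ℝ) * L ^ (-2 : ℝ) := i1.trans i2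
      _ ≤ (x * (1 / q)) * L ^ (-2 + 3 * η) := by gcongr
      _ = _ := by ring
  have hN : (⌊x⌋₊ : ℝ) / q ≤ x * (1 / q) := by
    rw [mul_one_div]
    have := Nat.floor_le hx0.le
    gcongr
  have hD0 : 0 < L ^ (-2 + 3 * η) := Real.rpow_pos_of_pos hL0 _
  calc _ ≤ (x * (1 / q)) * (Real.exp 72 * L ^ (-2 + 3 * η) + Real.exp 60 * L ^ (-2 + 3 * η)) + Real.exp 2 * (x * L ^ (-2 + 3 * η) * (1 / q)) := by
        apply add_le_add
        · refine (mul_le_mul_of_nonneg_left (add_le_add hV hT) (by positivity)).trans ?_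
          gcongr
        · gcongr
    _ = _ := by ring

lemma rough_bound (m : ℕ) (hm : 1 ≤ m) (W n : ℕ) (w : ℝ) (hw : w < W + 1) (hw1 : 1 < w) (hn : 1 ≤ n) :
    (tauM m (prt (fun p => ¬ p ≤ W) n) : ℝ) ≤ Real.exp (Real.log m * (Real.log n / Real.log w)) := by
  set b := prt (fun p => ¬ p ≤ W) n with hb
  have hb1 : 1 ≤ b := prt_pos _ _
  have h1 : (tauM m b : ℝ) ≤ (m : ℝ) ^ b.primeFactorsList.length := by exact_mod_cast tau_le_pow m b hb1
  refine h1.trans ?_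
  have h2 : (W + 1) ^ b.primeFactorsList.length ≤ b := by
    calc (W + 1) ^ b.primeFactorsList.length ≤ b.primeFactorsList.prod := by
          apply List.pow_card_le_prod
          intro p hp
          have hpp := Nat.prime_of_mem_primeFactorsList hp
          have := (prt_prime (fun p => ¬ p ≤ W) n p hpp (Nat.dvd_of_mem_primeFactorsList hp)).1
          omega
      _ = b := Nat.prod_primeFactorsList (by omega)
  have h3 : b ≤ n := Nat.le_of_dvd hn ⟨_, by rw [mul_comm]; exact (prt_mul (fun p => p ≤ W) n hn).symm⟩
  have h4 : w ^ b.primeFactorsList.length ≤ n := by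
    calc w ^ b.primeFactorsList.length ≤ ((W : ℝ) + 1) ^ b.primeFactorsList.length := by gcongr
      _ ≤ n := by exact_mod_cast h2.trans h3
  have hlw : 0 < Real.log w := Real.log_pos hw1
  have h5 : (b.primeFactorsList.length : ℝ) ≤ Real.log n / Real.log w := by
    rw [le_div_iff₀ hlw, ← Real.log_pow]
    exact Real.log_le_log (by positivity) h4
  have hm0 : (0 : ℝ) < m := by exact_mod_cast hm
  have hlm : 0 ≤ Real.log m := Real.log_natCast_nonneg m
  calc (m : ℝ) ^ b.primeFactorsList.length = Real.exp (Real.log m * b.primeFactorsList.length) := by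
        rw [← Real.rpow_natCast, Real.rpow_def_of_pos hm0]
    _ ≤ _ := by
        apply Real.exp_le_exp.2
        gcongr

lemma coef_le_smooth (m : ℕ) (f : ℕ → ℝ) (hf : Coef m f) (W n : ℕ) (hn : 1 ≤ n) (E : ℝ)
    (hE : (tauM m (prt (fun p => ¬ p ≤ W) n) : ℝ) ≤ E) : f n ≤ f (prt (fun p => p ≤ W) n) * E := by
  have h : f n = f (prt (fun p => p ≤ W) n) * f (prt (fun p => ¬ p ≤ W) n) := by
    conv_lhs => rw [← prt_mul (fun p => p ≤ W) n hn]
    exact hf.mul _ _ (prt_pos _ _) (prt_pos _ _) (prt_coprime _ _)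
  rw [h]
  exact mul_le_mul_of_nonneg_left ((hf.le _ (prt_pos _ _)).trans hE) (hf.nonneg _)

lemma prod_change (m : ℕ) (f : ℕ → ℝ) (hf : Coef m f) (V W : ℕ) (hV : 2 ≤ V) (hVW : V ≤ W) :
    ∏ p ∈ PR W, (1 + f p / p) ≤ (∏ p ∈ PR V, (1 + f p / p)) * Real.exp (m * (2 * Real.log W / Real.log V)) := by
  rw [← Finset.prod_filter_mul_prod_filter_not (PR W) (fun p => V < p), mul_comm]
  have e : (PR W).filter (fun p => ¬ V < p) = PR V := by
    ext p
    rw [Finset.mem_filter, mem_PR, mem_PR]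
    constructor
    · rintro ⟨h1, h2⟩; exact ⟨by omega, h1.2⟩
    · rintro ⟨h1, h2⟩; exact ⟨⟨by omega, h2⟩, by omega⟩
  rw [e]
  have h0 : 0 ≤ ∏ p ∈ PR V, (1 + f p / p) :=
    Finset.prod_nonneg fun p _ => add_nonneg zero_le_one (div_nonneg (hf.nonneg p) (by positivity))
  apply mul_le_mul_of_nonneg_left _ h0
  have h1 : ∏ p ∈ (PR W).filter (fun p => V < p), (1 + f p / p) ≤ ∏ p ∈ (PR W).filter (fun p => V < p), (1 + (m : ℝ) / p) := by
    refine Finset.prod_le_prod (fun p _ => add_nonneg zero_le_one (div_nonneg (hf.nonneg p) (by positivity))) fun p hp => ?_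
    have hpp := (mem_PR.1 (Finset.mem_filter.1 hp).1).2
    have : f p ≤ m := (hf.le p hpp.one_le).trans (by exact_mod_cast tau_prime m p hpp)
    gcongr
  refine h1.trans ((prod_le_exp_sum _ _ (by positivity)).trans (Real.exp_le_exp.2 ?_))
  have := mertens_between V W hV
  gcongr

lemma fiber_bound (ℓ : ℤ) (N W Z a a' : ℕ) (hZW : Z ≤ W) (S : Finset ℕ)
    (hS : ∀ n ∈ S, (1 ≤ n ∧ n ≤ N) ∧ 1 ≤ (n : ℤ) + ℓ ∧ prt (fun p => p ≤ W) n = a ∧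
      prt (fun p => p ≤ W) ((n : ℤ) + ℓ).toNat = a') :
    S ⊆ (Om a a' ℓ N).filter (fun n => ∀ p ∈ (PR Z).filter
      (fun p => ¬ p ∣ a * a' * ℓ.natAbs), ¬ (p ∣ n ∨ (p : ℤ) ∣ (n : ℤ) + ℓ)) := by
  intro n hn
  obtain ⟨hN, h1, h2, h3⟩ := hS n hn
  set n' := ((n : ℤ) + ℓ).toNat with hn'
  have hc : (n' : ℤ) = n + ℓ := Int.toNat_of_nonneg (by omega)
  have hn1 : 1 ≤ n' := by omega
  have e1 := prt_mul (fun p => p ≤ W) n hN.1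
  have e2 := prt_mul (fun p => p ≤ W) n' hn1
  rw [h2] at e1
  rw [h3] at e2
  rw [Finset.mem_filter, mem_Om]
  refine ⟨⟨hN, ⟨_, e1.symm⟩, ?_⟩, ?_⟩
  · rw [← hc]; exact_mod_cast Dvd.intro _ e2
  · intro p hp
    rw [Finset.mem_filter, mem_PR] at hp
    have hpW : p ≤ W := hp.1.1.trans hZW
    have hpp := hp.1.2
    rintro (h | h)
    · rw [← e1, hpp.dvd_mul] at h
      rcases h with h | h
      · exact hp.2 ((h.mul_right a').mul_right _)
      · exact (prt_prime _ n p hpp h).1 hpW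
    · rw [← hc] at h
      have h : p ∣ n' := by exact_mod_cast h
      rw [← e2, hpp.dvd_mul] at h
      rcases h with h | h
      · exact hp.2 ((h.mul_left a).mul_right _)
      · exact (prt_prime _ n' p hpp h).1 hpW

lemma main_range (m : ℕ) (hm : 1 ≤ m) (η e : ℝ) (h0 : 0 < η) (h1 : η < 1) (he0 : 0 < e) (he1 : e ≤ 1)
    (hem : 2 * e * Real.log m ≤ η) : ∃ C : ℝ, 1 ≤ C ∧ ∀ᶠ x : ℝ in Filter.atTop, ∀ f₁ f₂ : ℕ → ℝ, Coef m f₁ → Coef m f₂ →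
    ∀ ℓ : ℤ, ℓ ≠ 0 → (|ℓ| : ℝ) ≤ x → ∀ W : ℕ, W = ⌊x ^ (1 / (e * Real.log (Real.log x)))⌋₊ →
    ∑ n ∈ (Finset.Icc 1 ⌊x⌋₊).filter (fun n : ℕ => 1 ≤ (n : ℤ) + ℓ ∧
      ¬ (x ^ (1 / 8 : ℝ) < (prt (fun p => p ≤ W) n : ℕ) ∨ x ^ (1 / 8 : ℝ) < (prt (fun p => p ≤ W) ((n : ℤ) + ℓ).toNat : ℕ))),
      f₁ n * f₂ ((n : ℤ) + ℓ).toNat ≤ C * x * (Real.log x) ^ (-2 + 6 * η) *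
        ((∏ p ∈ PR W, (1 + f₁ p / p)) * (∏ p ∈ PR W, (1 + f₂ p / p))) := by
  obtain ⟨C1, hC1, ev⟩ := count_pair η h0 h1
  obtain ⟨C2, hC2, hS⟩ := S_bound m
  set D : ℝ := 2 * m + m ^ 2 with hD
  have hm0 : (1 : ℝ) ≤ m := by exact_mod_cast hm
  have hD0 : 0 < D := by positivity
  refine ⟨C1 * C2 * Real.exp (18 * D), ?_, ?_⟩
  · have : (1 : ℝ) ≤ Real.exp (18 * D) := Real.one_le_exp (by positivity)
    exact one_le_mul_of_one_le_of_one_le (one_le_mul_of_one_le_of_one_le hC1 hC2) this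
  filter_upwards [ev, ev_LLL (η / (8 * D)) (by positivity), ev_pow 1 η (by norm_num) h0,
    Real.tendsto_log_atTop.eventually_ge_atTop 3, Filter.eventually_ge_atTop 2] with x ev e1 e2 e3 e4 f₁ f₂ hf₁ hf₂ ℓ hℓ hℓx W hW
  have ev := ev ℓ hℓ hℓx
  set L := Real.log x with hL
  have hx0 : 0 < x := by linarith
  have hL0 : 0 < L := by linarith
  have hLL : 1 ≤ Real.log L := by
    rw [Real.le_log_iff_exp_le hL0]
    exact Real.exp_one_lt_three.le.trans e3
  have hLL0 : 0 < Real.log L := by linarith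
  set w := x ^ (1 / (e * Real.log L)) with hw
  have hlw : Real.log w = L / (e * Real.log L) := by rw [hw, Real.log_rpow hx0, ← hL]; ring
  have hw0 : 0 < w := Real.rpow_pos_of_pos hx0 _
  have hlw0 : 0 < Real.log w := by rw [hlw]; positivity
  have hw1 : 1 < w := (Real.log_pos_iff hw0.le).1 hlw0
  have hwW : w < W + 1 := by rw [hW]; exact Nat.lt_floor_add_one w
  set Z := ⌊Real.exp (L ^ (1 - η))⌋₊ with hZ
  have hZW : Z ≤ W := by
    rw [hZ, hW]
    apply Nat.floor_mono
    rw [← Real.le_log_iff_exp_le hw0, hlw, le_div_iff₀ (by positivity)]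
    calc L ^ (1 - η) * (e * Real.log L) ≤ L ^ (1 - η) * (1 * (1 * L ^ η)) := by gcongr
      _ = L := by rw [one_mul, one_mul, ← Real.rpow_add hL0]; norm_num
  have hrough : ∀ n : ℕ, 1 ≤ n → (n : ℝ) ≤ 2 * x → (tauM m (prt (fun p => ¬ p ≤ W) n) : ℝ) ≤ L ^ η := by
    intro n hn hnx
    refine (rough_bound m hm W n w hwW hw1 hn).trans ?_
    rw [Real.rpow_def_of_pos hL0]
    apply Real.exp_le_exp.2
    have n0 : (0 : ℝ) < n := by exact_mod_cast hn
    have a1 : Real.log n ≤ 2 * L := by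
      refine (Real.log_le_log n0 hnx).trans ?_
      rw [Real.log_mul (by norm_num) (by linarith)]
      have : Real.log 2 ≤ L := Real.log_le_log (by norm_num) e4
      linarith
    have a2 : Real.log n / Real.log w ≤ 2 * e * Real.log L := by
      rw [div_le_iff₀ hlw0, hlw]
      refine a1.trans (le_of_eq ?_)
      field_simp
    have a3 : 0 ≤ Real.log m := Real.log_natCast_nonneg m
    calc Real.log m * (Real.log n / Real.log w) ≤ Real.log m * (2 * e * Real.log L) := by gcongr
      _ = Real.log L * (2 * e * Real.log m) := by ring
      _ ≤ Real.log L * η := by gcongr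
  set Y := ⌊x ^ (1 / 8 : ℝ)⌋₊ with hY
  set S := (Finset.Icc 1 ⌊x⌋₊).filter (fun n : ℕ => 1 ≤ (n : ℤ) + ℓ ∧
      ¬ (x ^ (1 / 8 : ℝ) < (prt (fun p => p ≤ W) n : ℕ) ∨ x ^ (1 / 8 : ℝ) < (prt (fun p => p ≤ W) ((n : ℤ) + ℓ).toNat : ℕ))) with hSdef
  set φ : ℕ → ℕ × ℕ := fun n => (prt (fun p => p ≤ W) n, prt (fun p => p ≤ W) ((n : ℤ) + ℓ).toNat) with hφ
  have hx8 : 0 ≤ x ^ (1 / 8 : ℝ) := Real.rpow_nonneg hx0.le _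
  have hfac : ∀ n ∈ S, (1 ≤ n ∧ n ≤ ⌊x⌋₊) ∧ 1 ≤ (n : ℤ) + ℓ ∧ ((φ n).1 : ℝ) ≤ x ^ (1 / 8 : ℝ) ∧ ((φ n).2 : ℝ) ≤ x ^ (1 / 8 : ℝ) ∧
      (n : ℝ) ≤ 2 * x ∧ (((n : ℤ) + ℓ).toNat : ℝ) ≤ 2 * x ∧ 1 ≤ ((n : ℤ) + ℓ).toNat := by
    intro n hn
    rw [hSdef, Finset.mem_filter, Finset.mem_Icc, not_or, not_lt, not_lt] at hn
    have a1 : ((((n : ℤ) + ℓ).toNat : ℕ) : ℤ) = n + ℓ := Int.toNat_of_nonneg (by omega)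
    have a2 : ((((n : ℤ) + ℓ).toNat : ℕ) : ℝ) = n + ℓ := by exact_mod_cast a1
    have a3 : (n : ℝ) ≤ x := (Nat.le_floor_iff (by linarith)).1 hn.1.2
    have a4 := le_abs_self (ℓ : ℝ)
    exact ⟨hn.1, hn.2.1, hn.2.2.1, hn.2.2.2, by linarith, by rw [a2]; linarith, by omega⟩
  set T := (SM W Y ×ˢ SM W Y).filter (fun q => Nat.gcd q.1 q.2 ∣ ℓ.natAbs) with hT
  have hprtSM : ∀ n : ℕ, 1 ≤ n → ((prt (fun p => p ≤ W) n : ℕ) : ℝ) ≤ x ^ (1 / 8 : ℝ) → prt (fun p => p ≤ W) n ∈ SM W Y := by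
    intro n hn h
    rw [mem_SM]
    exact ⟨⟨prt_pos _ _, Nat.le_floor h⟩, fun p hp hpa => (prt_prime _ n p hp hpa).1⟩
  have hmaps : ∀ n ∈ S, φ n ∈ T := by
    intro n hn
    obtain ⟨b1, b2, b3, b4, b5, b6, b7⟩ := hfac n hn
    rw [hT, Finset.mem_filter, Finset.mem_product]
    refine ⟨⟨hprtSM n b1.1 b3, hprtSM _ b7 b4⟩, ?_⟩
    rw [← Int.natCast_dvd]
    have c1 : ((Nat.gcd (φ n).1 (φ n).2 : ℕ) : ℤ) ∣ (n : ℤ) := by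
      have : Nat.gcd (φ n).1 (φ n).2 ∣ n := (Nat.gcd_dvd_left _ _).trans (Dvd.intro _ (prt_mul (fun p => p ≤ W) n b1.1))
      exact_mod_cast this
    have c2 : ((Nat.gcd (φ n).1 (φ n).2 : ℕ) : ℤ) ∣ (n : ℤ) + ℓ := by
      have : Nat.gcd (φ n).1 (φ n).2 ∣ ((n : ℤ) + ℓ).toNat := (Nat.gcd_dvd_right _ _).trans (Dvd.intro _ (prt_mul (fun p => p ≤ W) _ b7))
      have a1 : ((((n : ℤ) + ℓ).toNat : ℕ) : ℤ) = n + ℓ := Int.toNat_of_nonneg (by omega)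
      rw [← a1]
      exact_mod_cast this
    exact (dvd_add_right c1).1 c2
  set P1 := ∏ p ∈ PR W, (1 + f₁ p / p) with hP1
  set P2 := ∏ p ∈ PR W, (1 + f₂ p / p) with hP2
  have hP10 : 0 ≤ P1 := Finset.prod_nonneg fun p _ => add_nonneg zero_le_one (div_nonneg (hf₁.nonneg p) (by positivity))
  have hP20 : 0 ≤ P2 := Finset.prod_nonneg fun p _ => add_nonneg zero_le_one (div_nonneg (hf₂.nonneg p) (by positivity))
  have hLη0 : 0 < L ^ η := Real.rpow_pos_of_pos hL0 _
  have hLη1 : 0 < L ^ (-2 + 3 * η) := Real.rpow_pos_of_pos hL0 _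
  have hl1 : 1 ≤ ℓ.natAbs := Int.natAbs_pos.2 hℓ
  have hE : Real.exp ((2 * m + m ^ 2) * ∑ p ∈ ℓ.natAbs.primeFactors, (1 : ℝ) / p) ≤ Real.exp (18 * D) * L ^ η := by
    have c3' : Real.log ℓ.natAbs ≤ 4 * L := by
      have hl0 : (0 : ℝ) < ℓ.natAbs := by exact_mod_cast hl1
      have : Real.log ℓ.natAbs ≤ L := by
        apply Real.log_le_log hl0
        rw [Nat.cast_natAbs]; push_cast; exact hℓx
      linarith
    have := prime_div_sum ℓ.natAbs hl1 L (by linarith) c3'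
    rw [Real.rpow_def_of_pos hL0, ← Real.exp_add, ← hD]
    apply Real.exp_le_exp.2
    calc D * ∑ p ∈ ℓ.natAbs.primeFactors, (1 : ℝ) / p ≤ D * (8 * Real.log (Real.log L) + 18) := by gcongr
      _ ≤ D * (8 * (η / (8 * D) * Real.log L) + 18) := by gcongr
      _ = _ := by field_simp; ring
  calc ∑ n ∈ S, f₁ n * f₂ ((n : ℤ) + ℓ).toNat
      ≤ ∑ n ∈ S, (L ^ η * L ^ η) * (f₁ (φ n).1 * f₂ (φ n).2) := by
        refine Finset.sum_le_sum fun n hn => ?_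
        obtain ⟨b1, b2, b3, b4, b5, b6, b7⟩ := hfac n hn
        have g1 := coef_le_smooth m f₁ hf₁ W n b1.1 _ (hrough n b1.1 b5)
        have g2 := coef_le_smooth m f₂ hf₂ W _ b7 _ (hrough _ b7 b6)
        calc _ ≤ (f₁ (φ n).1 * L ^ η) * (f₂ (φ n).2 * L ^ η) := by
              apply mul_le_mul g1 g2 (hf₂.nonneg _)
              exact mul_nonneg (hf₁.nonneg _) hLη0.le
          _ = _ := by ring
    _ = (L ^ η * L ^ η) * ∑ n ∈ S, (f₁ (φ n).1 * f₂ (φ n).2) := (Finset.mul_sum _ _ _).symm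
    _ = (L ^ η * L ^ η) * ∑ q ∈ T, ∑ n ∈ S.filter (fun n => φ n = q), (f₁ (φ n).1 * f₂ (φ n).2) := by
        rw [Finset.sum_fiberwise_of_maps_to hmaps]
    _ ≤ (L ^ η * L ^ η) * ∑ q ∈ T, (C1 * x * L ^ (-2 + 3 * η)) * (f₁ q.1 * f₂ q.2 / (Nat.lcm q.1 q.2 : ℕ)) := by
        apply mul_le_mul_of_nonneg_left _ (by positivity)
        refine Finset.sum_le_sum fun q hq => ?_
        have hq' := hq
        rw [hT, Finset.mem_filter, Finset.mem_product, mem_SM, mem_SM] at hq'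
        have k1 : ∑ n ∈ S.filter (fun n => φ n = q), (f₁ (φ n).1 * f₂ (φ n).2) =
            ((S.filter (fun n => φ n = q)).card : ℝ) * (f₁ q.1 * f₂ q.2) := by
          rw [← nsmul_eq_mul]
          apply Finset.sum_eq_card_nsmul
          intro n hn
          rw [(Finset.mem_filter.1 hn).2]
        rw [k1]
        have k2 : S.filter (fun n => φ n = q) ⊆ _ := fiber_bound ℓ ⌊x⌋₊ W Z q.1 q.2 hZW _ (by
          intro n hn
          rw [Finset.mem_filter] at hn
          obtain ⟨b1, b2, b3, b4, b5, b6, b7⟩ := hfac n hn.1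
          exact ⟨b1, b2, congrArg Prod.fst hn.2, congrArg Prod.snd hn.2⟩)
        have k3 : ((S.filter (fun n => φ n = q)).card : ℝ) ≤ C1 * x * L ^ (-2 + 3 * η) * (1 / (Nat.lcm q.1 q.2 : ℕ)) := by
          refine le_trans (by exact_mod_cast Finset.card_le_card k2) (ev q.1 q.2 hq'.1.1.1.1 hq'.1.2.1.1 ?_ ?_ ?_)
          · exact (Nat.le_floor_iff hx8).1 hq'.1.1.1.2
          · exact (Nat.le_floor_iff hx8).1 hq'.1.2.1.2
          · exact Int.natCast_dvd.2 hq'.2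
        calc _ ≤ (C1 * x * L ^ (-2 + 3 * η) * (1 / (Nat.lcm q.1 q.2 : ℕ))) * (f₁ q.1 * f₂ q.2) :=
              mul_le_mul_of_nonneg_right k3 (mul_nonneg (hf₁.nonneg _) (hf₂.nonneg _))
          _ = _ := by ring
    _ = (L ^ η * L ^ η) * ((C1 * x * L ^ (-2 + 3 * η)) * ∑ q ∈ T, (f₁ q.1 * f₂ q.2 / (Nat.lcm q.1 q.2 : ℕ))) := by
        congr 1; exact (Finset.mul_sum _ _ _).symm
    _ ≤ (L ^ η * L ^ η) * ((C1 * x * L ^ (-2 + 3 * η)) * (C2 * P1 * P2 * (Real.exp (18 * D) * L ^ η))) := by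
        have k4 := hS f₁ f₂ hf₁ hf₂ W Y ℓ.natAbs hl1
        have k5 : ∑ q ∈ T, (f₁ q.1 * f₂ q.2 / (Nat.lcm q.1 q.2 : ℕ)) ≤ C2 * P1 * P2 * (Real.exp (18 * D) * L ^ η) := by
          refine k4.trans ?_
          exact mul_le_mul_of_nonneg_left hE (by positivity)
        gcongr
    _ = (C1 * C2 * Real.exp (18 * D)) * x * (L ^ η * L ^ η * L ^ (-2 + 3 * η) * L ^ η) * (P1 * P2) := by ring
    _ = _ := by
        rw [← Real.rpow_add hL0, ← Real.rpow_add hL0, ← Real.rpow_add hL0]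
        congr 3; ring

/-- The bound of §4.3: the contribution `𝒮_y(x)` of those `n ≤ x` for which the `z`-smooth
parts of both `n` and `n + ℓ` are at most `y = x^ε` is
`≪ x (log x)^{ε-2} Π_{p ≤ z} (1 + |λ₁(p)|/p)(1 + |λ₂(p)|/p) τ(|ℓ|)`, where `z = x^{1/s}`,
`s = ε log log x`, uniformly over multiplicative `λ₁, λ₂` bounded by `τ_m` and nonzero
shifts `|ℓ| ≤ x`, for `x` sufficiently large in terms of `m` and `ε`. -/
theorem stmt2 (m : ℕ) (hm : 1 ≤ m) (ε : ℝ) (hε0 : 0 < ε) (hε1 : ε < 1) :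
    ∃ C > (0 : ℝ), ∃ x₀ : ℝ, ∀ lam₁ lam₂ : ℕ → ℂ,
      lam₁ 1 = 1 → lam₂ 1 = 1 →
      (∀ a b : ℕ, 1 ≤ a → 1 ≤ b → Nat.Coprime a b → lam₁ (a * b) = lam₁ a * lam₁ b) →
      (∀ a b : ℕ, 1 ≤ a → 1 ≤ b → Nat.Coprime a b → lam₂ (a * b) = lam₂ a * lam₂ b) →
      (∀ n : ℕ, 1 ≤ n → ‖lam₁ n‖ ≤ tauM m n) →
      (∀ n : ℕ, 1 ≤ n → ‖lam₂ n‖ ≤ tauM m n) →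
      ∀ x : ℝ, x₀ ≤ x → ∀ ℓ : ℤ, ℓ ≠ 0 → (|ℓ| : ℝ) ≤ x →
      (∑ n ∈ (Finset.Icc 1 ⌊x⌋₊ : Finset ℕ).filter fun n : ℕ =>
            1 ≤ (n : ℤ) + ℓ ∧
            (smoothPart (x ^ (1 / (ε * Real.log (Real.log x)))) n : ℝ) ≤ x ^ ε ∧
            (smoothPart (x ^ (1 / (ε * Real.log (Real.log x))))
                ((n : ℤ) + ℓ).toNat : ℝ) ≤ x ^ ε,
          ‖lam₁ n‖ * ‖lam₂ ((n : ℤ) + ℓ).toNat‖)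
        ≤ C * x * Real.log x ^ (ε - 2) *
          (∏ p ∈ (Finset.Icc 2 ⌊x ^ (1 / (ε * Real.log (Real.log x)))⌋₊).filter Nat.Prime,
            (1 + ‖lam₁ p‖ / p) * (1 + ‖lam₂ p‖ / p)) *
          (ℓ.natAbs.divisors.card : ℝ) := by
  set η := ε / 8 with hη
  have hη0 : 0 < η := by positivity
  have hη1 : η < 1 := by rw [hη]; linarith
  have hlm : 0 ≤ Real.log m := Real.log_natCast_nonneg m
  set e := min ε (η / (2 * (Real.log m + 1))) with he
  have he0 : 0 < e := lt_min hε0 (by positivity)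
  have heε : e ≤ ε := min_le_left _ _
  have hem : 2 * e * Real.log m ≤ η := by
    have h1 : e ≤ η / (2 * (Real.log m + 1)) := min_le_right _ _
    rw [le_div_iff₀ (by positivity)] at h1
    nlinarith
  obtain ⟨C1, hC1, ev1⟩ := main_range m hm η e hη0 hη1 he0 (by linarith) hem
  obtain ⟨C2, hC2, ev2⟩ := exc m e he0
  set G := Real.exp (m * (4 * (ε / e))) with hG
  have hG0 : 0 < G := Real.exp_pos _
  obtain ⟨x₀, hx₀⟩ := Filter.eventually_atTop.1 (ev1.and (ev2.and ((ev_LL (1 / 2) (by norm_num)).and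
    ((Real.tendsto_log_atTop.eventually_ge_atTop 3).and (Filter.eventually_ge_atTop (2 : ℝ))))))
  refine ⟨C1 * (G * G) + C2, by positivity, x₀, ?_⟩
  intro lam₁ lam₂ h11 h12 hm1 hm2 hb1 hb2 x hx ℓ hℓ hℓx
  obtain ⟨ev1, ev2, e1, e2, e3⟩ := hx₀ x hx
  have hf₁ : Coef m (fun n => ‖lam₁ n‖) := ⟨fun n => norm_nonneg _, by simp [h11],
    fun a b ha hb hab => by rw [hm1 a b ha hb hab, norm_mul], hb1⟩
  have hf₂ : Coef m (fun n => ‖lam₂ n‖) := ⟨fun n => norm_nonneg _, by simp [h12],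
    fun a b ha hb hab => by rw [hm2 a b ha hb hab, norm_mul], hb2⟩
  set L := Real.log x with hL
  have hx0 : 0 < x := by linarith
  have hL0 : 0 < L := by linarith
  have hLL : 1 ≤ Real.log L := by
    rw [Real.le_log_iff_exp_le hL0]
    exact Real.exp_one_lt_three.le.trans e2
  have hLL0 : 0 < Real.log L := by linarith
  set W := ⌊x ^ (1 / (e * Real.log L))⌋₊ with hW
  set V := ⌊x ^ (1 / (ε * Real.log L))⌋₊ with hV
  set w := x ^ (1 / (e * Real.log L)) with hw
  set z := x ^ (1 / (ε * Real.log L)) with hz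
  have hlw : Real.log w = L / (e * Real.log L) := by rw [hw, Real.log_rpow hx0, ← hL]; ring
  have hlz : Real.log z = L / (ε * Real.log L) := by rw [hz, Real.log_rpow hx0, ← hL]; ring
  have hw0 : 0 < w := Real.rpow_pos_of_pos hx0 _
  have hz0 : 0 < z := Real.rpow_pos_of_pos hx0 _
  have hzw : z ≤ w := by
    rw [hz, hw]
    apply Real.rpow_le_rpow_of_exponent_le (by linarith)
    gcongr
  have hlz2 : 2 ≤ Real.log z := by
    rw [hlz, le_div_iff₀ (by positivity)]
    nlinarith
  have hz4 : 4 ≤ z := by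
    have h1 : Real.log 4 ≤ Real.log z := by
      have : Real.log 4 = 2 * Real.log 2 := by
        rw [show (4 : ℝ) = 2 ^ 2 by norm_num, Real.log_pow]; norm_num
      linarith [Real.log_two_lt_d9]
    exact (Real.log_le_log_iff (by norm_num) hz0).1 h1
  have hV2 : 2 ≤ V := Nat.le_floor (by push_cast; linarith)
  have hVW : V ≤ W := Nat.floor_mono hzw
  have hW2 : (0 : ℝ) < W := by
    have : 0 < W := by omega
    exact_mod_cast this
  have hlogW : Real.log W ≤ L / (e * Real.log L) := by
    rw [← hlw]; exact Real.log_le_log hW2 (Nat.floor_le hw0.le)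
  have hlogV : L / (ε * Real.log L) / 2 ≤ Real.log V := by
    have h1 : z / 2 ≤ V := by
      have := Nat.lt_floor_add_one z
      rw [← hV] at this
      linarith
    have h2 : Real.log (z / 2) ≤ Real.log V := Real.log_le_log (by positivity) h1
    rw [Real.log_div hz0.ne' (by norm_num)] at h2
    rw [← hlz]
    linarith [Real.log_two_lt_d9]
  have hratio : 2 * Real.log W / Real.log V ≤ 4 * (ε / e) := by
    have hV0 : 0 < Real.log V := lt_of_lt_of_le (by positivity) hlogV
    rw [div_le_iff₀ hV0]
    calc 2 * Real.log W ≤ 2 * (L / (e * Real.log L)) := by gcongr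
      _ = 4 * (ε / e) * (L / (ε * Real.log L) / 2) := by field_simp; ring
      _ ≤ _ := by gcongr
  have hGm : Real.exp (m * (2 * Real.log W / Real.log V)) ≤ G := by
    apply Real.exp_le_exp.2
    gcongr
  have ev1 := ev1 _ _ hf₁ hf₂ ℓ hℓ hℓx W rfl
  have ev2 := ev2 W hlogW ℓ hℓx
  have pc1 := prod_change m _ hf₁ V W hV2 hVW
  have pc2 := prod_change m _ hf₂ V W hV2 hVW
  set Q1 := ∏ p ∈ PR V, (1 + ‖lam₁ p‖ / p) with hQ1
  set Q2 := ∏ p ∈ PR V, (1 + ‖lam₂ p‖ / p) with hQ2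
  have hQ11 : 1 ≤ Q1 := Finset.one_le_prod fun p _ => by
    have : 0 ≤ ‖lam₁ p‖ / (p : ℝ) := by positivity
    linarith
  have hQ21 : 1 ≤ Q2 := Finset.one_le_prod fun p _ => by
    have : 0 ≤ ‖lam₂ p‖ / (p : ℝ) := by positivity
    linarith
  have pc1 := pc1.trans (mul_le_mul_of_nonneg_left hGm (by linarith : 0 ≤ Q1))
  have pc2 := pc2.trans (mul_le_mul_of_nonneg_left hGm (by linarith : 0 ≤ Q2))
  have hprod : (∏ p ∈ (Finset.Icc 2 V).filter Nat.Prime, (1 + ‖lam₁ p‖ / p) * (1 + ‖lam₂ p‖ / p)) = Q1 * Q2 := by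
    rw [hQ1, hQ2, ← Finset.prod_mul_distrib]
  have hτ : (1 : ℝ) ≤ (ℓ.natAbs.divisors.card : ℝ) := by
    have : 0 < ℓ.natAbs.divisors.card := Finset.card_pos.2 ⟨1, Nat.mem_divisors.2 ⟨one_dvd _, by simpa using hℓ⟩⟩
    exact_mod_cast this
  set ex : ℕ → Prop := fun n => x ^ (1 / 8 : ℝ) < (prt (fun p => p ≤ W) n : ℕ) ∨
    x ^ (1 / 8 : ℝ) < (prt (fun p => p ≤ W) ((n : ℤ) + ℓ).toNat : ℕ) with hex
  have hD1 : L ^ (-2 + 6 * η) ≤ L ^ (ε - 2) := Real.rpow_le_rpow_of_exponent_le (by linarith) (by rw [hη]; linarith)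
  have hD2 : L ^ (-2 : ℝ) ≤ L ^ (ε - 2) := Real.rpow_le_rpow_of_exponent_le (by linarith) (by linarith)
  have hD0 : 0 < L ^ (ε - 2) := Real.rpow_pos_of_pos hL0 _
  have hQQ : 1 ≤ Q1 * Q2 := one_le_mul_of_one_le_of_one_le hQ11 hQ21
  have hmain : ∑ n ∈ (Finset.Icc 1 ⌊x⌋₊).filter (fun n : ℕ => 1 ≤ (n : ℤ) + ℓ),
      ‖lam₁ n‖ * ‖lam₂ ((n : ℤ) + ℓ).toNat‖ ≤ (C1 * (G * G) + C2) * x * L ^ (ε - 2) * (Q1 * Q2) := by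
    rw [← Finset.sum_filter_add_sum_filter_not _ ex, Finset.filter_filter, Finset.filter_filter]
    have t1 : ∑ n ∈ (Finset.Icc 1 ⌊x⌋₊).filter (fun n : ℕ => 1 ≤ (n : ℤ) + ℓ ∧ ex n),
        ‖lam₁ n‖ * ‖lam₂ ((n : ℤ) + ℓ).toNat‖ ≤ C2 * x * L ^ (ε - 2) * (Q1 * Q2) := by
      calc _ ≤ ∑ n ∈ (Finset.Icc 1 ⌊x⌋₊).filter (fun n : ℕ => 1 ≤ (n : ℤ) + ℓ ∧ ex n),
            (tauM m n : ℝ) * tauM m ((n : ℤ) + ℓ).toNat := by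
            refine Finset.sum_le_sum fun n hn => ?_
            rw [Finset.mem_filter, Finset.mem_Icc] at hn
            exact mul_le_mul (hb1 n hn.1.1) (hb2 _ (by omega)) (norm_nonneg _) (by positivity)
        _ ≤ C2 * x * L ^ (-2 : ℝ) := ev2
        _ ≤ C2 * x * L ^ (ε - 2) := by gcongr
        _ ≤ _ := le_mul_of_one_le_right (by positivity) hQQ
    have t2 : ∑ n ∈ (Finset.Icc 1 ⌊x⌋₊).filter (fun n : ℕ => 1 ≤ (n : ℤ) + ℓ ∧ ¬ ex n),
        ‖lam₁ n‖ * ‖lam₂ ((n : ℤ) + ℓ).toNat‖ ≤ C1 * (G * G) * x * L ^ (ε - 2) * (Q1 * Q2) := by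
      calc _ ≤ C1 * x * L ^ (-2 + 6 * η) *
            ((∏ p ∈ PR W, (1 + ‖lam₁ p‖ / p)) * (∏ p ∈ PR W, (1 + ‖lam₂ p‖ / p))) := ev1
        _ ≤ C1 * x * L ^ (ε - 2) * ((Q1 * G) * (Q2 * G)) := by
            have n2 : 0 ≤ ∏ p ∈ PR W, (1 + ‖lam₂ p‖ / p) := Finset.prod_nonneg fun p _ => by positivity
            gcongr
        _ = _ := by ring
    calc _ ≤ _ := add_le_add t1 t2
      _ = _ := by ring
  rw [hprod]
  refine le_trans (Finset.sum_le_sum_of_subset_of_nonneg ?_ fun n _ _ => by positivity)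
    (hmain.trans (le_mul_of_one_le_right (by positivity) hτ))
  intro n hn
  rw [Finset.mem_filter] at hn ⊢
  exact ⟨hn.1, hn.2.1⟩
end

section
/- Let g : ℝ → ℂ be infinitely differentiable, compactly supported in (0, ∞), and let G(s) := ∫₀^∞ g(y) y^{s-1} dy be its Mellin transform. Fix ε > 0. Then there is a constant C > 0 (depending only on g and ε) such that for every integer k ≥ 3 and every real X > 0: | (1/(2π)) ∫_{-∞}^{∞} G(-(1 + ε + it)) · X^{1 + ε + it} · Γ(1 + ε + it + k - 1)/Γ(k - 1) dt - g(X (k - 1)) | ≤ C · k^ε · X^{1 + ε}. -/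
lemma supp_bounds (g : ℝ → ℂ) (hsupp : HasCompactSupport g)
    (hpos : tsupport g ⊆ Set.Ioi 0) : ∃ c d : ℝ, 0 < c ∧ c < d ∧ tsupport g ⊆ Set.Icc c d := by
  rcases (tsupport g).eq_empty_or_nonempty with h | h
  · exact ⟨1, 2, by norm_num, by norm_num, by simp [h]⟩
  · obtain ⟨c, hc⟩ := hsupp.isCompact.exists_isLeast h
    obtain ⟨d, hd⟩ := hsupp.isCompact.exists_isGreatest h
    exact ⟨c, d + 1, hpos hc.1, by have := hc.2 hd.1; linarith,
      fun x hx => ⟨hc.2 hx, by have := hd.2 hx; linarith⟩⟩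

open MeasureTheory FourierTransform in
lemma mellin_vert (g : ℝ → ℂ) (hg : ContDiff ℝ (⊤ : ℕ∞) g) (hsupp : HasCompactSupport g)
    (hpos : tsupport g ⊆ Set.Ioi 0) (σ : ℝ) : Complex.VerticalIntegrable (mellin g) σ := by
  obtain ⟨c, d, hc, hcd, hs⟩ := supp_bounds g hsupp hpos
  have h1 : ContDiff ℝ (⊤ : ℕ∞) (fun u : ℝ => Real.exp (-σ * u) • g (Real.exp (-u))) := by
    apply ContDiff.fun_smul
    · exact Real.contDiff_exp.comp (contDiff_const.mul contDiff_id)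
    · exact hg.comp (Real.contDiff_exp.comp contDiff_neg)
  have h2 : HasCompactSupport (fun u : ℝ => Real.exp (-σ * u) • g (Real.exp (-u))) := by
    refine HasCompactSupport.intro (isCompact_Icc (a := -Real.log d) (b := -Real.log c)) ?_
    intro u hu
    by_cases h : g (Real.exp (-u)) = 0
    · simp [h]
    · exfalso
      have := hs (subset_tsupport g h)
      apply hu
      constructor
      · have := Real.log_le_log (Real.exp_pos _) this.2
        rw [Real.log_exp] at this; linarith
      · have := Real.log_le_log hc this.1
        rw [Real.log_exp] at this; linarith
  have h3 : Integrable (𝓕 (fun u : ℝ => Real.exp (-σ * u) • g (Real.exp (-u)))) :=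
    (𝓕 (h2.toSchwartzMap h1)).integrable
  have h4 := h3.comp_div (R := 2 * Real.pi) (by positivity)
  unfold Complex.VerticalIntegrable
  refine h4.congr (Filter.Eventually.of_forall fun y => ?_)
  simp [mellin_eq_fourier]

open MeasureTheory in
lemma mellin_conv (g : ℝ → ℂ) (hg : ContDiff ℝ (⊤ : ℕ∞) g) (hsupp : HasCompactSupport g)
    (hpos : tsupport g ⊆ Set.Ioi 0) (s : ℂ) : MellinConvergent g s := by
  obtain ⟨c, d, hc, hcd, hs⟩ := supp_bounds g hsupp hpos
  unfold MellinConvergent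
  have : IntegrableOn (fun t : ℝ => (t : ℂ) ^ (s - 1) • g t) (Set.Icc c d) := by
    apply ContinuousOn.integrableOn_Icc
    apply ContinuousOn.fun_smul _ hg.continuous.continuousOn
    intro t ht
    apply ContinuousAt.continuousWithinAt
    have : ContinuousAt (fun z : ℂ => z ^ (s-1)) (t : ℂ) :=
      continuousAt_cpow_const (by left; simp; linarith [ht.1])
    exact this.comp (f := fun t : ℝ => (t : ℂ)) Complex.continuous_ofReal.continuousAt
  refine this.of_forall_sdiff_eq_zero measurableSet_Ioi ?_
  intro x hx
  have : g x = 0 := by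
    by_contra h
    exact hx.2 (hs (subset_tsupport g h))
  simp [this]

open MeasureTheory Complex in
lemma inv_formula (g : ℝ → ℂ) (hg : ContDiff ℝ (⊤ : ℕ∞) g) (hsupp : HasCompactSupport g)
    (hpos : tsupport g ⊆ Set.Ioi 0) (ε : ℝ) (x : ℝ) (hx : 0 < x) :
    ((1 / (2 * Real.pi) : ℝ) : ℂ) * (∫ t : ℝ, mellin g (-(1 + (ε : ℂ) + I * t)) *
      (x : ℂ) ^ (1 + (ε : ℂ) + I * t)) = g x := by
  rw [← mellinInv_mellin_eq (-(1 + ε)) g hx (mellin_conv g hg hsupp hpos _)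
    (mellin_vert g hg hsupp hpos _) hg.continuous.continuousAt]
  unfold mellinInv
  rw [← integral_neg_eq_self, real_smul]
  congr 1
  apply integral_congr_ae
  refine Filter.Eventually.of_forall fun t => ?_
  simp only [smul_eq_mul]
  rw [mul_comm]
  congr 2 <;> (push_cast; ring)

lemma mellin_int (g : ℝ → ℂ) (hg : ContDiff ℝ (⊤ : ℕ∞) g) (hsupp : HasCompactSupport g)
    (hpos : tsupport g ⊆ Set.Ioi 0) (ε : ℝ) :
    MeasureTheory.Integrable (fun t : ℝ => mellin g (-(1 + (ε : ℂ) + Complex.I * t))) := by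
  have := (mellin_vert g hg hsupp hpos (-(1+ε))).comp_neg
  refine this.congr (Filter.Eventually.of_forall fun t => ?_)
  show mellin g _ = mellin g _
  congr 1; push_cast; ring

open MeasureTheory Complex in
lemma fubini_formula (g : ℝ → ℂ) (hg : ContDiff ℝ (⊤ : ℕ∞) g) (hsupp : HasCompactSupport g)
    (hpos : tsupport g ⊆ Set.Ioi 0) (ε : ℝ) (hε : 0 < ε) (j : ℕ) (X : ℝ) (hX : 0 < X) :
    ((1 / (2 * Real.pi) : ℝ) : ℂ) * (∫ t : ℝ, mellin g (-(1 + (ε : ℂ) + I * t)) *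
      (X : ℂ) ^ (1 + (ε : ℂ) + I * t) * Complex.Gamma ((1 + (ε : ℂ) + I * t) + (j + 1)))
    = ∫ u in Set.Ioi (0:ℝ), ((Real.exp (-u) * u ^ j : ℝ) : ℂ) * g (X * u) := by
  have e1 : ∀ t : ℝ, mellin g (-(1 + (ε : ℂ) + I * t)) *
      (X : ℂ) ^ (1 + (ε : ℂ) + I * t) * Complex.Gamma ((1 + (ε : ℂ) + I * t) + (j + 1)) =
      ∫ u in Set.Ioi (0:ℝ), (mellin g (-(1 + (ε : ℂ) + I * t)) *
      (X * u : ℝ) ^ (1 + (ε : ℂ) + I * t)) * ((Real.exp (-u) * u ^ j : ℝ) : ℂ) := by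
    intro t
    rw [Complex.Gamma_eq_integral (by simp; positivity), Complex.GammaIntegral,
      ← integral_const_mul]
    refine setIntegral_congr_fun measurableSet_Ioi fun u hu => ?_
    have hu : 0 < u := hu
    have hu' : (u : ℂ) ≠ 0 := by exact_mod_cast hu.ne'
    have : (1 + (ε : ℂ) + I * t) + (j + 1) - 1 = (1 + (ε : ℂ) + I * t) + j := by ring
    rw [this, cpow_add _ _ hu', cpow_natCast, ofReal_mul, mul_cpow_ofReal_nonneg hX.le hu.le]
    push_cast
    ring
  simp_rw [e1]
  rw [integral_integral_swap]
  · rw [← integral_const_mul]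
    refine setIntegral_congr_fun measurableSet_Ioi fun u hu => ?_
    have hu : 0 < u := hu
    rw [integral_mul_const, ← mul_assoc, inv_formula g hg hsupp hpos ε _ (by positivity), mul_comm]
  · have hm := mellin_int g hg hsupp hpos ε
    have hG : IntegrableOn (fun u : ℝ => ((Real.exp (-u) * u ^ ((ε + j + 2) - 1) * X ^ (1+ε) : ℝ) : ℂ)) (Set.Ioi 0) :=
      ((Real.GammaIntegral_convergent (s := ε + j + 2) (by positivity)).mul_const _).ofReal
    have hp := hm.mul_prod hG
    refine hp.mono ?_ ?_
    · have a1 := hm.aestronglyMeasurable.comp_fst (ν := volume.restrict (Set.Ioi (0:ℝ)))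
      refine (a1.mul ?_).mul ?_
      · apply Measurable.aestronglyMeasurable
        fun_prop
      · apply Measurable.aestronglyMeasurable
        fun_prop
    · have : ∀ᵐ z : ℝ × ℝ ∂(volume.prod (volume.restrict (Set.Ioi (0:ℝ)))), 0 < z.2 := by
        have h0 : ∀ᵐ u ∂(volume.restrict (Set.Ioi (0:ℝ))), 0 < u := ae_restrict_mem measurableSet_Ioi
        exact Measure.quasiMeasurePreserving_snd.ae h0
      filter_upwards [this] with z hz
      simp only [Function.uncurry, norm_mul, norm_real]
      rw [norm_cpow_eq_rpow_re_of_pos (by positivity)]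
      apply le_of_eq
      have h1 : ε + j + 2 - 1 = (1 + ε) + j := by ring
      simp only [add_re, one_re, ofReal_re, mul_re, I_re, I_im, ofReal_im, Real.norm_eq_abs]
      rw [h1, Real.rpow_add hz, Real.rpow_natCast, Real.mul_rpow hX.le hz.le]
      have h2 : 0 < z.2 ^ (1+ε) := by positivity
      have h3 : 0 < X ^ (1+ε) := by positivity
      rw [abs_mul, abs_of_pos h2, abs_of_pos h3]
      simp
      ring

lemma taylor_pt (g : ℝ → ℂ) (hg : ContDiff ℝ (⊤ : ℕ∞) g) (hsupp : HasCompactSupport g) :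
    ∃ M > 0, ∀ a y : ℝ, ‖g y - g a - ((y - a : ℝ) : ℂ) * deriv g a‖ ≤ M * (y - a) ^ 2 := by
  have hd1 : ContDiff ℝ (⊤ : ℕ∞) (deriv g) := (contDiff_infty_iff_deriv.1 hg).2
  have hd2 : ContDiff ℝ (⊤ : ℕ∞) (deriv (deriv g)) := (contDiff_infty_iff_deriv.1 hd1).2
  obtain ⟨M, hM⟩ := hsupp.deriv.deriv.exists_bound_of_continuous hd2.continuous
  have hMp : 0 ≤ M := (norm_nonneg _).trans (hM 0)
  have hdg : Differentiable ℝ g := (contDiff_infty_iff_deriv.1 hg).1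
  have hdg1 : Differentiable ℝ (deriv g) := (contDiff_infty_iff_deriv.1 hd1).1
  refine ⟨M + 1, by positivity, fun a y => ?_⟩
  have key : ∀ x, ‖deriv g x - deriv g a‖ ≤ M * ‖x - a‖ := fun x =>
    Convex.norm_image_sub_le_of_norm_deriv_le (fun x _ => hdg1 x) (fun x _ => hM x)
      convex_univ (Set.mem_univ _) (Set.mem_univ _)
  have h := Convex.norm_image_sub_le_of_norm_hasDerivWithin_le
    (f := fun x : ℝ => g x - (x : ℂ) * deriv g a) (f' := fun x => deriv g x - 1 * deriv g a)
    (C := M * |y - a|) (s := Set.uIcc a y) (x := a) (y := y)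
    (fun x _ => ((hdg x).hasDerivAt.sub
      ((Complex.ofRealCLM.hasDerivAt (x := x)).mul_const (deriv g a))).hasDerivWithinAt)
    (fun x hx => by
      rw [one_mul]
      refine (key x).trans ?_
      gcongr
      exact Set.abs_sub_left_of_mem_uIcc hx)
    (convex_uIcc _ _) Set.left_mem_uIcc Set.right_mem_uIcc
  have e : g y - g a - ((y - a : ℝ) : ℂ) * deriv g a =
    (g y - (y : ℂ) * deriv g a) - (g a - (a : ℂ) * deriv g a) := by push_cast; ring
  rw [e]
  refine h.trans ?_
  rw [Real.norm_eq_abs, mul_assoc, abs_mul_abs_self]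
  nlinarith [sq_nonneg (y - a)]

lemma pointwise (g : ℝ → ℂ) (hg : ContDiff ℝ (⊤ : ℕ∞) g) (hsupp : HasCompactSupport g)
    (hpos : tsupport g ⊆ Set.Ioi 0) (ε : ℝ) (hε : 0 < ε) (N : ℕ) (hN : ε ≤ N) :
    ∃ C > 0, ∀ a y : ℝ, 0 < a → 0 < y →
      ‖g y - g a - ((y - a : ℝ) : ℂ) * deriv g a‖ ≤
        C * ((y - a) ^ 2 * a ^ (ε - 1) * (1 + (y / a) ^ N)) := by
  obtain ⟨c, d, hc, hcd, hs⟩ := supp_bounds g hsupp hpos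
  obtain ⟨M, hM⟩ := hsupp.exists_bound_of_continuous hg.continuous
  have hMp : 0 ≤ M := (norm_nonneg _).trans (hM 0)
  obtain ⟨M2, hM2, hT⟩ := taylor_pt g hg hsupp
  have hd : 0 < d := hc.trans hcd
  have hz : ∀ x, x ∉ Set.Icc c d → g x = 0 := fun x hx => by
    by_contra h; exact hx (hs (subset_tsupport g h))
  have hz' : ∀ x, x ∉ Set.Icc c d → deriv g x = 0 := fun x hx => by
    by_contra h; exact hx (hs (support_deriv_subset h))
  set κ := min ((c/2) ^ (ε-1)) ((2*d) ^ (ε-1)) with hκ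
  have hκ0 : 0 < κ := by rw [hκ]; apply lt_min <;> positivity
  have hκa : ∀ a, c/2 ≤ a → a ≤ 2*d → κ ≤ a ^ (ε-1) := by
    intro a h1 h2
    have ha : 0 < a := by linarith
    rcases le_total 0 (ε-1) with h | h
    · exact (min_le_left _ _).trans (Real.rpow_le_rpow (by positivity) h1 h)
    · exact (min_le_right _ _).trans (Real.rpow_le_rpow_of_nonpos ha h2 h)
  set C1 := M2 / κ
  set C2 := 4 * M / (c^2 * c ^ (ε-1))
  set C3 := 4 * M / (2*d) ^ (1+ε)
  have hC1 : 0 ≤ C1 := by positivity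
  have hC2 : 0 ≤ C2 := by positivity
  have hC3 : 0 ≤ C3 := by positivity
  refine ⟨C1 + C2 + C3 + 1, by positivity, fun a y ha hy => ?_⟩
  have hR : 0 ≤ (y - a) ^ 2 * a ^ (ε - 1) * (1 + (y / a) ^ N) := by positivity
  have hR1 : (y - a) ^ 2 * a ^ (ε - 1) ≤ (y - a) ^ 2 * a ^ (ε - 1) * (1 + (y / a) ^ N) := by
    have : 0 ≤ (y/a)^N := by positivity
    exact le_mul_of_one_le_right (by positivity) (by linarith)
  have hR2 : (y - a) ^ 2 * a ^ (ε - 1) * (y / a) ^ N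
      ≤ (y - a) ^ 2 * a ^ (ε - 1) * (1 + (y / a) ^ N) := by
    gcongr; linarith
  generalize (y - a) ^ 2 * a ^ (ε - 1) * (1 + (y / a) ^ N) = R at *
  rcases lt_or_ge a (c/2) with h1 | h1
  · have hna : a ∉ Set.Icc c d := fun h => by linarith [h.1]
    rw [hz a hna, hz' a hna]
    by_cases hny : y ∈ Set.Icc c d
    swap
    · rw [hz y hny]; simp; positivity
    have hyc := hny.1
    have : M ≤ C2 * R := by
      have h2 : c^2/4 ≤ (y-a)^2 := by nlinarith
      have h3 : c ^ (ε-1) ≤ a ^ (ε-1) * (y/a)^N := by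
        have h4 : (c/a)^N ≤ (y/a)^N := by gcongr
        have h5 : c ^ (ε-1) ≤ a ^ (ε-1) * (c/a)^N := by
          rw [← Real.rpow_natCast, Real.div_rpow hc.le ha.le, mul_div_assoc', le_div_iff₀ (by positivity)]
          have e1 : c ^ (N:ℝ) = c ^ (ε-1) * c ^ ((N:ℝ)-(ε-1)) := by
            rw [← Real.rpow_add hc]; congr 1; ring
          have e2 : a ^ (N:ℝ) = a ^ (ε-1) * a ^ ((N:ℝ)-(ε-1)) := by
            rw [← Real.rpow_add ha]; congr 1; ring
          rw [e1, e2]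
          have : a ^ ((N:ℝ)-(ε-1)) ≤ c ^ ((N:ℝ)-(ε-1)) :=
            Real.rpow_le_rpow ha.le (by linarith) (by linarith)
          calc _ = (c ^ (ε-1) * a ^ (ε-1)) * a ^ ((N:ℝ)-(ε-1)) := by ring
            _ ≤ (c ^ (ε-1) * a ^ (ε-1)) * c ^ ((N:ℝ)-(ε-1)) := by gcongr
            _ = _ := by ring
        exact h5.trans (by gcongr)
      have h6 : c^2/4 * c ^ (ε-1) ≤ R := by
        refine le_trans ?_ hR2
        rw [mul_assoc]
        gcongr
      calc M = C2 * (c^2/4 * c ^ (ε-1)) := by simp only [C2]; field_simp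
        _ ≤ _ := by gcongr
    simp only [sub_zero, mul_zero]
    refine (hM y).trans (this.trans ?_)
    nlinarith
  rcases le_or_gt a (2*d) with h2 | h2
  · refine (hT a y).trans ?_
    have : M2 * (y-a)^2 ≤ C1 * R := by
      calc M2 * (y-a)^2 = C1 * ((y-a)^2 * κ) := by simp only [C1]; field_simp
        _ ≤ C1 * ((y - a) ^ 2 * a ^ (ε - 1)) := by
          have := hκa a h1 h2
          gcongr
        _ ≤ _ := by gcongr
    nlinarith
  · have hna : a ∉ Set.Icc c d := fun h => by linarith [h.2]
    rw [hz a hna, hz' a hna]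
    by_cases hny : y ∈ Set.Icc c d
    swap
    · rw [hz y hny]; simp; positivity
    have hyd := hny.2
    have : M ≤ C3 * R := by
      have h2' : a^2/4 ≤ (y-a)^2 := by nlinarith
      have h3 : (2*d) ^ (1+ε) ≤ a^2 * a ^ (ε-1) := by
        rw [← Real.rpow_natCast, ← Real.rpow_add ha]
        have : ((2:ℕ):ℝ) + (ε-1) = 1 + ε := by push_cast; ring
        rw [this]
        gcongr
      calc M = C3 * ((2*d) ^ (1+ε) / 4) := by simp only [C3]; field_simp
        _ ≤ C3 * (a^2 * a ^ (ε-1) / 4) := by gcongr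
        _ = C3 * (a^2/4 * a ^ (ε-1)) := by ring
        _ ≤ C3 * ((y-a)^2 * a ^ (ε-1)) := by gcongr
        _ ≤ _ := by gcongr
    simp only [sub_zero, mul_zero]
    refine (hM y).trans (this.trans ?_)
    nlinarith

open MeasureTheory in
lemma moment_int (n : ℕ) : IntegrableOn (fun u : ℝ => Real.exp (-u) * u ^ n) (Set.Ioi 0) := by
  have := Real.GammaIntegral_convergent (s := n + 1) (by positivity)
  simpa using this

open MeasureTheory in
lemma moment_eq (n : ℕ) : ∫ u in Set.Ioi (0:ℝ), Real.exp (-u) * u ^ n = (n.factorial : ℝ) := by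
  have := Real.Gamma_eq_integral (s := n + 1) (by positivity)
  rw [Real.Gamma_nat_eq_factorial] at this
  simpa using this.symm

open MeasureTheory in
lemma moment2_int (j N : ℕ) (m : ℝ) :
    IntegrableOn (fun u : ℝ => Real.exp (-u) * u ^ j * ((u - m) ^ 2 * u ^ N)) (Set.Ioi 0) := by
  have := ((moment_int (j+N+2)).sub ((moment_int (j+N+1)).const_mul (2*m))).add
    ((moment_int (j+N)).const_mul (m^2))
  refine this.congr (Filter.Eventually.of_forall fun u => ?_)
  simp only [Pi.add_apply, Pi.sub_apply]
  ring

open MeasureTheory in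
lemma moment2_eq (j N : ℕ) :
    ∫ u in Set.Ioi (0:ℝ), Real.exp (-u) * u ^ j * ((u - (j + 1)) ^ 2 * u ^ N) =
      ((j + N).factorial : ℝ) * (N ^ 2 + N + (j + 1)) := by
  set m : ℝ := j + 1 with hm
  have i1 := moment_int (j+N+2)
  have i2 := (moment_int (j+N+1)).const_mul (2*m)
  have i3 := (moment_int (j+N)).const_mul (m^2)
  have i12 : Integrable (fun u : ℝ => Real.exp (-u) * u ^ (j+N+2) -
      2*m*(Real.exp (-u) * u ^ (j+N+1))) (volume.restrict (Set.Ioi 0)) := i1.sub i2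
  have : (fun u : ℝ => Real.exp (-u) * u ^ j * ((u - m) ^ 2 * u ^ N)) =
     fun u => (Real.exp (-u) * u ^ (j+N+2) - 2*m*(Real.exp (-u) * u ^ (j+N+1))) +
      m^2*(Real.exp (-u) * u ^ (j+N)) := by
    funext u; ring
  rw [this, integral_add i12 i3, integral_sub i1 i2, integral_const_mul, integral_const_mul,
    moment_eq, moment_eq, moment_eq, Nat.factorial_succ (j+N+1), Nat.factorial_succ (j+N)]
  push_cast
  rw [hm]
  ring

open MeasureTheory in
lemma gamma_mean (g : ℝ → ℂ) (hg : ContDiff ℝ (⊤ : ℕ∞) g) (hsupp : HasCompactSupport g)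
    (hpos : tsupport g ⊆ Set.Ioi 0) (ε : ℝ) (hε : 0 < ε) :
    ∃ C > 0, ∀ j : ℕ, ∀ X : ℝ, 0 < X →
      ‖(∫ u in Set.Ioi (0:ℝ), ((Real.exp (-u) * u ^ j : ℝ) : ℂ) * g (X * u)) / (j.factorial : ℂ)
        - g (X * (j + 1))‖ ≤ C * (j + 1 : ℝ) ^ ε * X ^ (1 + ε) := by
  obtain ⟨N, hN⟩ := exists_nat_ge ε
  obtain ⟨C, hC, hpt⟩ := pointwise g hg hsupp hpos ε hε N hN
  refine ⟨C * (1 + (N+1)^N * (N^2+N+1)), by positivity, fun j X hX => ?_⟩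
  set m : ℝ := j + 1 with hm
  have hm0 : 0 < m := by positivity
  set a := X * m with ha
  have ha0 : 0 < a := by positivity
  obtain ⟨B, hB⟩ := hsupp.exists_bound_of_continuous hg.continuous
  have w0 : IntegrableOn (fun u : ℝ => ((Real.exp (-u) * u ^ j : ℝ) : ℂ)) (Set.Ioi 0) :=
    (moment_int j).ofReal
  have w1 : IntegrableOn (fun u : ℝ => ((Real.exp (-u) * u ^ (j+1) : ℝ) : ℂ)) (Set.Ioi 0) :=
    (moment_int (j+1)).ofReal
  have wg : IntegrableOn (fun u : ℝ => ((Real.exp (-u) * u ^ j : ℝ) : ℂ) * g (X * u)) (Set.Ioi 0) :=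
    w0.mul_bdd (c := B) (hg.continuous.comp (continuous_const.mul continuous_id)).aestronglyMeasurable
      (Filter.Eventually.of_forall fun u => hB _)
  have e0 : ∫ u in Set.Ioi (0:ℝ), ((Real.exp (-u) * u ^ j : ℝ) : ℂ) = (j.factorial : ℂ) := by
    rw [integral_complex_ofReal, moment_eq]; simp
  have e1 : ∫ u in Set.Ioi (0:ℝ), ((Real.exp (-u) * u ^ (j+1) : ℝ) : ℂ) = (m : ℂ) * (j.factorial : ℂ) := by
    rw [integral_complex_ofReal, moment_eq, Nat.factorial_succ]; simp [hm]
  have hj : (j.factorial : ℂ) ≠ 0 := by exact_mod_cast j.factorial_ne_zero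
  have hj' : (0 : ℝ) < j.factorial := by exact_mod_cast j.factorial_pos
  have main : (∫ u in Set.Ioi (0:ℝ), ((Real.exp (-u) * u ^ j : ℝ) : ℂ) * g (X * u)) / (j.factorial : ℂ) - g a
      = (∫ u in Set.Ioi (0:ℝ), ((Real.exp (-u) * u ^ j : ℝ) : ℂ) *
        (g (X * u) - g a - ((X * u - a : ℝ) : ℂ) * deriv g a)) / (j.factorial : ℂ) := by
    have : (fun u : ℝ => ((Real.exp (-u) * u ^ j : ℝ) : ℂ) *
        (g (X * u) - g a - ((X * u - a : ℝ) : ℂ) * deriv g a)) =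
        fun u : ℝ => (((Real.exp (-u) * u ^ j : ℝ) : ℂ) * g (X * u) -
          ((Real.exp (-u) * u ^ j : ℝ) : ℂ) * (g a - a * deriv g a)) -
          ((Real.exp (-u) * u ^ (j+1) : ℝ) : ℂ) * (X * deriv g a) := by
      funext u; push_cast; ring
    have i12 : Integrable (fun u : ℝ => ((Real.exp (-u) * u ^ j : ℝ) : ℂ) * g (X * u) -
          ((Real.exp (-u) * u ^ j : ℝ) : ℂ) * (g a - a * deriv g a))
          (volume.restrict (Set.Ioi 0)) := wg.sub (w0.mul_const _)
    rw [this, integral_sub i12 (w1.mul_const _), integral_sub wg (w0.mul_const _),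
      integral_mul_const, integral_mul_const, e0, e1]
    have haC : (a : ℂ) = X * m := by rw [ha]; push_cast; ring
    rw [haC]
    generalize (∫ u in Set.Ioi (0:ℝ), ((Real.exp (-u) * u ^ j : ℝ) : ℂ) * g (X * u)) = J
    field_simp
    ring
  rw [main, norm_div, Complex.norm_natCast, div_le_iff₀ hj']
  have i0 := moment2_int j 0 m
  have iN := moment2_int j N m
  have q0 := moment2_eq j 0
  have qN := moment2_eq j N
  rw [← hm] at q0 qN
  simp only [Nat.cast_zero, pow_zero, mul_one, add_zero] at i0 q0
  set D := C * (X^2 * a ^ (ε-1)) with hD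
  have hD0 : 0 < D := by positivity
  have bd : ‖∫ u in Set.Ioi (0:ℝ), ((Real.exp (-u) * u ^ j : ℝ) : ℂ) *
        (g (X * u) - g a - ((X * u - a : ℝ) : ℂ) * deriv g a)‖ ≤
      ∫ u in Set.Ioi (0:ℝ), (D * (Real.exp (-u) * u ^ j * (u - m) ^ 2) +
        D / m^N * (Real.exp (-u) * u ^ j * ((u - m) ^ 2 * u ^ N))) := by
    refine norm_integral_le_of_norm_le ((i0.const_mul D).add (iN.const_mul (D / m^N))) ?_
    filter_upwards [ae_restrict_mem measurableSet_Ioi] with u hu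
    have hu : 0 < u := hu
    rw [norm_mul, Complex.norm_real, Real.norm_of_nonneg (by positivity)]
    have := hpt a (X*u) ha0 (by positivity)
    calc _ ≤ Real.exp (-u) * u ^ j * (C * ((X * u - a) ^ 2 * a ^ (ε - 1) * (1 + (X * u / a) ^ N))) := by
          gcongr
      _ = _ := by
        have e2 : X * u / a = u / m := by rw [ha]; field_simp
        rw [e2, hD, ha, div_pow]
        field_simp
  refine bd.trans ?_
  rw [integral_add (i0.const_mul D) (iN.const_mul _), integral_const_mul, integral_const_mul, q0, qN]
  have f1 : ((j+N).factorial : ℝ) ≤ j.factorial * ((N+1)^N * m^N) := by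
    rw [← Nat.factorial_mul_ascFactorial]
    have : (((j+1).ascFactorial N : ℕ) : ℝ) ≤ ((j + N : ℕ) : ℝ)^N := by
      exact_mod_cast Nat.ascFactorial_le_pow_add j N
    push_cast at this ⊢
    rw [← mul_pow]
    have h2 : ((j:ℝ) + N)^N ≤ ((N+1)*m)^N := by
      gcongr
      rw [hm]
      have : (0:ℝ) ≤ N * j := by positivity
      linarith
    gcongr
    exact this.trans h2
  have f2 : (N:ℝ)^2 + N + m ≤ (N^2+N+1) * m := by
    have : (1:ℝ) ≤ m := by rw [hm]; linarith [(Nat.cast_nonneg j : (0:ℝ) ≤ j)]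
    have h3 : (0:ℝ) ≤ (N:ℝ)^2+N := by positivity
    nlinarith
  have f3 : D * m = C * m ^ ε * X ^ (1+ε) := by
    rw [hD, ha, Real.mul_rpow hX.le hm0.le, Real.rpow_sub hX, Real.rpow_sub hm0, Real.rpow_add hX]
    simp only [Real.rpow_one]
    field_simp
  calc _ ≤ D * (j.factorial * m) + D / m^N * (j.factorial * ((N+1)^N * m^N) * ((N^2+N+1) * m)) := by
        gcongr
        simp
    _ = (D * m) * (1 + (N+1)^N * (N^2+N+1)) * j.factorial := by
        field_simp
    _ = _ := by rw [f3]; ring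


open Complex in
/-- Mellin inversion with the Gamma-ratio weight on the line `Re(s) = 1 + ε`: for `g`
smooth and compactly supported in `(0, ∞)` with Mellin transform
`G(s) = ∫₀^∞ g(y) y^{s-1} dy`, one has
`(1/2π) ∫_ℝ G(-(1+ε+it)) X^{1+ε+it} Γ(1+ε+it+k-1)/Γ(k-1) dt = g(X(k-1)) + O_{g,ε}(k^ε X^{1+ε})`. -/
theorem stmt11 (g : ℝ → ℂ) (hg : ContDiff ℝ (⊤ : ℕ∞) g) (hsupp : HasCompactSupport g)
    (hpos : tsupport g ⊆ Set.Ioi 0) (ε : ℝ) (hε : 0 < ε) :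
    ∃ C > (0 : ℝ), ∀ k : ℕ, 3 ≤ k → ∀ X : ℝ, 0 < X →
      ‖((1 / (2 * Real.pi) : ℝ) : ℂ) * (∫ t : ℝ,
            (∫ y in Set.Ioi (0 : ℝ), g y * (y : ℂ) ^ (-(1 + (ε : ℂ) + I * t) - 1)) *
            (X : ℂ) ^ (1 + (ε : ℂ) + I * t) *
            (Complex.Gamma ((1 + (ε : ℂ) + I * t) + k - 1) / Complex.Gamma ((k : ℂ) - 1)))
          - g (X * ((k : ℝ) - 1))‖
        ≤ C * (k : ℝ) ^ ε * X ^ (1 + ε) := by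
  obtain ⟨C, hC, h⟩ := gamma_mean g hg hsupp hpos ε hε
  refine ⟨C, hC, fun k hk X hX => ?_⟩
  obtain ⟨j, rfl⟩ : ∃ j, k = j + 2 := ⟨k - 2, by omega⟩
  have h1 := h j X hX
  rw [← fubini_formula g hg hsupp hpos ε hε j X hX] at h1
  have e1 : (X * (((j + 2 : ℕ) : ℝ) - 1)) = X * (j + 1) := by push_cast; ring
  have e2 : Complex.Gamma (((j + 2 : ℕ) : ℂ) - 1) = (j.factorial : ℂ) := by
    rw [← Complex.Gamma_nat_eq_factorial]; congr 1; push_cast; ring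
  have e3 : ∀ t : ℝ, (∫ y in Set.Ioi (0 : ℝ), g y * (y : ℂ) ^ (-(1 + (ε : ℂ) + I * t) - 1)) =
      mellin g (-(1 + (ε : ℂ) + I * t)) := by
    intro t
    simp only [mellin, smul_eq_mul, mul_comm]
  have e4 : ∀ t : ℝ, (1 + (ε : ℂ) + I * t) + ((j + 2 : ℕ) : ℂ) - 1 =
      (1 + (ε : ℂ) + I * t) + (j + 1) := by
    intro t; push_cast; ring
  rw [e1, e2]
  simp only [e3, e4]
  simp only [mul_div_assoc', MeasureTheory.integral_div]
  refine h1.trans ?_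
  have : (j + 1 : ℝ) ^ ε ≤ ((j + 2 : ℕ) : ℝ) ^ ε := by
    apply Real.rpow_le_rpow (by positivity) _ hε.le
    push_cast; linarith
  gcongr
end

section
/- Let ψ : ℝ → ℂ be continuous with compact support contained in (0, ∞). For z = x + iy in the upper half-plane define P(z) := ψ(y) + Σ_{c ≥ 1} Σ_{d ∈ ℤ, gcd(c,d) = 1} ψ(y / |c z + d|²) (this is the incomplete Eisenstein series Σ_{γ ∈ Γ_∞\Γ} ψ(Im γz) for Γ = SL₂(ℤ)). Then ∫_𝒟 P(z) y^{-2} dx dy = ∫₀^∞ ψ(y) y^{-2} dy, where 𝒟 := { z = x + iy : y > 0, |z| > 1, |x| < 1/2 } is the standard fundamental domain for the action of SL₂(ℤ) on the upper half-plane. -/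
namespace Unfold

open UpperHalfPlane MeasureTheory MatrixGroups

/-- the coordinates of a point of the upper half-plane -/
noncomputable def toPair (z : ℍ) : ℝ × ℝ := (z.re, z.im)

lemma toPair_emb : MeasurableEmbedding toPair :=
  Complex.measurableEquivRealProd.measurableEmbedding.comp measurableEmbedding_coe

lemma toPair_mp : MeasurePreserving toPair (volume.comap UpperHalfPlane.coe)
    (volume.restrict {q : ℝ × ℝ | 0 < q.2}) := by
  have h1 : MeasurePreserving UpperHalfPlane.coe (volume.comap UpperHalfPlane.coe)
      (volume.restrict (.range UpperHalfPlane.coe)) :=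
    ⟨measurable_coe, by rw [measurableEmbedding_coe.map_comap]⟩
  have h2 := Complex.volume_preserving_equiv_real_prod.restrict_preimage_emb
    Complex.measurableEquivRealProd.measurableEmbedding {q : ℝ × ℝ | 0 < q.2}
  have h3 : (Complex.measurableEquivRealProd ⁻¹' {q : ℝ × ℝ | 0 < q.2}) =
      Set.range UpperHalfPlane.coe := by
    ext z
    constructor
    · intro hz
      exact ⟨⟨z, hz⟩, rfl⟩
    · rintro ⟨w, rfl⟩
      exact w.im_pos
  rw [h3] at h2
  exact h2.comp h1

/-- density -/
noncomputable def dens (z : ℍ) : NNReal := (1 / NNReal.mk z.im z.im_pos.le) ^ 2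

lemma dens_meas : Measurable dens := by
  have : Continuous dens := by
    refine .pow (.div₀ continuous_const ?_ ?_) _
    · exact continuous_im.subtype_mk _
    · exact fun x ↦ NNReal.ne_iff.mp x.im_ne_zero
  exact this.measurable

lemma dens_smul (z : ℍ) (w : ℂ) : dens z • w = w / ((z.im : ℂ) ^ 2) := by
  rw [NNReal.smul_def]
  simp only [dens]
  push_cast
  simp [Complex.real_smul]
  field_simp

lemma integral_toPair (f : ℝ × ℝ → ℂ) :
    ∫ z : ℍ, f (toPair z) = ∫ q in {q : ℝ × ℝ | 0 < q.2}, f q / ((q.2 : ℂ) ^ 2) := by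
  rw [← toPair_mp.integral_comp toPair_emb, volume_def]
  change ∫ z : ℍ, f (toPair z) ∂((volume.comap UpperHalfPlane.coe).withDensity fun z => (dens z : ENNReal)) = _
  rw [integral_withDensity_eq_integral_smul dens_meas]
  simp only [dens_smul]
  rfl

lemma integrable_toPair (f : ℝ × ℝ → ℂ)
    (hf : IntegrableOn (fun q => f q / ((q.2 : ℂ) ^ 2)) {q : ℝ × ℝ | 0 < q.2}) :
    Integrable (fun z : ℍ => f (toPair z)) := by
  rw [IntegrableOn, ← toPair_mp.integrable_comp_emb toPair_emb] at hf
  rw [volume_def]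
  change Integrable _ ((volume.comap UpperHalfPlane.coe).withDensity fun z => (dens z : ENNReal))
  rw [integrable_withDensity_iff_integrable_smul dens_meas]
  simp only [dens_smul]
  exact hf

lemma null_of_toPair (s : Set (ℝ × ℝ)) (hs : volume s = 0) : volume (toPair ⁻¹' s) = 0 := by
  rw [volume_def]
  apply withDensity_absolutelyContinuous
  have := (toPair_mp.quasiMeasurePreserving).preimage_null
    (s := s) (Measure.restrict_le_self.absolutelyContinuous hs)
  exact this

lemma setIntegral_toPair (f : ℝ × ℝ → ℂ) (s : Set (ℝ × ℝ)) (hs : MeasurableSet s)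
    (hpos : s ⊆ {q | 0 < q.2}) :
    ∫ z in toPair ⁻¹' s, f (toPair z) = ∫ q in s, f q / ((q.2 : ℂ) ^ 2) := by
  rw [← integral_indicator (toPair_emb.measurable hs)]
  have h := integral_toPair (s.indicator f)
  have e1 : (fun z => s.indicator f (toPair z)) =
      (toPair ⁻¹' s).indicator (fun z => f (toPair z)) := rfl
  rw [e1] at h
  rw [h]
  have e2 : (fun q : ℝ × ℝ => s.indicator f q / ((q.2 : ℂ) ^ 2)) =
      s.indicator (fun q => f q / ((q.2 : ℂ) ^ 2)) := by
    ext q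
    by_cases hq : q ∈ s <;> simp [hq]
  rw [e2, setIntegral_indicator hs, Set.inter_eq_right.mpr hpos]

lemma fd_diff_null : volume (ModularGroup.fd \ ModularGroup.fdo) = 0 := by
  have hline : ∀ a : ℝ, volume (toPair ⁻¹' ({a} ×ˢ Set.univ)) = 0 := by
    intro a
    apply null_of_toPair
    rw [Measure.volume_eq_prod, Measure.prod_prod]
    simp
  have hcirc : volume (toPair ⁻¹' (Complex.measurableEquivRealProd.symm ⁻¹' Metric.sphere 0 1)) = 0 := by
    apply null_of_toPair
    rw [(Complex.volume_preserving_equiv_real_prod.symm _).measure_preimage_equiv]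
    exact Measure.addHaar_sphere _ _ _
  refine measure_mono_null ?_ (measure_union_null (measure_union_null (hline (1/2)) (hline (-(1/2)))) hcirc)
  rintro z ⟨⟨h1, h2⟩, h3⟩
  by_cases h : |z.re| = 1 / 2
  · left
    rcases (abs_eq (by norm_num)).1 h with h | h
    · left; simp [toPair, h]
    · right; simp [toPair, h]
  · right
    have h4 : Complex.normSq (z : ℂ) = 1 := by
      by_contra h5
      exact h3 ⟨lt_of_le_of_ne h1 (Ne.symm h5), lt_of_le_of_ne h2 h⟩
    have h6 : Complex.measurableEquivRealProd.symm (toPair z) = (z : ℂ) := by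
      apply Complex.ext <;> rfl
    simp only [Set.mem_preimage, h6, mem_sphere_zero_iff_norm]
    rw [Complex.normSq_eq_norm_sq] at h4
    nlinarith [norm_nonneg (z : ℂ)]

lemma smul_mp (g : SL(2, ℤ)) : MeasurePreserving (fun z : ℍ => g • z) volume volume :=
  measurePreserving_smul (g : GL (Fin 2) ℝ) (volume : Measure ℍ)

lemma smul_emb (g : SL(2, ℤ)) : MeasurableEmbedding (fun z : ℍ => g • z) :=
  measurableEmbedding_const_smul (g : GL (Fin 2) ℝ)

/-- index set for `Γ_∞ \ Γ` -/
abbrev Idx : Type := Unit ⊕ (Σ c : ℕ+, {d : ℤ // Int.gcd (c : ℤ) d = 1})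

/-- bottom row -/
def row : Idx → (Fin 2 → ℤ)
  | .inl _ => ![0, 1]
  | .inr p => ![(p.1 : ℤ), (p.2 : ℤ)]

lemma row_inj : ∀ i j : Idx, (row i = row j ∨ row i = - row j) → i = j ∧ row i = row j := by
  intro i j h
  have h0 : (row i 0 = row j 0 ∧ row i 1 = row j 1) ∨ (row i 0 = - row j 0 ∧ row i 1 = - row j 1) := by
    rcases h with h | h
    · left; simp [h]
    · right; simp [h]
  rcases i with i | ⟨c, d, hd⟩ <;> rcases j with j | ⟨c', d', hd'⟩
  · exact ⟨rfl, rfl⟩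
  · have := c'.pos
    simp [row] at h0
    exfalso; lia
  · have := c.pos
    simp [row] at h0
  · have := c.pos
    have := c'.pos
    simp only [row, Matrix.cons_val_zero, Matrix.cons_val_one] at h0
    have h1 : (c : ℕ) = c' := by lia
    have h2 : d = d' := by lia
    have h1' : c = c' := PNat.coe_injective h1
    subst h1'; subst h2
    exact ⟨rfl, rfl⟩

lemma row_coprime (i : Idx) : IsCoprime (row i 0) (row i 1) := by
  rcases i with i | ⟨c, d, hd⟩
  · exact isCoprime_one_right
  · exact Int.isCoprime_iff_gcd_eq_one.mpr hd

lemma row_surj (p : Fin 2 → ℤ) (hp : IsCoprime (p 0) (p 1)) : ∃ i, p = row i ∨ p = - row i := by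
  rcases lt_trichotomy (p 0) 0 with h | h | h
  · refine ⟨.inr ⟨⟨(-p 0).toNat, by lia⟩, -p 1, ?_⟩, Or.inr ?_⟩
    · have e : (((-p 0).toNat : ℕ) : ℤ) = - p 0 := by lia
      simp [e, Int.isCoprime_iff_gcd_eq_one.mp hp]
    · ext k; fin_cases k
      · simp [row]; lia
      · simp [row]
  · rw [h, isCoprime_zero_left, Int.isUnit_iff] at hp
    refine ⟨.inl (), ?_⟩
    rcases hp with hp | hp
    · left; ext k; fin_cases k <;> simp [row, h, hp]
    · right; ext k; fin_cases k <;> simp [row, h, hp]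
  · refine ⟨.inr ⟨⟨(p 0).toNat, by lia⟩, p 1, ?_⟩, Or.inl ?_⟩
    · have e : (((p 0).toNat : ℕ) : ℤ) = p 0 := by lia
      simp [e, Int.isCoprime_iff_gcd_eq_one.mp hp]
    · ext k; fin_cases k
      · simp [row]; lia
      · simp [row]

lemma exists_rep (i : Idx) : ∃ g : SL(2, ℤ), g 1 = row i := by
  obtain ⟨g, -, hg⟩ := ModularGroup.bottom_row_surj (R := ℤ) (row_coprime i)
  exact ⟨g, hg⟩

/-- coset representatives -/
noncomputable def rep (i : Idx) : SL(2, ℤ) := (exists_rep i).choose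

lemma rep_row (i : Idx) : (rep i) 1 = row i := (exists_rep i).choose_spec

/-- representatives of `Γ / ±1` -/
noncomputable def el (j : Idx × ℤ) : SL(2, ℤ) := ModularGroup.T ^ j.2 * rep j.1

lemma el_row (j : Idx × ℤ) : (el j) 1 = row j.1 := by
  rw [← rep_row]
  ext k
  simp [el]

lemma el_inj (j k : Idx × ℤ) (h : el j = el k ∨ el j = - el k) : j = k := by
  have h1 : row j.1 = row k.1 ∨ row j.1 = - row k.1 := by
    rw [← el_row, ← el_row]
    rcases h with h | h
    · left; rw [h]
    · right; rw [h]; ext i; simp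
  obtain ⟨h2, h3⟩ := row_inj _ _ h1
  obtain ⟨j1, j2⟩ := j
  obtain ⟨k1, k2⟩ := k
  simp only at h2
  subst h2
  have h4 : ModularGroup.T ^ j2 • (rep j1 • I) = ModularGroup.T ^ k2 • (rep j1 • I) := by
    rw [← mul_smul, ← mul_smul]
    change el (j1, j2) • I = el (j1, k2) • I
    rcases h with h | h
    · rw [h]
    · rw [h, ModularGroup.SL_neg_smul]
  have h5 := congrArg UpperHalfPlane.re h4
  rw [ModularGroup.re_T_zpow_smul, ModularGroup.re_T_zpow_smul] at h5
  have : j2 = k2 := by exact_mod_cast add_left_cancel h5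
  rw [this]

lemma el_surj (g : SL(2, ℤ)) : ∃ j, ∀ z : ℍ, g • z = el j • z := by
  obtain ⟨i, hi⟩ := row_surj (g 1) (ModularGroup.bottom_row_coprime g)
  have hr := rep_row i
  have hc : (g * (rep i)⁻¹) 1 0 = 0 := by
    have e1 : (rep i) 1 0 = row i 0 := by rw [hr]
    have e2 : (rep i) 1 1 = row i 1 := by rw [hr]
    rw [Matrix.SpecialLinearGroup.coe_mul, Matrix.SpecialLinearGroup.coe_inv,
      Matrix.adjugate_fin_two, Matrix.mul_apply, Fin.sum_univ_two]
    rcases hi with hi | hi <;> simp [hi, e1, e2] <;> ring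
  obtain ⟨n, hn⟩ := ModularGroup.exists_eq_T_zpow_of_c_eq_zero hc
  refine ⟨(i, n), fun z => ?_⟩
  have := hn (rep i • z)
  rw [← mul_smul, ← mul_smul, inv_mul_cancel_right] at this
  exact this

/-- tiles of the tessellation -/
def tile (j : Idx × ℤ) : Set ℍ := (fun z : ℍ => el j • z) '' ModularGroup.fdo

lemma tile_meas (j : Idx × ℤ) : MeasurableSet (tile j) :=
  (smul_emb _).measurableSet_image.mpr ModularGroup.isOpen_fdo.measurableSet

lemma tile_disj : Pairwise (Function.onFun Disjoint tile) := by
  intro j k hjk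
  rw [Function.onFun, Set.disjoint_left]
  rintro x ⟨z, hz, hzx⟩ ⟨w, hw, hwx⟩
  apply hjk
  simp only at hzx hwx
  have h1 : ((el k)⁻¹ * el j) • z = w := by
    rw [mul_smul, hzx, ← hwx, inv_smul_smul]
  apply el_inj
  rcases ModularGroup.eq_one_or_neg_one_of_mem_fdo_mem_fdo hz (h1 ▸ hw) with h | h
  · left; exact (inv_mul_eq_one.mp h).symm
  · right
    rw [inv_mul_eq_iff_eq_mul] at h
    rw [h]; simp

lemma tile_cover : (⋃ j, tile j) =ᵐ[volume] (Set.univ : Set ℍ) := by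
  rw [ae_eq_univ]
  have hnull : volume (⋃ j : Idx × ℤ, (fun z : ℍ => el j • z) '' (ModularGroup.fd \ ModularGroup.fdo)) = 0 := by
    rw [measure_iUnion_null_iff]
    intro j
    rw [← (smul_mp (el j)).measure_preimage_emb (smul_emb (el j)),
      Set.preimage_image_eq _ (smul_emb (el j)).injective]
    exact fd_diff_null
  refine measure_mono_null ?_ hnull
  intro z hz
  obtain ⟨g, hg⟩ := ModularGroup.exists_smul_mem_fd z
  obtain ⟨j, hj⟩ := el_surj g⁻¹
  have hzj : el j • (g • z) = z := by rw [← hj, inv_smul_smul]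
  rw [Set.mem_iUnion]
  refine ⟨j, g • z, ⟨hg, fun hgo => hz ?_⟩, hzj⟩
  rw [Set.mem_iUnion]
  exact ⟨j, g • z, hgo, hzj⟩

lemma unfold_hasSum {E : Type*} [NormedAddCommGroup E] [NormedSpace ℝ E]
    (G : ℍ → E) (hG : Integrable G) :
    HasSum (fun j => ∫ z in ModularGroup.fdo, G (el j • z)) (∫ z, G z) := by
  have h := hasSum_integral_iUnion tile_meas tile_disj (hG.integrableOn (s := ⋃ j, tile j))
  rw [setIntegral_congr_set tile_cover, setIntegral_univ] at h
  convert h using 2 with j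
  exact ((smul_mp (el j)).setIntegral_image_emb (smul_emb (el j)) G _).symm

lemma unfold_integral (G : ℍ → ℂ) (hG : Integrable G) :
    ∫ z in ModularGroup.fdo, ∑' j, G (el j • z) = ∫ z, G z := by
  have h1 := unfold_hasSum _ hG.norm
  have h2 := unfold_hasSum _ hG
  refine (hasSum_integral_of_summable_integral_norm (fun j => ?_) h1.summable).unique h2
  exact (((smul_mp (el j)).integrable_comp_emb (smul_emb (el j))).mpr hG).integrableOn

/-- cut-off to the strip -/
noncomputable def cut (ψ : ℝ → ℂ) (q : ℝ × ℝ) : ℂ :=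
  (Set.Ico (-(1/2) : ℝ) (1/2)).indicator (fun _ => (1 : ℂ)) q.1 * ψ q.2

lemma zero_near (ψ : ℝ → ℂ) (hpos : tsupport ψ ⊆ Set.Ioi 0) : ψ =ᶠ[nhds 0] 0 := by
  rw [← notMem_tsupport_iff_eventuallyEq]
  intro h
  exact lt_irrefl (0 : ℝ) (hpos h)

lemma psi_integrable (ψ : ℝ → ℂ) (hcont : Continuous ψ) (hsupp : HasCompactSupport ψ)
    (hpos : tsupport ψ ⊆ Set.Ioi 0) : Integrable (fun y : ℝ => ψ y / ((y : ℂ) ^ 2)) := by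
  apply Continuous.integrable_of_hasCompactSupport
  · rw [continuous_iff_continuousAt]
    intro y
    by_cases hy : y = 0
    · subst hy
      have : (fun y : ℝ => ψ y / ((y : ℂ) ^ 2)) =ᶠ[nhds 0] fun _ => 0 := by
        filter_upwards [zero_near ψ hpos] with y hy
        simp [hy]
      exact continuousAt_const.congr this.symm
    · apply ContinuousAt.div hcont.continuousAt (by fun_prop)
      simpa using hy
  · simp only [div_eq_mul_inv]
    exact hsupp.mul_right

lemma cut_div (ψ : ℝ → ℂ) (q : ℝ × ℝ) : cut ψ q / ((q.2 : ℂ) ^ 2) =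
    (Set.Ico (-(1/2) : ℝ) (1/2)).indicator (fun _ => (1 : ℂ)) q.1 * (ψ q.2 / ((q.2 : ℂ) ^ 2)) := by
  rw [cut, mul_div_assoc]

lemma cut_integrable (ψ : ℝ → ℂ) (hcont : Continuous ψ) (hsupp : HasCompactSupport ψ)
    (hpos : tsupport ψ ⊆ Set.Ioi 0) : Integrable (fun z : ℍ => cut ψ (toPair z)) := by
  apply integrable_toPair
  simp only [cut_div]
  refine Integrable.integrableOn (Integrable.mul_prod ?_ (psi_integrable ψ hcont hsupp hpos))
  rw [integrable_indicator_iff measurableSet_Ico]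
  simp [IntegrableOn]

lemma cut_integral (ψ : ℝ → ℂ) :
    ∫ z : ℍ, cut ψ (toPair z) = ∫ y in Set.Ioi (0 : ℝ), ψ y / ((y : ℂ) ^ 2) := by
  rw [integral_toPair]
  simp only [cut_div]
  have : {q : ℝ × ℝ | 0 < q.2} = Set.univ ×ˢ Set.Ioi 0 := by ext; simp
  rw [this, Measure.volume_eq_prod, setIntegral_prod_mul (μ := (volume : Measure ℝ))
    (fun x => (Set.Ico (-(1/2) : ℝ) (1/2)).indicator (fun _ => (1 : ℂ)) x)
    (fun y : ℝ => ψ y / ((y : ℂ) ^ 2))]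
  rw [setIntegral_univ, integral_indicator measurableSet_Ico]
  norm_num

lemma rep_im (i : Idx) (z : ℍ) :
    (rep i • z).im = z.im / Complex.normSq ((row i 0 : ℂ) * z + row i 1) := by
  rw [ModularGroup.im_smul_eq_div_normSq, ModularGroup.denom_apply, ← rep_row]

lemma finite_support (ψ : ℝ → ℂ) (hpos : tsupport ψ ⊆ Set.Ioi 0) (z : ℍ) :
    (Function.support fun i : Idx => ψ (rep i • z).im).Finite := by
  have hinj : Function.Injective row := fun i j h => (row_inj i j (Or.inl h)).1
  have h1 := (ModularGroup.tendsto_normSq_coprime_pair z).comp hinj.tendsto_cofinite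
  have h2 := (Filter.Tendsto.const_div_atTop h1 z.im).eventually (zero_near ψ hpos)
  rw [Filter.eventually_cofinite] at h2
  refine h2.subset fun i hi => ?_
  simp only [Function.mem_support, rep_im] at hi
  exact hi

lemma cut_el (ψ : ℝ → ℂ) (z : ℍ) : ∃ N : Idx → ℤ, ∀ i n,
    cut ψ (toPair (el (i, n) • z)) = if n = N i then ψ (rep i • z).im else 0 := by
  have h : ∀ i : Idx, ∃ N : ℤ, ∀ n : ℤ,
      ((rep i • z).re + n ∈ Set.Ico (-(1/2) : ℝ) (1/2) ↔ n = N) := by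
    intro i
    obtain ⟨N, h1, h2⟩ := existsUnique_add_zsmul_mem_Ico (one_pos : (0:ℝ) < 1) (rep i • z).re (-(1/2))
    have e : (-(1/2) + 1 : ℝ) = 1/2 := by norm_num
    simp only [e, zsmul_eq_mul, mul_one] at h1 h2
    exact ⟨N, fun n => ⟨fun hn => h2 n hn, fun hn => hn ▸ h1⟩⟩
  choose N hN using h
  refine ⟨N, fun i n => ?_⟩
  have e : el (i, n) • z = ModularGroup.T ^ n • (rep i • z) := by
    rw [← mul_smul]; rfl
  rw [e, cut, toPair]
  simp only [ModularGroup.re_T_zpow_smul, ModularGroup.im_T_zpow_smul]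
  rw [Set.indicator_apply]
  simp only [hN]
  split_ifs <;> simp

lemma tsum_cut (ψ : ℝ → ℂ) (hpos : tsupport ψ ⊆ Set.Ioi 0) (z : ℍ) :
    ∑' j, cut ψ (toPair (el j • z)) = ∑' i, ψ (rep i • z).im := by
  obtain ⟨N, hN⟩ := cut_el ψ z
  have hs : Summable fun j => cut ψ (toPair (el j • z)) := by
    apply summable_of_hasFiniteSupport
    refine ((finite_support ψ hpos z).image fun i => (i, N i)).subset ?_
    rintro ⟨i, n⟩ h
    rw [Function.mem_support, hN] at h
    split_ifs at h with hn
    · exact ⟨i, h, by rw [hn]⟩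
    · exact absurd rfl h
  rw [hs.tsum_prod]
  congr 1
  ext i
  simp only [hN]
  exact tsum_ite_eq _ _

lemma tsum_idx (ψ : ℝ → ℂ) (hpos : tsupport ψ ⊆ Set.Ioi 0) (z : ℍ) :
    ∑' i, ψ (rep i • z).im = ψ z.im + ∑' c : ℕ+, ∑' d : {d : ℤ // Int.gcd (c : ℤ) d = 1},
      ψ (z.im / Complex.normSq ((c : ℕ) * (z.re + z.im * Complex.I) + ((d : ℤ) : ℂ))) := by
  have hs : Summable fun i : Idx => ψ (rep i • z).im :=
    summable_of_hasFiniteSupport (finite_support ψ hpos z)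
  have hr := hs.comp_injective Sum.inr_injective
  have hl := hs.comp_injective Sum.inl_injective
  have := (HasSum.sum hl.hasSum hr.hasSum).tsum_eq
  rw [this, hr.tsum_sigma]
  have e : ((z.re : ℂ) + z.im * Complex.I) = z := Complex.re_add_im (z : ℂ)
  simp only [Function.comp_apply, rep_im]
  simp [row, e]

end Unfold

open Complex in
/-- Unfolding of the incomplete Eisenstein series: for `ψ` continuous and compactly
supported in `(0, ∞)`, integrating
`P(z) = ψ(y) + Σ_{c ≥ 1} Σ_{gcd(c,d)=1} ψ(y/|cz + d|²)` over the standard fundamental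
domain `𝒟 = {z = x + iy : y > 0, |z| > 1, |x| < 1/2}` against `dμz = y^{-2} dx dy` gives
`∫_𝒟 P(z) dμz = ∫₀^∞ ψ(y) y^{-2} dy`. -/
theorem stmt12 (ψ : ℝ → ℂ) (hcont : Continuous ψ) (hsupp : HasCompactSupport ψ)
    (hpos : tsupport ψ ⊆ Set.Ioi 0) :
    (∫ p in {q : ℝ × ℝ | 0 < q.2 ∧ 1 < q.1 ^ 2 + q.2 ^ 2 ∧ |q.1| < 1 / 2},
        (ψ p.2 + ∑' c : ℕ+, ∑' d : {d : ℤ // Int.gcd (c : ℤ) d = 1},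
            ψ (p.2 / Complex.normSq ((c : ℕ) * (p.1 + p.2 * I) + ((d : ℤ) : ℂ))))
          / ((p.2 : ℂ) ^ 2))
      = ∫ y in Set.Ioi (0 : ℝ), ψ y / ((y : ℂ) ^ 2) := by
  have hm : MeasurableSet {q : ℝ × ℝ | 0 < q.2 ∧ 1 < q.1 ^ 2 + q.2 ^ 2 ∧ |q.1| < 1 / 2} := by
    have h1 : IsOpen {q : ℝ × ℝ | 0 < q.2} := isOpen_lt (by fun_prop) (by fun_prop)
    have h2 : IsOpen {q : ℝ × ℝ | 1 < q.1 ^ 2 + q.2 ^ 2} := isOpen_lt (by fun_prop) (by fun_prop)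
    have h3 : IsOpen {q : ℝ × ℝ | |q.1| < 1 / 2} := isOpen_lt (by fun_prop) (by fun_prop)
    exact (h1.inter (h2.inter h3)).measurableSet
  rw [← Unfold.setIntegral_toPair (fun p => ψ p.2 + ∑' c : ℕ+,
    ∑' d : {d : ℤ // Int.gcd (c : ℤ) d = 1},
      ψ (p.2 / Complex.normSq ((c : ℕ) * (p.1 + p.2 * I) + ((d : ℤ) : ℂ)))) _ hm (fun q hq => hq.1)]
  have hset : Unfold.toPair ⁻¹' {q : ℝ × ℝ | 0 < q.2 ∧ 1 < q.1 ^ 2 + q.2 ^ 2 ∧ |q.1| < 1 / 2} =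
      ModularGroup.fdo := by
    ext z
    have e : Complex.normSq (z : ℂ) = z.re ^ 2 + z.im ^ 2 := by
      rw [Complex.normSq_apply, sq, sq]; rfl
    simp only [Unfold.toPair, Set.mem_preimage, Set.mem_setOf_eq, ModularGroup.fdo, e]
    exact ⟨fun h => h.2, fun h => ⟨z.im_pos, h⟩⟩
  rw [hset, ← Unfold.cut_integral,
    ← Unfold.unfold_integral _ (Unfold.cut_integrable ψ hcont hsupp hpos)]
  congr 1
  ext z
  rw [Unfold.tsum_cut ψ hpos, Unfold.tsum_idx ψ hpos]
  rfl
end
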